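/- Let n ≥ 3 and 0 ≤ i, j ≤ n. The linear map ι: Val_i^f ⊗ Val_j^f → BVal_{i,j}^f induced by ι(φ ⊗ ψ)(K,L) = φ(K)ψ(L) is an isomorphism of O(n)×O(n)-modules, where the superscript f denotes the subspaces of O(n)-finite (respectively O(n)×O(n)-finite) elements. -/

import Mathlib

open scoped Pointwise NNReal
noncomputable section

abbrev En (n : ℕ) : Type := EuclideanSpace ℝ (Fin n)
abbrev Body (n : ℕ) : Type := ConvexBody (En n)

/-- The special orthogonal group `SO(n)`, as a subgroup of the orthogonal group. -/
def SOGroup (n : ℕ) : Subgroup (Matrix.orthogonalGroup (Fin n) ℝ) where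
  carrier := {g | Matrix.det (g : Matrix (Fin n) (Fin n) ℝ) = 1}
  one_mem' := by simp
  mul_mem' := by
    intro a b ha hb
    simp only [Set.mem_setOf_eq] at *
    rw [Submonoid.coe_mul, Matrix.det_mul, ha, hb, mul_one]
  inv_mem' := by
    intro a ha
    simp only [Set.mem_setOf_eq] at *
    have h : ((a * a⁻¹ : Matrix.orthogonalGroup (Fin n) ℝ) : Matrix (Fin n) (Fin n) ℝ) = 1 := by
      rw [mul_inv_cancel]; rfl
    rw [Submonoid.coe_mul] at h
    have h2 := congrArg Matrix.det h
    rw [Matrix.det_mul, ha, one_mul, Matrix.det_one] at h2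
    exact h2

/-- The underlying matrix of an element of `O(n)`. -/
def OMat {n : ℕ} (g : Matrix.orthogonalGroup (Fin n) ℝ) : Matrix (Fin n) (Fin n) ℝ := g

/-- The underlying matrix of an element of `SO(n)`. -/
def SOMat {n : ℕ} (g : SOGroup n) : Matrix (Fin n) (Fin n) ℝ := ((g : Matrix.orthogonalGroup (Fin n) ℝ) : Matrix (Fin n) (Fin n) ℝ)

def mapBody {n : ℕ} (A : Matrix (Fin n) (Fin n) ℝ) (K : Body n) : Body n where
  carrier := (Matrix.toEuclideanLin A) '' (K : Set (En n))
  convex' := K.convex.linear_image _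
  isCompact' := K.isCompact.image (LinearMap.continuous_of_finiteDimensional _)
  nonempty' := K.nonempty.image _

/-- Rotation of a convex body by an element of `SO(n)`. -/
def rotBody {n : ℕ} (g : SOGroup n) (K : Body n) : Body n := mapBody (SOMat g) K

/-- Rotation of a convex body by an element of `O(n)`. -/
def rotBodyO {n : ℕ} (g : Matrix.orthogonalGroup (Fin n) ℝ) (K : Body n) : Body n := mapBody (OMat g) K

/-- The natural action of `SO(n)` on complex-valued functions of convex bodies. -/
def actVal {n : ℕ} {M : Type*} (g : SOGroup n) (φ : Body n → M) : Body n → M :=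
  fun K => φ (rotBody g⁻¹ K)

/-- Volume of a convex body. -/
def bvol {n : ℕ} (K : Body n) : ℝ := (MeasureTheory.volume (K : Set (En n))).toReal

/-- The mixed volume of an `n`-tuple of convex bodies, defined through the standard
polarization formula. -/
def mixedVol {n : ℕ} (K : Fin n → Body n) : ℝ :=
  (n.factorial : ℝ)⁻¹ * ∑ S : Finset (Fin n),
    if S.Nonempty then (-1 : ℝ) ^ (n - S.card) * bvol (∑ i ∈ S, K i) else 0

/-- The Euclidean unit ball as a convex body. -/
def unitB (n : ℕ) : Body n where
  carrier := Metric.closedBall (0 : En n) 1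
  convex' := convex_closedBall _ _
  isCompact' := isCompact_closedBall _ _
  nonempty' := ⟨0, Metric.mem_closedBall_self zero_le_one⟩

/-- The `j`-th quermassintegral `W_j(K)`: the mixed volume of `n - j` copies of `K` and
`j` copies of the unit ball. -/
def quer {n : ℕ} (j : ℕ) (K : Body n) : ℝ :=
  mixedVol (fun l => if (l : ℕ) < n - j then K else unitB n)

/-- The mixed quermassintegral `W_j(K, L)`: the mixed volume of `n - 1 - j` copies of `K`,
`j` copies of the unit ball and one copy of `L`. -/
def querM {n : ℕ} (j : ℕ) (K L : Body n) : ℝ :=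
  mixedVol (fun l => if (l : ℕ) < n - 1 - j then K else if (l : ℕ) < n - 1 then unitB n else L)

/-- The volume `κ_m` of the `m`-dimensional Euclidean unit ball. -/
def kappa (m : ℕ) : ℝ := (MeasureTheory.volume (Metric.closedBall (0 : En m) 1)).toReal

/-- The `i`-th intrinsic volume, normalized by `κ_{n-i} V_i(K) = (n choose i) W_{n-i}(K)`. -/
def intrVol {n : ℕ} (i : ℕ) (K : Body n) : ℝ :=
  (n.choose i : ℝ) * quer (n - i) K / kappa (n - i)

/-- Two convex bodies are homothetic if one is a translate of a positive dilate of the other. -/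
def Homothetic {n : ℕ} (K L : Body n) : Prop :=
  ∃ (t : ℝ) (x : En n), 0 < t ∧ (L : Set (En n)) = (fun y => x + t • y) '' (K : Set (En n))

/-- A convex body with nonempty interior. -/
def HasInterior {n : ℕ} (K : Body n) : Prop := (interior (K : Set (En n))).Nonempty


/-- The translate of a convex body by a vector. -/
def transBody {n : ℕ} (x : En n) (K : Body n) : Body n where
  carrier := (fun y => x + y) '' (K : Set (En n))
  convex' := K.convex.translate x
  isCompact' := K.isCompact.image (continuous_const.add continuous_id)
  nonempty' := K.nonempty.image _

/-- The dilate of a convex body by a real factor. -/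
def scaleBody {n : ℕ} (t : ℝ) (K : Body n) : Body n where
  carrier := t • (K : Set (En n))
  convex' := K.convex.smul t
  isCompact' := K.isCompact.smul t
  nonempty' := K.nonempty.smul_set

/-- `φ` is a valuation: additive on unions of convex bodies which are again convex bodies. -/
def IsValuation {n : ℕ} {M : Type*} [Add M] (φ : Body n → M) : Prop :=
  ∀ K L U I : Body n,
    (U : Set (En n)) = (K : Set (En n)) ∪ (L : Set (En n)) →
    (I : Set (En n)) = (K : Set (En n)) ∩ (L : Set (En n)) →
    φ K + φ L = φ U + φ I

/-- `φ` is translation invariant. -/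
def IsTransInv {n : ℕ} {M : Type*} (φ : Body n → M) : Prop :=
  ∀ (x : En n) (K : Body n), φ (transBody x K) = φ K

/-- `φ` (scalar- or vector-valued) is homogeneous of degree `i`. -/
def IsHomog {n : ℕ} {M : Type*} [SMul ℝ M] (i : ℕ) (φ : Body n → M) : Prop :=
  ∀ (t : ℝ), 0 < t → ∀ K : Body n, φ (scaleBody t K) = (t ^ i : ℝ) • φ K

/-- `φ` is a continuous, translation invariant valuation. -/
def IsContTIVal {n : ℕ} {M : Type*} [Add M] [TopologicalSpace M] (φ : Body n → M) : Prop :=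
  Continuous φ ∧ IsValuation φ ∧ IsTransInv φ

/-- `φ` is a bivaluation: a valuation in each of its two arguments. -/
def IsBival {n : ℕ} {M : Type*} [Add M] (φ : Body n → Body n → M) : Prop :=
  (∀ L : Body n, IsValuation (fun K => φ K L)) ∧ (∀ K : Body n, IsValuation (φ K))

/-- `φ` is invariant under independent translations of its two arguments. -/
def IsTransBiinv {n : ℕ} {M : Type*} (φ : Body n → Body n → M) : Prop :=
  ∀ (x y : En n) (K L : Body n), φ (transBody x K) (transBody y L) = φ K L

/-- `φ` has bidegree `(i, j)`. -/
def IsBihomog {n : ℕ} {M : Type*} [SMul ℝ M] (i j : ℕ) (φ : Body n → Body n → M) : Prop :=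
  ∀ (t s : ℝ), 0 < t → 0 < s → ∀ K L : Body n,
    φ (scaleBody t K) (scaleBody s L) = (t ^ i * s ^ j : ℝ) • φ K L

/-- `φ` is `O(n)` invariant. -/
def IsOBiinv {n : ℕ} {M : Type*} (φ : Body n → Body n → M) : Prop :=
  ∀ (g : Matrix.orthogonalGroup (Fin n) ℝ) (K L : Body n), φ (rotBodyO g K) (rotBodyO g L) = φ K L

/-- `φ` is `SO(n)` invariant. -/
def IsSOBiinv {n : ℕ} {M : Type*} (φ : Body n → Body n → M) : Prop :=
  ∀ (g : SOGroup n) (K L : Body n), φ (rotBody g K) (rotBody g L) = φ K L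

/-- `φ` is jointly continuous. -/
def ContinuousBi {n : ℕ} {M : Type*} [TopologicalSpace M] (φ : Body n → Body n → M) : Prop :=
  Continuous fun p : Body n × Body n => φ p.1 p.2

/-- A continuous translation invariant Minkowski valuation which is
homogeneous of degree `i`. -/
def IsMinkValHom {n : ℕ} (i : ℕ) (Φ : Body n → Body n) : Prop :=
  Continuous Φ ∧ IsValuation Φ ∧ IsTransInv Φ ∧
    ∀ (t : ℝ), 0 < t → ∀ K : Body n, Φ (scaleBody t K) = scaleBody (t ^ i) (Φ K)

/-- A Minkowski valuation is `SO(n)` equivariant. -/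
def IsSOEquivariant {n : ℕ} (Φ : Body n → Body n) : Prop :=
  ∀ (g : SOGroup n) (K : Body n), Φ (rotBody g K) = rotBody g (Φ K)

/-- A Minkowski valuation is `O(n)` equivariant. -/
def IsOEquivariant {n : ℕ} (Φ : Body n → Body n) : Prop :=
  ∀ (g : Matrix.orthogonalGroup (Fin n) ℝ) (K : Body n), Φ (rotBodyO g K) = rotBodyO g (Φ K)

/-- The space `Val` of continuous translation invariant complex-valued valuations,
as a subspace of the space of all functions `K^n → ℂ`. -/
def ValSub (n : ℕ) : Submodule ℂ (Body n → ℂ) where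
  carrier := {φ | IsContTIVal φ}
  zero_mem' := by
    refine ⟨continuous_const, ?_, ?_⟩
    · intro _ _ _ _ _ _; simp
    · intro _ _; rfl
  add_mem' := by
    rintro φ ψ ⟨hc1, hv1, ht1⟩ ⟨hc2, hv2, ht2⟩
    refine ⟨hc1.add hc2, ?_, ?_⟩
    · intro K L U I hU hI
      simp only [Pi.add_apply]
      linear_combination hv1 K L U I hU hI + hv2 K L U I hU hI
    · intro x K; simp only [Pi.add_apply, ht1 x K, ht2 x K]
  smul_mem' := by
    rintro c φ ⟨hc1, hv1, ht1⟩
    refine ⟨hc1.const_smul c, ?_, ?_⟩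
    · intro K L U I hU hI
      simp only [Pi.smul_apply, smul_eq_mul]
      linear_combination c * hv1 K L U I hU hI
    · intro x K; simp only [Pi.smul_apply, ht1 x K]

/-- The subspace `Val_i ⊆ Val` of continuous translation invariant valuations which are
homogeneous of degree `i`. -/
def ValI (n i : ℕ) : Submodule ℂ (Body n → ℂ) where
  carrier := {φ | IsContTIVal φ ∧ IsHomog i φ}
  zero_mem' := by
    refine ⟨(ValSub n).zero_mem, ?_⟩
    intro t ht K; simp
  add_mem' := by
    intro φ ψ ⟨h1, hh1⟩ ⟨h2, hh2⟩
    refine ⟨(ValSub n).add_mem h1 h2, ?_⟩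
    intro t ht K
    simp only [Pi.add_apply, hh1 t ht K, hh2 t ht K, smul_add]
  smul_mem' := by
    intro c φ ⟨h1, hh1⟩
    refine ⟨(ValSub n).smul_mem c h1, ?_⟩
    intro t ht K
    simp only [Pi.smul_apply, hh1 t ht K]
    rw [smul_comm]

/-- The natural action of `O(n)` on functions of convex bodies, `(ϑφ)(K) = φ(ϑ⁻¹K)`. -/
def actValO {n : ℕ} {M : Type*} (g : Matrix.orthogonalGroup (Fin n) ℝ) (φ : Body n → M) :
    Body n → M :=
  fun K => φ (rotBodyO g⁻¹ K)

/-- A function of convex bodies is `O(n)` finite if the span of its `O(n)` orbit is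
finite dimensional. -/
def IsOFinite {n : ℕ} (φ : Body n → ℂ) : Prop :=
  FiniteDimensional ℂ
    ↥(Submodule.span ℂ (Set.range fun g : Matrix.orthogonalGroup (Fin n) ℝ => actValO g φ))

/-- The subspace `Val_i^f ⊆ Val_i` of `O(n)` finite valuations. -/
def ValIf (n i : ℕ) : Submodule ℂ (Body n → ℂ) where
  carrier := {φ | φ ∈ ValI n i ∧ IsOFinite φ}
  zero_mem' := by
    refine ⟨(ValI n i).zero_mem, ?_⟩
    unfold IsOFinite
    have h : (Set.range fun g : Matrix.orthogonalGroup (Fin n) ℝ =>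
        actValO g (0 : Body n → ℂ)) ⊆ {0} := by
      rintro _ ⟨g, rfl⟩; rfl
    have hle : Submodule.span ℂ (Set.range fun g : Matrix.orthogonalGroup (Fin n) ℝ =>
        actValO g (0 : Body n → ℂ)) ≤ Submodule.span ℂ {0} :=
      Submodule.span_mono h
    rw [Submodule.span_zero_singleton] at hle
    haveI : FiniteDimensional ℂ (⊥ : Submodule ℂ (Body n → ℂ)) := inferInstance
    exact Submodule.finiteDimensional_of_le hle
  add_mem' := by
    rintro φ ψ ⟨hm1, hf1⟩ ⟨hm2, hf2⟩
    refine ⟨(ValI n i).add_mem hm1 hm2, ?_⟩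
    unfold IsOFinite at *
    set S1 := Submodule.span ℂ (Set.range fun g : Matrix.orthogonalGroup (Fin n) ℝ => actValO g φ)
    set S2 := Submodule.span ℂ (Set.range fun g : Matrix.orthogonalGroup (Fin n) ℝ => actValO g ψ)
    haveI := hf1; haveI := hf2
    have hle : Submodule.span ℂ (Set.range fun g : Matrix.orthogonalGroup (Fin n) ℝ =>
        actValO g (φ + ψ)) ≤ S1 ⊔ S2 := by
      rw [Submodule.span_le]
      rintro _ ⟨g, rfl⟩
      show actValO g (φ + ψ) ∈ ↑(S1 ⊔ S2)
      have h : actValO g (φ + ψ) = actValO g φ + actValO g ψ := rfl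
      rw [h]
      exact Submodule.add_mem _
        (Submodule.mem_sup_left (Submodule.subset_span ⟨g, rfl⟩))
        (Submodule.mem_sup_right (Submodule.subset_span ⟨g, rfl⟩))
    exact Submodule.finiteDimensional_of_le hle
  smul_mem' := by
    rintro c φ ⟨hm1, hf1⟩
    refine ⟨(ValI n i).smul_mem c hm1, ?_⟩
    unfold IsOFinite at *
    haveI := hf1
    have hle : Submodule.span ℂ (Set.range fun g : Matrix.orthogonalGroup (Fin n) ℝ =>
        actValO g (c • φ)) ≤
        Submodule.span ℂ (Set.range fun g : Matrix.orthogonalGroup (Fin n) ℝ => actValO g φ) := by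
      rw [Submodule.span_le]
      rintro _ ⟨g, rfl⟩
      show actValO g (c • φ) ∈
        ↑(Submodule.span ℂ (Set.range fun g : Matrix.orthogonalGroup (Fin n) ℝ => actValO g φ))
      have h : actValO g (c • φ) = c • actValO g φ := rfl
      rw [h]
      exact Submodule.smul_mem _ c (Submodule.subset_span ⟨g, rfl⟩)
    exact Submodule.finiteDimensional_of_le hle

/-- The space `BVal` of continuous translation biinvariant complex-valued bivaluations,
as a subspace of the space of all functions `K^n × K^n → ℂ`. -/
def BValSub (n : ℕ) : Submodule ℂ (Body n → Body n → ℂ) where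
  carrier := {φ | ContinuousBi φ ∧ IsBival φ ∧ IsTransBiinv φ}
  zero_mem' := by
    refine ⟨continuous_const, ⟨?_, ?_⟩, ?_⟩
    · intro _ _ _ _ _ _ _; simp
    · intro _ _ _ _ _ _ _; simp
    · intro _ _ _ _; simp
  add_mem' := by
    rintro φ ψ ⟨hc1, ⟨hv1a, hv1b⟩, ht1⟩ ⟨hc2, ⟨hv2a, hv2b⟩, ht2⟩
    refine ⟨hc1.add hc2, ⟨fun L => ?_, fun K => ?_⟩, fun x y K L => ?_⟩
    · intro K1 K2 U I hU hI
      simp only [Pi.add_apply]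
      linear_combination hv1a L K1 K2 U I hU hI + hv2a L K1 K2 U I hU hI
    · intro L1 L2 U I hU hI
      simp only [Pi.add_apply]
      linear_combination hv1b K L1 L2 U I hU hI + hv2b K L1 L2 U I hU hI
    · simp only [Pi.add_apply, ht1 x y K L, ht2 x y K L]
  smul_mem' := by
    rintro c φ ⟨hc1, ⟨hv1a, hv1b⟩, ht1⟩
    refine ⟨hc1.const_smul c, ⟨fun L => ?_, fun K => ?_⟩, fun x y K L => ?_⟩
    · intro K1 K2 U I hU hI
      simp only [Pi.smul_apply, smul_eq_mul]
      linear_combination c * hv1a L K1 K2 U I hU hI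
    · intro L1 L2 U I hU hI
      simp only [Pi.smul_apply, smul_eq_mul]
      linear_combination c * hv1b K L1 L2 U I hU hI
    · simp only [Pi.smul_apply, ht1 x y K L]


/-- The action of `O(n) × O(n)` on functions of pairs of convex bodies. -/
def actBValOO {n : ℕ} {M : Type*} (g h : Matrix.orthogonalGroup (Fin n) ℝ)
    (φ : Body n → Body n → M) : Body n → Body n → M :=
  fun K L => φ (rotBodyO g⁻¹ K) (rotBodyO h⁻¹ L)

/-- A bivaluation is `O(n) × O(n)` finite if the span of its orbit is finite dimensional. -/
def IsOOFinite {n : ℕ} (φ : Body n → Body n → ℂ) : Prop :=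
  FiniteDimensional ℂ
    ↥(Submodule.span ℂ (Set.range fun p :
        Matrix.orthogonalGroup (Fin n) ℝ × Matrix.orthogonalGroup (Fin n) ℝ =>
          actBValOO p.1 p.2 φ))

/-- The subspace `BVal_{i,j}^f` of `O(n) × O(n)` finite continuous translation biinvariant
bivaluations of bidegree `(i,j)`. -/
def BValIJf (n i j : ℕ) : Submodule ℂ (Body n → Body n → ℂ) where
  carrier := {φ | φ ∈ BValSub n ∧ IsBihomog i j φ ∧ IsOOFinite φ}
  zero_mem' := by
    refine ⟨(BValSub n).zero_mem, by intro t s ht hs K L; simp, ?_⟩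
    unfold IsOOFinite
    have hle : Submodule.span ℂ (Set.range fun p :
        Matrix.orthogonalGroup (Fin n) ℝ × Matrix.orthogonalGroup (Fin n) ℝ =>
          actBValOO p.1 p.2 (0 : Body n → Body n → ℂ)) ≤ Submodule.span ℂ {0} :=
      Submodule.span_mono (by rintro _ ⟨p, rfl⟩; rfl)
    rw [Submodule.span_zero_singleton] at hle
    exact Submodule.finiteDimensional_of_le hle
  add_mem' := by
    rintro φ ψ ⟨hm1, hd1, hf1⟩ ⟨hm2, hd2, hf2⟩
    refine ⟨(BValSub n).add_mem hm1 hm2, ?_, ?_⟩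
    · intro t s ht hs K L
      simp only [Pi.add_apply, hd1 t s ht hs K L, hd2 t s ht hs K L, smul_add]
    · unfold IsOOFinite at *
      set S1 := Submodule.span ℂ (Set.range fun p :
        Matrix.orthogonalGroup (Fin n) ℝ × Matrix.orthogonalGroup (Fin n) ℝ =>
          actBValOO p.1 p.2 φ)
      set S2 := Submodule.span ℂ (Set.range fun p :
        Matrix.orthogonalGroup (Fin n) ℝ × Matrix.orthogonalGroup (Fin n) ℝ =>
          actBValOO p.1 p.2 ψ)
      haveI := hf1; haveI := hf2
      have hle : Submodule.span ℂ (Set.range fun p :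
          Matrix.orthogonalGroup (Fin n) ℝ × Matrix.orthogonalGroup (Fin n) ℝ =>
            actBValOO p.1 p.2 (φ + ψ)) ≤ S1 ⊔ S2 := by
        rw [Submodule.span_le]
        rintro _ ⟨p, rfl⟩
        show actBValOO p.1 p.2 (φ + ψ) ∈ ↑(S1 ⊔ S2)
        have h : actBValOO p.1 p.2 (φ + ψ) = actBValOO p.1 p.2 φ + actBValOO p.1 p.2 ψ := rfl
        rw [h]
        exact Submodule.add_mem _
          (Submodule.mem_sup_left (Submodule.subset_span ⟨p, rfl⟩))
          (Submodule.mem_sup_right (Submodule.subset_span ⟨p, rfl⟩))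
      exact Submodule.finiteDimensional_of_le hle
  smul_mem' := by
    rintro c φ ⟨hm1, hd1, hf1⟩
    refine ⟨(BValSub n).smul_mem c hm1, ?_, ?_⟩
    · intro t s ht hs K L
      simp only [Pi.smul_apply, hd1 t s ht hs K L]
      rw [smul_comm]
    · unfold IsOOFinite at *
      haveI := hf1
      have hle : Submodule.span ℂ (Set.range fun p :
          Matrix.orthogonalGroup (Fin n) ℝ × Matrix.orthogonalGroup (Fin n) ℝ =>
            actBValOO p.1 p.2 (c • φ)) ≤
          Submodule.span ℂ (Set.range fun p :
            Matrix.orthogonalGroup (Fin n) ℝ × Matrix.orthogonalGroup (Fin n) ℝ =>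
              actBValOO p.1 p.2 φ) := by
        rw [Submodule.span_le]
        rintro _ ⟨p, rfl⟩
        show actBValOO p.1 p.2 (c • φ) ∈ _
        have h : actBValOO p.1 p.2 (c • φ) = c • actBValOO p.1 p.2 φ := rfl
        rw [h]
        exact Submodule.smul_mem _ c (Submodule.subset_span ⟨p, rfl⟩)
      exact Submodule.finiteDimensional_of_le hle

/-- The bilinear map `(φ, ψ) ↦ ((K,L) ↦ φ(K)ψ(L))` on `O(n)` finite valuations. -/
def biProd (n i j : ℕ) :
    ↥(ValIf n i) →ₗ[ℂ] ↥(ValIf n j) →ₗ[ℂ] (Body n → Body n → ℂ) :=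
  LinearMap.mk₂ ℂ (fun φ ψ => fun K L => (φ : Body n → ℂ) K * (ψ : Body n → ℂ) L)
    (by intro m₁ m₂ ψ; funext K L; simp only [Submodule.coe_add, Pi.add_apply]; ring)
    (by intro c m ψ; funext K L; simp only [Submodule.coe_smul, Pi.smul_apply, smul_eq_mul]; ring)
    (by intro m ψ₁ ψ₂; funext K L; simp only [Submodule.coe_add, Pi.add_apply]; ring)
    (by intro c m ψ; funext K L; simp only [Submodule.coe_smul, Pi.smul_apply, smul_eq_mul]; ring)

namespace BodyVal

open Filter Topology
open scoped RealInnerProductSpace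

/-- The support function of a convex body. -/
def suppF {n : ℕ} (K : Body n) (u : En n) : ℝ := sSup ((fun x => ⟪x, u⟫) '' (K : Set (En n)))

section Support

variable {n : ℕ}

theorem isCompact_inner_image (K : Body n) (u : En n) :
    IsCompact ((fun x => ⟪x, u⟫) '' (K : Set (En n))) :=
  K.isCompact.image (continuous_id.inner continuous_const)

theorem inner_le_suppF {K : Body n} {x : En n} (hx : x ∈ K) (u : En n) : ⟪x, u⟫ ≤ suppF K u :=
  le_csSup (isCompact_inner_image K u).bddAbove ⟨x, hx, rfl⟩

theorem exists_inner_eq_suppF (K : Body n) (u : En n) : ∃ x ∈ K, ⟪x, u⟫ = suppF K u := by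
  obtain ⟨x, hx, h⟩ := (isCompact_inner_image K u).sSup_mem (K.nonempty.image _)
  exact ⟨x, hx, h⟩

theorem suppF_le {K : Body n} {u : En n} {c : ℝ} (h : ∀ x ∈ K, ⟪x, u⟫ ≤ c) : suppF K u ≤ c := by
  obtain ⟨x, hx, e⟩ := exists_inner_eq_suppF K u
  exact e ▸ h x hx

theorem suppF_eq {K : Body n} {u : En n} {c : ℝ} (h : ∀ x ∈ K, ⟪x, u⟫ ≤ c)
    (h' : ∃ x ∈ K, ⟪x, u⟫ = c) : suppF K u = c := by
  refine le_antisymm (suppF_le h) ?_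
  obtain ⟨x, hx, e⟩ := h'
  exact e ▸ inner_le_suppF hx u

theorem suppF_add (K L : Body n) (u : En n) : suppF (K + L) u = suppF K u + suppF L u := by
  apply suppF_eq
  · rintro _ ⟨x, hx, y, hy, rfl⟩
    simp only [inner_add_left]
    exact add_le_add (inner_le_suppF hx u) (inner_le_suppF hy u)
  · obtain ⟨x, hx, e⟩ := exists_inner_eq_suppF K u
    obtain ⟨y, hy, e'⟩ := exists_inner_eq_suppF L u
    exact ⟨x + y, ⟨x, hx, y, hy, rfl⟩, by rw [inner_add_left, e, e']⟩

@[simp] theorem suppF_zero (u : En n) : suppF (0 : Body n) u = 0 := by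
  apply suppF_eq
  · rintro _ rfl
    simp
  · exact ⟨0, rfl, by simp⟩

theorem suppF_smul (t : ℝ) (K : Body n) (u : En n) : suppF (t • K) u = suppF K (t • u) := by
  apply suppF_eq
  · rintro _ ⟨x, hx, rfl⟩
    simpa [inner_smul_left, inner_smul_right] using inner_le_suppF hx (t • u)
  · obtain ⟨x, hx, e⟩ := exists_inner_eq_suppF K (t • u)
    exact ⟨t • x, ⟨x, hx, rfl⟩, by rw [← e]; simp [inner_smul_left, inner_smul_right]⟩

theorem suppF_smul_right {t : ℝ} (ht : 0 ≤ t) (K : Body n) (u : En n) :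
    suppF K (t • u) = t * suppF K u := by
  apply suppF_eq
  · intro x hx
    rw [inner_smul_right]
    exact mul_le_mul_of_nonneg_left (inner_le_suppF hx u) ht
  · obtain ⟨x, hx, e⟩ := exists_inner_eq_suppF K u
    exact ⟨x, hx, by rw [← e, inner_smul_right]⟩

theorem suppF_smul_of_nonneg {t : ℝ} (ht : 0 ≤ t) (K : Body n) (u : En n) :
    suppF (t • K) u = t * suppF K u := by
  rw [suppF_smul, suppF_smul_right ht]

theorem suppF_mapBody (A : Matrix (Fin n) (Fin n) ℝ) (K : Body n) (u : En n) :
    suppF (mapBody A K) u = suppF K (Matrix.toEuclideanLin A.transpose u) := by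
  have key : ∀ x : En n, ⟪Matrix.toEuclideanLin A x, u⟫
      = ⟪x, Matrix.toEuclideanLin A.transpose u⟫ := by
    intro x
    have h := Matrix.toEuclideanLin_conjTranspose_eq_adjoint A
    rw [Matrix.conjTranspose_eq_transpose_of_trivial] at h
    rw [h, LinearMap.adjoint_inner_right]
  apply suppF_eq
  · rintro _ ⟨x, hx, rfl⟩
    rw [key]
    exact inner_le_suppF hx _
  · obtain ⟨x, hx, e⟩ := exists_inner_eq_suppF K (Matrix.toEuclideanLin A.transpose u)
    exact ⟨_, ⟨x, hx, rfl⟩, by rw [← e, key]⟩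

theorem mem_of_inner_le_suppF {K : Body n} {x : En n}
    (h : ∀ u : En n, ‖u‖ = 1 → ⟪x, u⟫ ≤ suppF K u) : x ∈ K := by
  by_contra hx
  obtain ⟨f, s, hs, hK⟩ := geometric_hahn_banach_point_closed K.convex K.isClosed hx
  set v : En n := -(InnerProductSpace.toDual ℝ (En n)).symm f with hv
  have hf : ∀ y, ⟪y, v⟫ = - f y := by
    intro y
    rw [hv, inner_neg_right, real_inner_comm, InnerProductSpace.toDual_symm_apply]
  have hv0 : v ≠ 0 := by
    intro h0
    obtain ⟨y, hy⟩ := K.nonempty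
    have h1 := hf x
    have h2 := hf y
    rw [h0, inner_zero_right] at h1 h2
    have := hK y hy
    linarith
  have hpos : 0 < ‖v‖ := norm_pos_iff.2 hv0
  have h1 := h (‖v‖⁻¹ • v) (by rw [norm_smul, norm_inv, norm_norm, inv_mul_cancel₀ hpos.ne'])
  rw [suppF_smul_right (inv_nonneg.2 hpos.le), inner_smul_right] at h1
  have h2 := le_of_mul_le_mul_left h1 (inv_pos.2 hpos)
  obtain ⟨y, hy, e⟩ := exists_inner_eq_suppF K v
  rw [← e, hf, hf] at h2
  have := hK y hy
  linarith

theorem subset_of_suppF_le {K L : Body n}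
    (h : ∀ u : En n, ‖u‖ = 1 → suppF K u ≤ suppF L u) : (K : Set (En n)) ⊆ L :=
  fun _ hx => mem_of_inner_le_suppF fun u hu => (inner_le_suppF hx u).trans (h u hu)

theorem suppF_mono {K L : Body n} (h : (K : Set (En n)) ⊆ L) (u : En n) :
    suppF K u ≤ suppF L u := suppF_le fun _ hx => inner_le_suppF (h hx) u

theorem body_ext {K L : Body n} (h : ∀ u : En n, ‖u‖ = 1 → suppF K u = suppF L u) : K = L :=
  ConvexBody.ext (Set.Subset.antisymm (subset_of_suppF_le fun u hu => (h u hu).le)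
    (subset_of_suppF_le fun u hu => (h u hu).ge))

theorem suppF_unitB {u : En n} (hu : ‖u‖ = 1) : suppF (unitB n) u = 1 := by
  apply suppF_eq
  · intro x hx
    have hx' : ‖x‖ ≤ 1 := by simpa using (mem_closedBall_zero_iff.1 hx)
    calc ⟪x, u⟫ ≤ ‖x‖ * ‖u‖ := real_inner_le_norm x u
      _ ≤ 1 := by rw [hu, mul_one]; exact hx'
  · exact ⟨u, mem_closedBall_zero_iff.2 hu.le, by rw [real_inner_self_eq_norm_sq, hu]; norm_num⟩

theorem dist_le_of_suppF {K L : Body n} {ε : ℝ} (hε : 0 ≤ ε)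
    (h : ∀ u : En n, ‖u‖ = 1 → |suppF K u - suppF L u| ≤ ε) : dist K L ≤ ε := by
  have aux : ∀ {K L : Body n}, (∀ u : En n, ‖u‖ = 1 → suppF K u - suppF L u ≤ ε) →
      ∀ x ∈ (K : Set (En n)), ∃ y ∈ (L : Set (En n)), dist x y ≤ ε := by
    intro K L h x hx
    have hsub : (K : Set (En n)) ⊆ (L + ε • unitB n : Body n) := by
      apply subset_of_suppF_le
      intro u hu
      rw [suppF_add, suppF_smul_of_nonneg hε, suppF_unitB hu]
      linarith [h u hu]
    obtain ⟨y, hy, _, ⟨z, hz, rfl⟩, rfl⟩ := hsub hx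
    refine ⟨y, hy, ?_⟩
    have hz' : ‖z‖ ≤ 1 := by simpa using (mem_closedBall_zero_iff.1 hz)
    simp only [dist_eq_norm, add_sub_cancel_left, norm_smul, Real.norm_eq_abs, abs_of_nonneg hε]
    exact mul_le_of_le_one_right hε hz'
  rw [← ConvexBody.hausdorffDist_coe]
  refine Metric.hausdorffDist_le_of_mem_dist hε (aux fun u hu => (abs_le.1 (h u hu)).2)
    (aux fun u hu => ?_)
  have := (abs_le.1 (h u hu)).1
  linarith

theorem suppF_sub_le_dist (K L : Body n) (u : En n) :
    |suppF K u - suppF L u| ≤ dist K L * ‖u‖ := by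
  have aux : ∀ K L : Body n, suppF K u - suppF L u ≤ dist K L * ‖u‖ := by
    intro K L
    obtain ⟨x, hx, e⟩ := exists_inner_eq_suppF K u
    rw [← e]
    refine le_of_forall_pos_le_add fun ε hε => ?_
    have hδ : 0 < ε / (‖u‖ + 1) := by positivity
    obtain ⟨y, hy, hxy⟩ := Metric.exists_dist_lt_of_hausdorffDist_lt
      (r := dist K L + ε / (‖u‖ + 1)) (s := (K : Set (En n))) (t := (L : Set (En n))) hx
      (by rw [ConvexBody.hausdorffDist_coe]; linarith) ConvexBody.hausdorffEDist_ne_top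
    have h1 := inner_le_suppF hy u
    have h2 : ⟪x, u⟫ - ⟪y, u⟫ ≤ dist x y * ‖u‖ := by
      rw [← inner_sub_left, dist_eq_norm]
      exact real_inner_le_norm _ _
    have h3 : dist x y * ‖u‖ ≤ (dist K L + ε / (‖u‖ + 1)) * ‖u‖ :=
      mul_le_mul_of_nonneg_right hxy.le (norm_nonneg u)
    have h4 : ε / (‖u‖ + 1) * ‖u‖ ≤ ε := by
      rw [div_mul_eq_mul_div, div_le_iff₀ (by positivity)]
      nlinarith [norm_nonneg u]
    nlinarith
  rw [abs_le]
  have h1 := aux K L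
  have h2 := aux L K
  rw [dist_comm] at h2
  constructor <;> linarith

theorem dist_add_add_le_body (K L K' L' : Body n) :
    dist (K + L) (K' + L') ≤ dist K K' + dist L L' := by
  refine dist_le_of_suppF (by positivity) fun u hu => ?_
  have h1 := suppF_sub_le_dist K K' u
  have h2 := suppF_sub_le_dist L L' u
  rw [hu, mul_one] at h1 h2
  rw [suppF_add, suppF_add, show ∀ a b c d : ℝ, a + b - (c + d) = (a - c) + (b - d) by intros; ring]
  exact (abs_add_le _ _).trans (add_le_add h1 h2)

theorem continuous_body_add : Continuous fun p : Body n × Body n => p.1 + p.2 := by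
  rw [Metric.continuous_iff]
  rintro ⟨K, L⟩ ε hε
  refine ⟨ε / 2, by positivity, ?_⟩
  rintro ⟨K', L'⟩ h
  rw [Prod.dist_eq, max_lt_iff] at h
  exact (dist_add_add_le_body _ _ _ _).trans_lt (by linarith [h.1, h.2])

instance : ContinuousAdd (Body n) := ⟨continuous_body_add⟩

theorem exists_norm_le (K : Body n) : ∃ R : ℝ, 0 < R ∧ ∀ x ∈ K, ‖x‖ ≤ R := by
  obtain ⟨R, h, h'⟩ := K.isBounded.exists_pos_norm_le
  exact ⟨R, h, h'⟩

theorem continuous_smul_body (K : Body n) : Continuous fun t : ℝ => t • K := by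
  obtain ⟨R, hR, hK⟩ := exists_norm_le K
  have aux : ∀ s t : ℝ, ∀ u : En n, ‖u‖ = 1 →
      suppF K (s • u) - suppF K (t • u) ≤ R * dist s t := by
    intro s t u hu
    obtain ⟨x, hx, e⟩ := exists_inner_eq_suppF K (s • u)
    have h1 := inner_le_suppF hx (t • u)
    rw [inner_smul_right] at h1 e
    have h2 : (s - t) * ⟪x, u⟫ ≤ dist s t * R := by
      refine (le_abs_self _).trans ?_
      rw [abs_mul, Real.dist_eq]
      refine mul_le_mul_of_nonneg_left ((abs_real_inner_le_norm x u).trans ?_) (abs_nonneg _)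
      rw [hu, mul_one]
      exact hK x hx
    nlinarith
  refine LipschitzWith.continuous (K := R.toNNReal) (LipschitzWith.of_dist_le_mul fun s t => ?_)
  rw [Real.coe_toNNReal R hR.le]
  refine dist_le_of_suppF (mul_nonneg hR.le dist_nonneg) fun u hu => ?_
  rw [suppF_smul, suppF_smul, abs_le]
  have h1 := aux s t u hu
  have h2 := aux t s u hu
  rw [dist_comm] at h2
  exact ⟨by linarith, h1⟩

theorem exists_body_suppF {f : En n → ℝ} {C : ℝ} (hC : ∀ u : En n, ‖u‖ = 1 → f u ≤ C)
    (h : ∀ q : En n, ‖q‖ = 1 → ∃ x : En n, (∀ u : En n, ‖u‖ = 1 → ⟪x, u⟫ ≤ f u) ∧ ⟪x, q⟫ = f q) :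
    ∃ K : Body n, ∀ u : En n, ‖u‖ = 1 → suppF K u = f u := by
  by_cases hne : ∃ q : En n, ‖q‖ = 1
  swap
  · exact ⟨0, fun u hu => (hne ⟨u, hu⟩).elim⟩
  obtain ⟨q, hq⟩ := hne
  let s : Set (En n) := {x | ∀ u : En n, ‖u‖ = 1 → ⟪x, u⟫ ≤ f u}
  have hclosed : IsClosed s := by
    have : s = ⋂ (u : En n) (_ : ‖u‖ = 1), {x | ⟪x, u⟫ ≤ f u} := by
      ext x; simp [s]
    rw [this]
    exact isClosed_iInter fun u => isClosed_iInter fun _ =>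
      isClosed_le (continuous_id.inner continuous_const) continuous_const
  have hconv : Convex ℝ s := by
    intro x hx y hy a b ha hb hab u hu
    rw [inner_add_left, inner_smul_left, inner_smul_left]
    simp only [conj_trivial]
    calc a * ⟪x, u⟫ + b * ⟪y, u⟫ ≤ a * f u + b * f u :=
          add_le_add (mul_le_mul_of_nonneg_left (hx u hu) ha)
            (mul_le_mul_of_nonneg_left (hy u hu) hb)
      _ = f u := by rw [← add_mul, hab, one_mul]
  have hbdd : s ⊆ Metric.closedBall 0 (max C 0) := by
    intro x hx
    rw [mem_closedBall_zero_iff]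
    by_cases h0 : x = 0
    · simp [h0]
    have hp : 0 < ‖x‖ := norm_pos_iff.2 h0
    have hu : ‖‖x‖⁻¹ • x‖ = 1 := by rw [norm_smul, norm_inv, norm_norm, inv_mul_cancel₀ hp.ne']
    have h1 := (hx _ hu).trans (hC _ hu)
    rw [inner_smul_right, real_inner_self_eq_norm_sq, pow_two, inv_mul_cancel_left₀ hp.ne'] at h1
    exact h1.trans (le_max_left _ _)
  obtain ⟨x0, hx0, -⟩ := h q hq
  let K : Body n := ⟨s, hconv, (isCompact_closedBall _ _).of_isClosed_subset hclosed hbdd, ⟨x0, hx0⟩⟩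
  refine ⟨K, fun u hu => suppF_eq (fun x hx => hx u hu) ?_⟩
  obtain ⟨x, hx, e⟩ := h u hu
  exact ⟨x, hx, e⟩

theorem exists_body_max (K L : Body n) :
    ∃ M : Body n, ∀ u : En n, ‖u‖ = 1 → suppF M u = max (suppF K u) (suppF L u) := by
  obtain ⟨R, -, hR⟩ := exists_norm_le K
  obtain ⟨R', -, hR'⟩ := exists_norm_le L
  have hb : ∀ (K : Body n) (R : ℝ), (∀ x ∈ K, ‖x‖ ≤ R) → ∀ u : En n, ‖u‖ = 1 → suppF K u ≤ R := by
    intro K R hR u hu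
    refine suppF_le fun x hx => (real_inner_le_norm x u).trans ?_
    rw [hu, mul_one]
    exact hR x hx
  refine exists_body_suppF (C := max R R')
    (fun u hu => max_le_max (hb K R hR u hu) (hb L R' hR' u hu)) fun q hq => ?_
  rcases le_total (suppF K q) (suppF L q) with h | h
  · obtain ⟨x, hx, e⟩ := exists_inner_eq_suppF L q
    exact ⟨x, fun u _ => (inner_le_suppF hx u).trans (le_max_right _ _), by
      rw [e, max_eq_right h]⟩
  · obtain ⟨x, hx, e⟩ := exists_inner_eq_suppF K q
    exact ⟨x, fun u _ => (inner_le_suppF hx u).trans (le_max_left _ _), by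
      rw [e, max_eq_left h]⟩

theorem abs_suppF_le {K : Body n} {R : ℝ} (hR : ∀ x ∈ K, ‖x‖ ≤ R) {u : En n} (hu : ‖u‖ = 1) :
    |suppF K u| ≤ R := by
  obtain ⟨x, hx, e⟩ := exists_inner_eq_suppF K u
  rw [← e]
  refine (abs_real_inner_le_norm x u).trans ?_
  rw [hu, mul_one]
  exact hR x hx

theorem scaleBody_eq (t : ℝ) (K : Body n) : scaleBody t K = t • K := rfl

end Support

section Cutting

variable {n : ℕ} {ι : Type*} [Fintype ι]

open Classical in
/-- The value of `φ` on the body `π(Λ) + L`, and `0` if `Λ` is not a convex body. -/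
def cutVal (φ : Body n → ℂ) (π : (ι → ℝ) →ₗ[ℝ] En n) (L : Body n) (Λ : Set (ι → ℝ)) : ℂ :=
  if h : Convex ℝ Λ ∧ IsCompact Λ ∧ Λ.Nonempty then
    φ ⟨π '' Λ + L, (h.1.linear_image π).add L.convex,
      (h.2.1.image (LinearMap.continuous_of_finiteDimensional π)).add L.isCompact,
      (h.2.2.image π).add L.nonempty⟩
  else 0

theorem cutVal_empty (φ : Body n → ℂ) (π : (ι → ℝ) →ₗ[ℝ] En n) (L : Body n) :
    cutVal φ π L ∅ = 0 := by
  rw [cutVal, dif_neg]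
  rintro ⟨-, -, h⟩
  exact Set.not_nonempty_empty h

theorem cutVal_eq (φ : Body n → ℂ) (π : (ι → ℝ) →ₗ[ℝ] En n) (L : Body n) {Λ : Set (ι → ℝ)}
    (h1 : Convex ℝ Λ) (h2 : IsCompact Λ) (h3 : Λ.Nonempty) (B : Body n)
    (hB : (B : Set (En n)) = π '' Λ + L) : cutVal φ π L Λ = φ B := by
  rw [cutVal, dif_pos ⟨h1, h2, h3⟩]
  congr 1
  exact ConvexBody.ext hB.symm

theorem exists_cutBody (π : (ι → ℝ) →ₗ[ℝ] En n) (L : Body n) {Λ : Set (ι → ℝ)}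
    (h1 : Convex ℝ Λ) (h2 : IsCompact Λ) (h3 : Λ.Nonempty) :
    ∃ B : Body n, (B : Set (En n)) = π '' Λ + L :=
  ⟨⟨π '' Λ + L, (h1.linear_image π).add L.convex,
      (h2.image (LinearMap.continuous_of_finiteDimensional π)).add L.isCompact,
      (h3.image π).add L.nonempty⟩, rfl⟩

/-- A level set of a coordinate meets any segment joining the two half spaces. -/
theorem exists_convex_comb_eq {a b h : ℝ} (ha : h ≤ a) (hb : b ≤ h) :
    ∃ r s : ℝ, 0 ≤ r ∧ 0 ≤ s ∧ r + s = 1 ∧ r * a + s * b = h := by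
  by_cases hab : a = b
  · exact ⟨1, 0, zero_le_one, le_rfl, by ring, by linarith⟩
  have hlt : 0 < a - b := lt_of_le_of_ne (by linarith) (fun h => hab (by linarith))
  refine ⟨(h - b) / (a - b), (a - h) / (a - b), div_nonneg (by linarith) hlt.le,
    div_nonneg (by linarith) hlt.le, ?_, ?_⟩
  · field_simp
    ring
  · field_simp
    ring

theorem cutVal_cut {φ : Body n → ℂ} (hφ : IsValuation φ) (π : (ι → ℝ) →ₗ[ℝ] En n) (L : Body n)
    {Λ : Set (ι → ℝ)} (h1 : Convex ℝ Λ) (h2 : IsCompact Λ) (k : ι) (h : ℝ) :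
    cutVal φ π L (Λ ∩ {x | h ≤ x k}) + cutVal φ π L (Λ ∩ {x | x k ≤ h})
      = cutVal φ π L Λ + cutVal φ π L (Λ ∩ {x | x k = h}) := by
  have hlin : IsLinearMap ℝ fun x : ι → ℝ => x k := ⟨fun _ _ => rfl, fun _ _ => rfl⟩
  by_cases hA : (Λ ∩ {x | h ≤ x k}).Nonempty
  swap
  · rw [Set.not_nonempty_iff_eq_empty] at hA
    have e1 : Λ ∩ {x | x k ≤ h} = Λ := by
      refine Set.inter_eq_left.2 fun x hx => ?_
      by_contra hc
      have hc' : h < x k := not_le.1 hc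
      exact (Set.eq_empty_iff_forall_notMem.1 hA x) ⟨hx, hc'.le⟩
    have e2 : Λ ∩ {x | x k = h} = ∅ := by
      refine Set.eq_empty_iff_forall_notMem.2 fun x hx => ?_
      exact (Set.eq_empty_iff_forall_notMem.1 hA x) ⟨hx.1, hx.2.ge⟩
    rw [hA, e1, e2, add_comm]
  by_cases hB : (Λ ∩ {x | x k ≤ h}).Nonempty
  swap
  · rw [Set.not_nonempty_iff_eq_empty] at hB
    have e1 : Λ ∩ {x | h ≤ x k} = Λ := by
      refine Set.inter_eq_left.2 fun x hx => ?_
      by_contra hc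
      have hc' : x k < h := not_le.1 hc
      exact (Set.eq_empty_iff_forall_notMem.1 hB x) ⟨hx, hc'.le⟩
    have e2 : Λ ∩ {x | x k = h} = ∅ := by
      refine Set.eq_empty_iff_forall_notMem.2 fun x hx => ?_
      exact (Set.eq_empty_iff_forall_notMem.1 hB x) ⟨hx.1, hx.2.le⟩
    rw [hB, e1, e2]
  have cross : ∀ a ∈ Λ ∩ {x | h ≤ x k}, ∀ b ∈ Λ ∩ {x | x k ≤ h}, ∃ r s : ℝ, 0 ≤ r ∧ 0 ≤ s ∧
      r + s = 1 ∧ r • a + s • b ∈ Λ ∩ {x | x k = h} := by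
    rintro a ⟨ha, ha'⟩ b ⟨hb, hb'⟩
    obtain ⟨r, s, hr, hs, hrs, e⟩ := exists_convex_comb_eq ha' hb'
    exact ⟨r, s, hr, hs, hrs, h1 ha hb hr hs hrs, by simpa using e⟩
  have hC : (Λ ∩ {x | x k = h}).Nonempty := by
    obtain ⟨a, ha⟩ := hA
    obtain ⟨b, hb⟩ := hB
    obtain ⟨r, s, -, -, -, hm⟩ := cross a ha b hb
    exact ⟨_, hm⟩
  have hk : Continuous fun x : ι → ℝ => x k := continuous_apply k
  have cA : Convex ℝ (Λ ∩ {x | h ≤ x k}) := h1.inter (convex_halfSpace_ge hlin h)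
  have cB : Convex ℝ (Λ ∩ {x | x k ≤ h}) := h1.inter (convex_halfSpace_le hlin h)
  have cC : Convex ℝ (Λ ∩ {x | x k = h}) := h1.inter (convex_hyperplane hlin h)
  have kA : IsCompact (Λ ∩ {x | h ≤ x k}) := h2.inter_right (isClosed_le continuous_const hk)
  have kB : IsCompact (Λ ∩ {x | x k ≤ h}) := h2.inter_right (isClosed_le hk continuous_const)
  have kC : IsCompact (Λ ∩ {x | x k = h}) := h2.inter_right (isClosed_eq hk continuous_const)
  have hN : Λ.Nonempty := hA.mono Set.inter_subset_left
  obtain ⟨A, eA⟩ := exists_cutBody π L cA kA hA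
  obtain ⟨B, eB⟩ := exists_cutBody π L cB kB hB
  obtain ⟨C, eC⟩ := exists_cutBody π L cC kC hC
  obtain ⟨D, eD⟩ := exists_cutBody π L h1 h2 hN
  rw [cutVal_eq φ π L cA kA hA A eA, cutVal_eq φ π L cB kB hB B eB, cutVal_eq φ π L cC kC hC C eC,
    cutVal_eq φ π L h1 h2 hN D eD]
  apply hφ
  · rw [eA, eB, eD, ← Set.union_add, ← Set.image_union, ← Set.inter_union_distrib_left]
    congr 2
    symm
    exact Set.inter_eq_left.2 fun x _ => le_total h (x k)
  · rw [eA, eB, eC]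
    apply Set.Subset.antisymm
    · rintro _ ⟨_, ⟨x, hx, rfl⟩, l, hl, rfl⟩
      exact ⟨⟨_, ⟨x, ⟨hx.1, hx.2.ge⟩, rfl⟩, l, hl, rfl⟩, ⟨_, ⟨x, ⟨hx.1, hx.2.le⟩, rfl⟩, l, hl, rfl⟩⟩
    · rintro z ⟨⟨_, ⟨a, ha, rfl⟩, l, hl, e1⟩, ⟨_, ⟨b, hb, rfl⟩, l', hl', e2⟩⟩
      obtain ⟨r, s, hr, hs, hrs, hm⟩ := cross a ha b hb
      refine ⟨_, ⟨_, hm, rfl⟩, r • l + s • l', L.convex hl hl' hr hs hrs, ?_⟩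
      simp only at e1 e2 ⊢
      rw [map_add, map_smul, map_smul]
      calc r • π a + s • π b + (r • l + s • l') = r • (π a + l) + s • (π b + l') := by module
        _ = z := by rw [e1, e2, ← add_smul, hrs, one_smul]

theorem cutVal_inclusion_exclusion {φ : Body n → ℂ} (hφ : IsValuation φ)
    (π : (ι → ℝ) →ₗ[ℝ] En n) (L : Body n) (h : ℝ) [DecidableEq ι] (J : Finset ι) :
    ∀ {Λ : Set (ι → ℝ)}, Convex ℝ Λ → IsCompact Λ → (Λ ∩ {x | ∀ k ∈ J, x k ≤ h} = ∅) →
      ∑ A ∈ J.powerset, (-1 : ℂ) ^ A.card * cutVal φ π L (Λ ∩ {x | ∀ k ∈ A, h ≤ x k}) = 0 := by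
  induction J using Finset.induction_on with
  | empty =>
    intro Λ _ _ he
    have he' : Λ = ∅ := by simpa using he
    simp [he', cutVal_empty]
  | insert k J hk ih =>
    intro Λ h1 h2 he
    have hlin : IsLinearMap ℝ fun x : ι → ℝ => x k := ⟨fun _ _ => rfl, fun _ _ => rfl⟩
    have hkc : Continuous fun x : ι → ℝ => x k := continuous_apply k
    have i1 := ih (Λ := Λ ∩ {x | x k ≤ h}) (h1.inter (convex_halfSpace_le hlin h))
      (h2.inter_right (isClosed_le hkc continuous_const)) (by
        rw [← he]; ext x; simp [and_assoc])
    have i2 := ih (Λ := Λ ∩ {x | x k = h}) (h1.inter (convex_hyperplane hlin h))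
      (h2.inter_right (isClosed_eq hkc continuous_const)) (by
        refine Set.eq_empty_iff_forall_notMem.2 fun x hx => ?_
        refine (Set.eq_empty_iff_forall_notMem.1 he x) ⟨hx.1.1, ?_⟩
        intro k' hk'
        rcases Finset.mem_insert.1 hk' with rfl | h'
        · exact hx.1.2.le
        · exact hx.2 k' h')
    rw [Finset.sum_powerset_insert hk, ← Finset.sum_add_distrib]
    rw [← sub_eq_zero.2 (i1.trans i2.symm), ← Finset.sum_sub_distrib]
    refine Finset.sum_congr rfl fun A hA => ?_
    have hkA : k ∉ A := fun h' => hk (Finset.mem_powerset.1 hA h')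
    rw [Finset.card_insert_of_notMem hkA]
    have cA : Convex ℝ (Λ ∩ {x | ∀ k ∈ A, h ≤ x k}) := by
      refine h1.inter ?_
      intro x hx y hy a b ha hb hab k' hk'
      have h3 := hx k' hk'
      have h4 := hy k' hk'
      simp only [Pi.add_apply, Pi.smul_apply, smul_eq_mul]
      calc h = a * h + b * h := by rw [← add_mul, hab, one_mul]
        _ ≤ _ := add_le_add (mul_le_mul_of_nonneg_left h3 ha) (mul_le_mul_of_nonneg_left h4 hb)
    have kA : IsCompact (Λ ∩ {x | ∀ k ∈ A, h ≤ x k}) := by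
      refine h2.inter_right ?_
      have : {x : ι → ℝ | ∀ k ∈ A, h ≤ x k} = ⋂ k ∈ A, {x | h ≤ x k} := by ext x; simp
      rw [this]
      exact isClosed_biInter fun k' _ => isClosed_le continuous_const (continuous_apply k')
    have key := cutVal_cut hφ π L cA kA k h
    have s1 : Λ ∩ {x | ∀ k' ∈ insert k A, h ≤ x k'}
        = Λ ∩ {x | ∀ k ∈ A, h ≤ x k} ∩ {x | h ≤ x k} := by
      ext x; simp; tauto
    have s2 : Λ ∩ {x | x k ≤ h} ∩ {x | ∀ k ∈ A, h ≤ x k}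
        = Λ ∩ {x | ∀ k ∈ A, h ≤ x k} ∩ {x | x k ≤ h} := Set.inter_right_comm _ _ _
    have s3 : Λ ∩ {x | x k = h} ∩ {x | ∀ k ∈ A, h ≤ x k}
        = Λ ∩ {x | ∀ k ∈ A, h ≤ x k} ∩ {x | x k = h} := Set.inter_right_comm _ _ _
    rw [s1, s2, s3, pow_succ]
    linear_combination (-1) * (-1 : ℂ) ^ A.card * key

/-- The dilated standard simplex. -/
def simplexSet (ι : Type*) [Fintype ι] (t : ℝ) : Set (ι → ℝ) := {x | (∀ k, 0 ≤ x k) ∧ ∑ k, x k = t}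

theorem convex_simplexSet (t : ℝ) : Convex ℝ (simplexSet ι t) := by
  rintro x ⟨hx, hx'⟩ y ⟨hy, hy'⟩ a b ha hb hab
  refine ⟨fun k => ?_, ?_⟩
  · exact add_nonneg (mul_nonneg ha (hx k)) (mul_nonneg hb (hy k))
  · simp only [Pi.add_apply, Pi.smul_apply, smul_eq_mul]
    rw [Finset.sum_add_distrib, ← Finset.mul_sum, ← Finset.mul_sum, hx', hy', ← add_mul, hab,
      one_mul]

theorem isCompact_simplexSet (t : ℝ) : IsCompact (simplexSet ι t) := by
  refine (isCompact_Icc (a := (0 : ι → ℝ)) (b := fun _ => t)).of_isClosed_subset ?_ ?_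
  · have : simplexSet ι t = (⋂ k, {x | 0 ≤ x k}) ∩ {x | ∑ k, x k = t} := by
      ext x; simp [simplexSet]
    rw [this]
    exact (isClosed_iInter fun k => isClosed_le continuous_const (continuous_apply k)).inter
      (isClosed_eq (by fun_prop) continuous_const)
  · rintro x ⟨hx, hx'⟩
    refine ⟨hx, fun k => ?_⟩
    rw [← hx']
    exact Finset.single_le_sum (fun k _ => hx k) (Finset.mem_univ k)

theorem simplexSet_nonempty [Nonempty ι] {t : ℝ} (ht : 0 ≤ t) : (simplexSet ι t).Nonempty := by
  classical
  obtain ⟨k⟩ := ‹Nonempty ι›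
  refine ⟨Pi.single k t, fun k' => ?_, by simp⟩
  by_cases h : k' = k
  · subst h; simpa using ht
  · simp [h]

theorem smul_simplexSet {t : ℝ} (ht : 0 < t) : simplexSet ι t = t • simplexSet ι 1 := by
  ext x
  rw [Set.mem_smul_set_iff_inv_smul_mem₀ ht.ne']
  simp only [simplexSet, Set.mem_ofPred_eq, Pi.smul_apply, smul_eq_mul, ← Finset.mul_sum]
  refine and_congr (forall_congr' fun k => ?_) ?_
  · rw [mul_nonneg_iff_of_pos_left (inv_pos.2 ht)]
  · rw [inv_mul_eq_one₀ ht.ne', eq_comm]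

/-- The convex hull of a finite family of points. -/
def polyt [Nonempty ι] (v : ι → En n) : Body n :=
  ⟨Fintype.linearCombination ℝ v '' simplexSet ι 1, (convex_simplexSet 1).linear_image _,
    (isCompact_simplexSet 1).image (LinearMap.continuous_of_finiteDimensional _),
    (simplexSet_nonempty zero_le_one).image _⟩

theorem sum_neg_one_pow_polyt_of_lt [Nonempty ι] {φ : Body n → ℂ} (hφ : IsValuation φ)
    (hT : IsTransInv φ) (v : ι → En n) (L : Body n) {t : ℝ} (ht : (Fintype.card ι : ℝ) < t) :
    ∑ j ∈ Finset.range (Fintype.card ι + 1), (-1 : ℂ) ^ j * (Fintype.card ι).choose j *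
      φ ((t - j) • polyt v + L) = 0 := by
  classical
  have key := cutVal_inclusion_exclusion hφ (Fintype.linearCombination ℝ v) L 1 Finset.univ
    (convex_simplexSet (ι := ι) t) (isCompact_simplexSet t) (by
      refine Set.eq_empty_iff_forall_notMem.2 fun x hx => ?_
      have h1 : ∑ k, x k ≤ ∑ k : ι, (1 : ℝ) := Finset.sum_le_sum fun k hk => hx.2 k hk
      rw [hx.1.2] at h1
      simp at h1
      linarith)
  have step : ∀ A : Finset ι, cutVal φ (Fintype.linearCombination ℝ v) L
      (simplexSet ι t ∩ {x | ∀ k ∈ A, 1 ≤ x k}) = φ ((t - A.card) • polyt v + L) := by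
    intro A
    have hA : (A.card : ℝ) ≤ Fintype.card ι := by exact_mod_cast A.card_le_univ
    have hs : 0 < t - A.card := by linarith
    let c : ι → ℝ := fun k => if k ∈ A then 1 else 0
    have hc : ∑ k, c k = A.card := by simp [c]
    have e : simplexSet ι t ∩ {x | ∀ k ∈ A, 1 ≤ x k}
        = (fun x => c + x) '' simplexSet ι (t - A.card) := by
      ext x
      constructor
      · rintro ⟨⟨h1, h2⟩, h3⟩
        refine ⟨x - c, ⟨fun k => ?_, ?_⟩, by simp⟩
        · by_cases hk : k ∈ A
          · simpa [c, hk] using h3 k hk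
          · simpa [c, hk] using h1 k
        · simp [Finset.sum_sub_distrib, hc, h2]
      · rintro ⟨y, ⟨h1, h2⟩, rfl⟩
        refine ⟨⟨fun k => ?_, ?_⟩, fun k hk => ?_⟩
        · have : 0 ≤ c k := by simp only [c]; split_ifs <;> norm_num
          exact add_nonneg this (h1 k)
        · simp [Finset.sum_add_distrib, hc, h2]
        · simpa [c, hk] using h1 k
    rw [e, cutVal_eq φ _ L ((convex_simplexSet _).translate c)
      ((isCompact_simplexSet _).image (continuous_const.add continuous_id))
      ((simplexSet_nonempty hs.le).image _)
      (transBody (Fintype.linearCombination ℝ v c) ((t - A.card) • polyt v + L)) ?_, hT]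
    show (fun y => _ + y) '' ((t - (A.card : ℝ)) •
      (Fintype.linearCombination ℝ v '' simplexSet ι 1) + (L : Set (En n))) = _
    rw [smul_simplexSet hs]
    ext z
    constructor
    · rintro ⟨_, ⟨_, ⟨_, ⟨y, hy, rfl⟩, rfl⟩, l, hl, rfl⟩, rfl⟩
      exact ⟨_, ⟨_, ⟨_, ⟨y, hy, rfl⟩, rfl⟩, rfl⟩, l, hl, by
        simp only [map_add, map_smul, add_assoc]⟩
    · rintro ⟨_, ⟨_, ⟨_, ⟨y, hy, rfl⟩, rfl⟩, rfl⟩, l, hl, rfl⟩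
      exact ⟨_, ⟨_, ⟨_, ⟨y, hy, rfl⟩, rfl⟩, l, hl, rfl⟩, by
        simp only [map_add, map_smul, add_assoc]⟩
  simp only [step] at key
  rw [Finset.sum_powerset_apply_card (fun j => (-1 : ℂ) ^ j * φ ((t - (j : ℝ)) • polyt v + L)),
    Finset.card_univ] at key
  rw [← key]
  refine Finset.sum_congr rfl fun j _ => ?_
  rw [nsmul_eq_mul]
  ring

end Cutting

section NatPolynomials

open Polynomial

theorem exists_polynomial_of_fwdDiff {f : ℕ → ℂ} {d : ℕ} (h : (fwdDiff 1)^[d + 1] f = 0) :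
    ∃ p : ℂ[X], p.natDegree ≤ d ∧ ∀ N : ℕ, f N = p.eval (N : ℂ) := by
  have hz : ∀ k, (fwdDiff 1)^[k + (d + 1)] f = 0 := by
    intro k
    rw [Function.iterate_add_apply, h]
    induction k with
    | zero => rfl
    | succ k ih =>
      rw [Function.iterate_succ_apply', ih]
      funext x
      simp [fwdDiff]
  refine ⟨∑ k ∈ Finset.range (d + 1),
    C ((fwdDiff 1)^[k] f 0 / (k.factorial : ℂ)) * descPochhammer ℂ k, ?_, fun N => ?_⟩
  · refine natDegree_sum_le_of_forall_le _ _ fun k hk => ?_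
    refine (natDegree_C_mul_le _ _).trans ?_
    rw [descPochhammer_natDegree]
    exact Nat.lt_succ_iff.1 (Finset.mem_range.1 hk)
  · have h1 := shift_eq_sum_fwdDiff_iter (h := 1) f N 0
    simp only [smul_eq_mul, mul_one, zero_add] at h1
    rw [h1, eval_finsetSum]
    have h2 : ∀ k, eval (N : ℂ) (C ((fwdDiff 1)^[k] f 0 / (k.factorial : ℂ)) * descPochhammer ℂ k)
        = N.choose k • (fwdDiff 1)^[k] f 0 := by
      intro k
      rw [eval_mul, eval_C, descPochhammer_eval_eq_descFactorial,
        Nat.descFactorial_eq_factorial_mul_choose, nsmul_eq_mul]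
      push_cast
      field_simp [Nat.cast_ne_zero.2 k.factorial_ne_zero]
    simp only [h2]
    rcases le_total N d with hN | hN
    · refine Finset.sum_subset (Finset.range_subset_range.2 (by lia)) fun k _ hk => ?_
      rw [Nat.choose_eq_zero_of_lt (by simpa using hk), zero_smul]
    · symm
      refine Finset.sum_subset (Finset.range_subset_range.2 (by lia)) fun k _ hk => ?_
      obtain ⟨l, rfl⟩ := Nat.exists_eq_add_of_le' (by simpa using hk : d + 1 ≤ k)
      rw [hz l]
      simp

theorem natDegree_le_of_norm_eval_le {p : ℂ[X]} {C : ℝ} {d : ℕ}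
    (h : ∀ N : ℕ, 1 ≤ N → ‖p.eval (N : ℂ)‖ ≤ C * (N : ℝ) ^ d) : p.natDegree ≤ d := by
  by_contra! hd
  have hp : p ≠ 0 := by
    rintro rfl
    simp at hd
  have h1 : Tendsto (fun N : ℕ => p.reverse.eval ((N : ℂ)⁻¹)) atTop (𝓝 p.leadingCoeff) := by
    have : p.leadingCoeff = p.reverse.eval 0 := by
      rw [← coeff_zero_eq_eval_zero, coeff_zero_reverse]
    rw [this]
    exact (p.reverse.continuous.tendsto 0).comp (tendsto_inv_atTop_nhds_zero_nat (𝕜 := ℂ))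
  have h2 : ∀ N : ℕ, 1 ≤ N → ‖p.reverse.eval ((N : ℂ)⁻¹)‖ ≤ C * (N : ℝ)⁻¹ := by
    intro N hN
    have hN0 : (N : ℂ) ≠ 0 := Nat.cast_ne_zero.2 (by lia)
    have hNp : (0 : ℝ) < N := Nat.cast_pos.2 (by lia)
    have : Invertible (N : ℂ) := invertibleOfNonzero hN0
    have e := eval₂_reverse_mul_pow (RingHom.id ℂ) (N : ℂ) p
    rw [invOf_eq_inv] at e
    change p.reverse.eval ((N : ℂ)⁻¹) * (N : ℂ) ^ p.natDegree = p.eval (N : ℂ) at e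
    have h3 := h N hN
    rw [← e, norm_mul, norm_pow, Complex.norm_natCast] at h3
    have h1N : (1 : ℝ) ≤ N := by exact_mod_cast hN
    have h4 : (N : ℝ) ^ (d + 1) ≤ (N : ℝ) ^ p.natDegree := pow_le_pow_right₀ h1N hd
    have h5 : ‖p.reverse.eval ((N : ℂ)⁻¹)‖ * (N : ℝ) ^ (d + 1) ≤ C * (N : ℝ) ^ d :=
      (mul_le_mul_of_nonneg_left h4 (norm_nonneg _)).trans h3
    rw [pow_succ, ← mul_assoc, mul_right_comm] at h5
    have h6 := le_of_mul_le_mul_right h5 (pow_pos hNp d)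
    rwa [← div_eq_mul_inv, le_div_iff₀ hNp]
  have h3 : Tendsto (fun N : ℕ => p.reverse.eval ((N : ℂ)⁻¹)) atTop (𝓝 0) := by
    refine squeeze_zero_norm' (eventually_atTop.2 ⟨1, h2⟩) ?_
    simpa using (tendsto_inv_atTop_nhds_zero_nat (𝕜 := ℝ)).const_mul C
  exact hp (leadingCoeff_eq_zero.1 (tendsto_nhds_unique h1 h3))

theorem fwdDiff_iter_polynomial {p : ℂ[X]} {d : ℕ} (hp : p.natDegree ≤ d) :
    (fwdDiff 1)^[d + 1] (fun N : ℕ => p.eval (N : ℂ)) = 0 := by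
  have h := fwdDiff_iter_eq_zero_of_degree_lt (P := p) (n := d + 1)
    (Nat.lt_succ_of_le hp)
  funext N
  have h' := congrFun h (N : ℂ)
  rw [fwdDiff_iter_eq_sum_shift] at h' ⊢
  simpa using h'

end NatPolynomials

section Polynomiality

open Polynomial

variable {n : ℕ} {i : ℕ} {φ : Body n → ℂ}

theorem norm_add_smul_le (hc : Continuous φ) (hh : IsHomog i φ) (K L : Body n) :
    ∃ C : ℝ, ∀ N : ℕ, 1 ≤ N → ‖φ ((N : ℝ) • K + L)‖ ≤ C * (N : ℝ) ^ i := by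
  have hcont : Continuous fun s : ℝ => φ (K + s • L) :=
    hc.comp (continuous_const.add (continuous_smul_body L))
  obtain ⟨C, hC⟩ := (isCompact_Icc (a := (0 : ℝ)) (b := 1)).exists_bound_of_continuousOn
    hcont.continuousOn
  refine ⟨C, fun N hN => ?_⟩
  have hNp : (0 : ℝ) < N := Nat.cast_pos.2 (by lia)
  have h1N : (1 : ℝ) ≤ N := by exact_mod_cast hN
  have e : (N : ℝ) • K + L = scaleBody (N : ℝ) (K + (N : ℝ)⁻¹ • L) := by
    rw [scaleBody_eq, smul_add, smul_smul, mul_inv_cancel₀ hNp.ne', one_smul]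
  rw [e, hh _ hNp, norm_smul, Real.norm_eq_abs, abs_of_nonneg (by positivity), mul_comm]
  exact mul_le_mul_of_nonneg_right
    (hC _ ⟨by positivity, inv_le_one_of_one_le₀ h1N⟩) (by positivity)

theorem fwdDiff_polyt (hφ : φ ∈ ValI n i) {ι : Type*} [Fintype ι] [Nonempty ι] (v : ι → En n)
    (L : Body n) : (fwdDiff 1)^[i + 1] (fun N : ℕ => φ ((N : ℝ) • polyt v + L)) = 0 := by
  obtain ⟨⟨hc, hv, ht⟩, hh⟩ := hφ
  set m := Fintype.card ι with hm
  have hm0 : 0 < m := Fintype.card_pos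
  have hcont : ∀ j : ℕ, Continuous fun t : ℝ => φ ((t - j) • polyt v + L) := fun j =>
    hc.comp (((continuous_smul_body (polyt v)).comp (continuous_id.sub continuous_const)).add
      continuous_const)
  have hclosed : IsClosed {t : ℝ | ∑ j ∈ Finset.range (m + 1), (-1 : ℂ) ^ j * m.choose j *
      φ ((t - j) • polyt v + L) = 0} :=
    isClosed_eq (continuous_finsetSum _ fun j _ => continuous_const.mul (hcont j))
      continuous_const
  have hle : ∀ t : ℝ, (m : ℝ) ≤ t → ∑ j ∈ Finset.range (m + 1), (-1 : ℂ) ^ j * m.choose j *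
      φ ((t - j) • polyt v + L) = 0 := by
    intro t ht'
    have h1 : closure (Set.Ioi (m : ℝ)) ⊆ _ := hclosed.closure_subset_iff.2 fun t h =>
      sum_neg_one_pow_polyt_of_lt hv ht v L h
    rw [closure_Ioi] at h1
    exact h1 ht'
  obtain ⟨d, hd⟩ : ∃ d, m = d + 1 := ⟨m - 1, by lia⟩
  have hdiff : (fwdDiff 1)^[d + 1] (fun N : ℕ => φ ((N : ℝ) • polyt v + L)) = 0 := by
    funext N
    rw [← hd, fwdDiff_iter_eq_sum_shift]
    have h2 := hle (N + m) (by linarith [Nat.cast_nonneg (α := ℝ) N])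
    rw [← Finset.sum_range_reflect] at h2
    rw [Pi.zero_apply, ← h2]
    refine Finset.sum_congr rfl fun k hk => ?_
    have hk' : k ≤ m := Nat.lt_succ_iff.1 (Finset.mem_range.1 hk)
    have e1 : m + 1 - 1 - k = m - k := by lia
    rw [e1, Nat.choose_symm hk', Nat.cast_sub hk', zsmul_eq_mul]
    push_cast
    congr 4
    simp
    ring
  obtain ⟨p, -, hp⟩ := exists_polynomial_of_fwdDiff hdiff
  obtain ⟨C, hC⟩ := norm_add_smul_le hc hh (polyt v) L
  have hdeg : p.natDegree ≤ i := natDegree_le_of_norm_eval_le (C := C) fun N hN => by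
    rw [← hp]
    exact hC N hN
  simp only [hp]
  exact fwdDiff_iter_polynomial hdeg

theorem exists_polyt_dist_le (K : Body n) {ε : ℝ} (hε : 0 < ε) :
    ∃ (ι : Type) (_ : Fintype ι) (_ : Nonempty ι) (v : ι → En n), dist (polyt v) K ≤ ε := by
  obtain ⟨t, htK, hfin, hcov⟩ := K.isCompact.finite_cover_balls hε
  have : Fintype t := hfin.fintype
  have hne : Nonempty t := by
    obtain ⟨x, hx⟩ := K.nonempty
    have := hcov hx
    simp only [Set.mem_iUnion] at this
    obtain ⟨y, hy, -⟩ := this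
    exact ⟨⟨y, hy⟩⟩
  let e := Fintype.equivFin t
  have : Nonempty (Fin (Fintype.card t)) := ⟨e (Classical.arbitrary t)⟩
  refine ⟨Fin (Fintype.card t), inferInstance, inferInstance, fun k => (e.symm k : En n),
    dist_le_of_suppF hε.le fun u hu => ?_⟩
  have h1 : suppF (polyt fun k => (e.symm k : En n)) u ≤ suppF K u := by
    refine suppF_mono ?_ u
    rintro _ ⟨x, ⟨hx, hx'⟩, rfl⟩
    rw [Fintype.linearCombination_apply]
    exact K.convex.sum_mem (fun k _ => hx k) hx' fun k _ => htK (e.symm k).2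
  obtain ⟨x, hx, ex⟩ := exists_inner_eq_suppF K u
  have h2 := hcov hx
  simp only [Set.mem_iUnion] at h2
  obtain ⟨y, hy, hxy⟩ := h2
  have h3 : y ∈ polyt fun k => (e.symm k : En n) := by
    classical
    refine ⟨Pi.single (e ⟨y, hy⟩) 1, ⟨fun k => ?_, by simp⟩, ?_⟩
    · by_cases h : k = e ⟨y, hy⟩
      · subst h; simp
      · simp [h]
    · simp
  have h4 := inner_le_suppF h3 u
  have h5 : ⟪x, u⟫ - ⟪y, u⟫ ≤ ε := by
    rw [← inner_sub_left]
    refine (real_inner_le_norm _ _).trans ?_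
    rw [hu, mul_one, ← dist_eq_norm]
    exact (Metric.mem_ball.1 hxy).le
  rw [abs_le]
  constructor <;> linarith

theorem fwdDiff_body (hφ : φ ∈ ValI n i) (K L : Body n) :
    (fwdDiff 1)^[i + 1] (fun N : ℕ => φ ((N : ℝ) • K + L)) = 0 := by
  funext N
  rw [fwdDiff_iter_eq_sum_shift, Pi.zero_apply]
  have hcont : Continuous fun K : Body n => ∑ k ∈ Finset.range (i + 1 + 1),
      ((-1 : ℤ) ^ (i + 1 - k) * (i + 1).choose k) • φ (((N + k • 1 : ℕ) : ℝ) • K + L) := by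
    refine continuous_finsetSum _ fun k _ => Continuous.const_smul ?_ _
    refine hφ.1.1.comp (Continuous.add ?_ continuous_const)
    have e : ∀ M : ℕ, (fun K : Body n => (M : ℝ) • K) = fun K => M • K := by
      intro M
      funext K
      apply body_ext
      intro u _
      rw [suppF_smul_of_nonneg (Nat.cast_nonneg M)]
      induction M with
      | zero => simp
      | succ M ih => rw [succ_nsmul, suppF_add, ← ih]; push_cast; ring
    exact (continuous_nsmul (N + k • 1)).congr fun K => (congrFun (e (N + k • 1)) K).symm
  by_contra hne
  have hopen : IsOpen {K : Body n | ∑ k ∈ Finset.range (i + 1 + 1),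
      ((-1 : ℤ) ^ (i + 1 - k) * (i + 1).choose k) • φ (((N + k • 1 : ℕ) : ℝ) • K + L) ≠ 0} :=
    isOpen_ne_fun hcont continuous_const
  obtain ⟨ε, hε, hball⟩ := Metric.isOpen_iff.1 hopen K hne
  obtain ⟨ι, _, _, v, hv⟩ := exists_polyt_dist_le K (half_pos hε)
  have h1 : polyt v ∈ Metric.ball K ε := Metric.mem_ball.2 (by linarith)
  refine hball h1 ?_
  have h2 := congrFun (fwdDiff_polyt hφ v L) N
  rwa [fwdDiff_iter_eq_sum_shift] at h2

/-- McMullen's polynomial expansion. -/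
theorem exists_polynomial_expansion (hφ : φ ∈ ValI n i) (K L : Body n) :
    ∃ p : ℂ[X], p.natDegree ≤ i ∧ ∀ t : ℝ, 0 ≤ t → φ (t • K + L) = p.eval (t : ℂ) := by
  have hP : ∀ K : Body n, ∃ p : ℂ[X], p.natDegree ≤ i ∧
      ∀ N : ℕ, φ ((N : ℝ) • K + L) = p.eval (N : ℂ) := fun K =>
    exists_polynomial_of_fwdDiff (fwdDiff_body hφ K L)
  obtain ⟨p, hpd, hp⟩ := hP K
  refine ⟨p, hpd, fun t ht => ?_⟩
  have hrat : ∀ N M : ℕ, 1 ≤ M → φ (((N : ℝ) / M) • K + L) = p.eval (((N : ℝ) / M : ℝ) : ℂ) := by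
    intro N M hM
    have hM0 : (M : ℝ) ≠ 0 := Nat.cast_ne_zero.2 (by lia)
    have hM0' : (M : ℂ) ≠ 0 := Nat.cast_ne_zero.2 (by lia)
    obtain ⟨r, -, hr⟩ := hP ((M : ℝ)⁻¹ • K)
    have e : p = r.comp (C (M : ℂ) * X) := by
      refine Polynomial.eq_of_infinite_eval_eq _ _ ?_
      refine Set.Infinite.mono (s := Set.range (fun N : ℕ => (N : ℂ))) ?_
        (Set.infinite_range_of_injective Nat.cast_injective)
      rintro _ ⟨N, rfl⟩
      show p.eval (N : ℂ) = (r.comp (C (M : ℂ) * X)).eval (N : ℂ)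
      rw [eval_comp, ← hp]
      simp only [eval_mul, eval_C, eval_X]
      have := hr (M * N)
      push_cast at this
      rw [← this, smul_smul]
      congr 3
      field_simp
    rw [e, eval_comp]
    simp only [eval_mul, eval_C, eval_X]
    have := hr N
    rw [smul_smul, ← div_eq_mul_inv] at this
    rw [this]
    congr 1
    push_cast
    field_simp
  have hc1 : Continuous fun t : ℝ => φ (t • K + L) :=
    hφ.1.1.comp ((continuous_smul_body K).add continuous_const)
  have hc2 : Continuous fun t : ℝ => p.eval (t : ℂ) :=
    p.continuous.comp Complex.continuous_ofReal
  have hlim : Tendsto (fun M : ℕ => (⌊t * M⌋₊ : ℝ) / M) atTop (𝓝 t) :=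
    (tendsto_nat_floor_mul_div_atTop ht).comp tendsto_natCast_atTop_atTop
  refine tendsto_nhds_unique ((hc1.tendsto t).comp hlim) ?_
  refine ((hc2.tendsto t).comp hlim).congr' ?_
  filter_upwards [eventually_ge_atTop 1] with M hM
  exact (hrat _ M hM).symm

end Polynomiality

section PolyHom

open Polynomial (X C)
open scoped Polynomial

variable {n : ℕ}

/-- Functions of convex bodies which are homogeneous of degree `i` and polynomial of degree at
most `i` along rays. -/
def IsPolyHom (i : ℕ) (φ : Body n → ℂ) : Prop :=
  (∀ t : ℝ, 0 < t → ∀ K, φ (t • K) = (t : ℂ) ^ i * φ K) ∧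
    ∀ K L, ∃ p : ℂ[X], p.natDegree ≤ i ∧ ∀ t : ℝ, 0 ≤ t → φ (t • K + L) = p.eval (t : ℂ)

theorem zero_smul_body (K : Body n) : (0 : ℝ) • K = 0 :=
  SetLike.ext' (Set.zero_smul_set K.nonempty)

theorem isPolyHom_of_mem {i : ℕ} {φ : Body n → ℂ} (hφ : φ ∈ ValI n i) : IsPolyHom i φ := by
  refine ⟨fun t ht K => ?_, exists_polynomial_expansion hφ⟩
  have h := hφ.2 t ht K
  rw [scaleBody_eq] at h
  rw [h, Complex.real_smul]
  push_cast
  rfl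

theorem polynomial_eq_of_eval_nonneg {p q : ℂ[X]}
    (h : ∀ t : ℝ, 0 ≤ t → p.eval (t : ℂ) = q.eval (t : ℂ)) : p = q := by
  refine Polynomial.eq_of_infinite_eval_eq p q ((Set.infinite_range_of_injective
    (f := fun N : ℕ => (N : ℂ)) Nat.cast_injective).mono ?_)
  rintro _ ⟨N, rfl⟩
  simpa using h N N.cast_nonneg

theorem coeff_eq_sum_eval {p : ℂ[X]} {i : ℕ} (hp : p.natDegree ≤ i) (k : ℕ) :
    p.coeff k = ∑ j ∈ Finset.range (i + 1), p.eval (j : ℂ) *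
      (Lagrange.basis (Finset.range (i + 1)) (fun j : ℕ => (j : ℂ)) j).coeff k := by
  have h := Lagrange.eq_interpolate (s := Finset.range (i + 1)) (v := fun j : ℕ => (j : ℂ)) (f := p)
    (Nat.cast_injective.injOn) (by
      rw [Finset.card_range]
      exact lt_of_le_of_lt Polynomial.degree_le_natDegree (by exact_mod_cast Nat.lt_succ_of_le hp))
  conv_lhs => rw [h, Lagrange.interpolate_apply]
  simp [Polynomial.finsetSum_coeff]

theorem exists_isPolyHom_coeff {i : ℕ} {φ : Body n → ℂ} (hφ : IsPolyHom i φ) (K : Body n) :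
    ∃ c : ℕ → Body n → ℂ, (∀ k ≤ i, IsPolyHom (i - k) (c k)) ∧ c 0 = φ ∧
      ∀ L, ∀ t : ℝ, 0 ≤ t → φ (t • K + L) = ∑ k ∈ Finset.range (i + 1), c k L * (t : ℂ) ^ k := by
  choose p hpd hp using fun L => hφ.2 K L
  have hhom : ∀ (k : ℕ) (s : ℝ), 0 < s → k ≤ i → ∀ L, (p (s • L)).coeff k =
      (s : ℂ) ^ (i - k) * (p L).coeff k := by
    intro k s hs hk L
    have hsc : (s : ℂ) ≠ 0 := by exact_mod_cast hs.ne'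
    have e : p (s • L) = C ((s : ℂ) ^ i) * (p L).comp (C ((s : ℂ)⁻¹) * X) := by
      apply polynomial_eq_of_eval_nonneg
      intro t ht
      rw [← hp _ t ht]
      have : t • K + s • L = s • ((s⁻¹ * t) • K + L) := by
        rw [smul_add, smul_smul, mul_inv_cancel_left₀ hs.ne']
      rw [this, hφ.1 s hs, hp L _ (by positivity)]
      simp
    rw [e, Polynomial.coeff_C_mul, Polynomial.comp_C_mul_X_coeff, ← Nat.sub_add_cancel hk]
    simp only [Nat.add_sub_cancel, pow_add, inv_pow]
    field_simp
  have hpoly : ∀ (k : ℕ) (K' L : Body n), ∃ q : ℂ[X], q.natDegree ≤ i ∧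
      ∀ t : ℝ, 0 ≤ t → (p (t • K' + L)).coeff k = q.eval (t : ℂ) := by
    intro k K' L
    choose q hqd hq using fun j : ℕ => hφ.2 K' ((j : ℝ) • K + L)
    refine ⟨∑ j ∈ Finset.range (i + 1), q j *
      C ((Lagrange.basis (Finset.range (i + 1)) (fun j : ℕ => (j : ℂ)) j).coeff k), ?_, ?_⟩
    · refine Polynomial.natDegree_sum_le_of_forall_le _ _ fun j _ => ?_
      exact (Polynomial.natDegree_mul_C_le _ _).trans (hqd j)
    · intro t ht
      rw [coeff_eq_sum_eval (hpd _) k, Polynomial.eval_finsetSum]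
      refine Finset.sum_congr rfl fun j _ => ?_
      have h1 := hp (t • K' + L) j j.cast_nonneg
      rw [Complex.ofReal_natCast] at h1
      rw [← h1, Polynomial.eval_mul, Polynomial.eval_C, ← hq j t ht, add_left_comm]
  refine ⟨fun k L => (p L).coeff k, fun k hk => ⟨fun s hs L => hhom k s hs hk L, fun K' L => ?_⟩,
    ?_, ?_⟩
  · obtain ⟨q, hqd, hq⟩ := hpoly k K' L
    obtain ⟨r, hrd, hr⟩ := hpoly k L K'
    refine ⟨q, ?_, hq⟩
    obtain ⟨B, hB⟩ := (isCompact_Icc (a := (0 : ℝ)) (b := 1)).exists_bound_of_continuousOn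
      (f := fun t : ℝ => r.eval (t : ℂ))
      (r.continuous.comp Complex.continuous_ofReal).continuousOn
    refine natDegree_le_of_norm_eval_le (C := B) fun N hN => ?_
    have hNp : (0 : ℝ) < N := Nat.cast_pos.2 (by lia)
    have h1N : (1 : ℝ) ≤ N := by exact_mod_cast hN
    have e := hq N hNp.le
    have : (N : ℝ) • K' + L = (N : ℝ) • ((N : ℝ)⁻¹ • L + K') := by
      rw [smul_add, smul_smul, mul_inv_cancel₀ hNp.ne', one_smul, add_comm]
    rw [this, hhom k N hNp hk, hr _ (by positivity), Complex.ofReal_natCast] at e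
    rw [← e, norm_mul, norm_pow, Complex.norm_natCast, mul_comm]
    gcongr
    exact hB (N : ℝ)⁻¹ ⟨by positivity, inv_le_one_of_one_le₀ h1N⟩
  · funext L
    have := hp L 0 le_rfl
    rw [zero_smul_body, zero_add] at this
    rw [this, Complex.ofReal_zero]
    exact Polynomial.coeff_zero_eq_eval_zero _
  · intro L t ht
    rw [hp L t ht, Polynomial.eval_eq_sum_range' (Nat.lt_succ_of_le (hpd L))]

theorem IsPolyHom.natCast_smul {i : ℕ} {φ : Body n → ℂ} (hφ : IsPolyHom i φ) (K : Body n) (N : ℕ) :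
    φ ((N : ℝ) • K) = (N : ℂ) ^ i * φ K := by
  rcases Nat.eq_zero_or_pos N with rfl | hN
  · rw [Nat.cast_zero, zero_smul_body]
    rcases Nat.eq_zero_or_pos i with rfl | hi
    · obtain ⟨p, hpd, hp⟩ := hφ.2 K 0
      rw [Polynomial.eq_C_of_natDegree_le_zero hpd] at hp
      have h0 := hp 0 le_rfl
      have h1 := hp 1 zero_le_one
      rw [zero_smul_body, Polynomial.eval_C] at h0
      rw [one_smul, Polynomial.eval_C] at h1
      simp only [add_zero] at h0 h1
      rw [h0, h1]
      simp
    · have h := hφ.1 2 two_pos 0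
      rw [show (2 : ℝ) • (0 : Body n) = 0 from
        body_ext fun u _ => by rw [suppF_smul, suppF_zero, suppF_zero]] at h
      have h2 : ((2 : ℝ) : ℂ) ^ i ≠ 1 := by
        rw [Complex.ofReal_ofNat]
        exact_mod_cast (Nat.one_lt_pow hi.ne' one_lt_two).ne'
      have : φ 0 = 0 := by
        have h3 : (((2 : ℝ) : ℂ) ^ i - 1) * φ 0 = 0 := by rw [sub_mul, ← h]; ring
        exact (mul_eq_zero.1 h3).resolve_left (sub_ne_zero.2 h2)
      rw [this]
      simp [hi.ne']
  · have h := hφ.1 N (Nat.cast_pos.2 hN) K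
    simpa using h

end PolyHom

section BodyAlgebra

open scoped Polynomial

variable {n : ℕ}

/-- The semigroup algebra of convex bodies under Minkowski addition. -/
abbrev BodyAlg (n : ℕ) : Type := AddMonoidAlgebra ℂ (Body n)

/-- The basis element of the body algebra attached to a convex body. -/
def br (K : Body n) : BodyAlg n := AddMonoidAlgebra.single K 1

theorem br_add (K L : Body n) : br (K + L) = br K * br L := by
  rw [br, br, br, AddMonoidAlgebra.single_mul_single, one_mul]

theorem br_zero : br (0 : Body n) = 1 := rfl

theorem br_nsmul (K : Body n) (N : ℕ) : br (N • K) = br K ^ N := by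
  rw [br, br, AddMonoidAlgebra.single_pow, one_pow]

theorem natCast_smul_body (K : Body n) (N : ℕ) : (N : ℝ) • K = N • K := by
  induction N with
  | zero => rw [Nat.cast_zero, zero_smul_body, zero_nsmul]
  | succ N ih =>
    rw [succ_nsmul, ← ih]
    have h := add_smul (N : ℝ≥0) 1 K
    rw [one_smul] at h
    rw [show (N : ℝ) • K = (N : ℝ≥0) • K from by rw [NNReal.smul_def]; simp, ← h, NNReal.smul_def]
    simp

theorem bodyAlg_induction {P : BodyAlg n → Prop} (a : BodyAlg n) (h0 : P 0)
    (hadd : ∀ a b, P a → P b → P (a + b)) (hs : ∀ (c : ℂ) K, P (c • br K)) : P a := by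
  refine AddMonoidAlgebra.induction_linear a h0 hadd fun K c => ?_
  have := hs c K
  rwa [br, AddMonoidAlgebra.smul_single', mul_one] at this

/-- The linear extension of a function of convex bodies to the body algebra. -/
def ev : (Body n → ℂ) →ₗ[ℂ] BodyAlg n →ₗ[ℂ] ℂ where
  toFun φ := Finsupp.linearCombination ℂ φ ∘ₗ
    (AddMonoidAlgebra.coeffLinearEquiv ℂ).toLinearMap
  map_add' φ ψ := by
    ext a
    simp [Finsupp.linearCombination_apply, Finsupp.sum, mul_add, Finset.sum_add_distrib]
  map_smul' c φ := by
    ext a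
    simp [Finsupp.linearCombination_apply, Finsupp.sum, mul_left_comm]

@[simp] theorem ev_br (φ : Body n → ℂ) (K : Body n) : ev φ (br K) = φ K := by
  simp [ev, br]

theorem ev_apply (φ : Body n → ℂ) (a : BodyAlg n) :
    ev φ a = ∑ K ∈ a.coeff.support, a.coeff K * φ K := by
  simp [ev, Finsupp.linearCombination_apply, Finsupp.sum]

theorem ev_mul_br (φ : Body n → ℂ) (a : BodyAlg n) (K : Body n) :
    ev φ (br K * a) = ev (fun L => φ (K + L)) a := by
  induction a using bodyAlg_induction with
  | h0 => simp
  | hadd a b ha hb => rw [mul_add, map_add, ha, hb, map_add]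
  | hs c L => rw [mul_smul_comm, ← br_add, map_smul, map_smul, ev_br, ev_br]

/-- The augmentation ideal of the body algebra. -/
def augI (n : ℕ) : Ideal (BodyAlg n) := Ideal.span (Set.range fun K : Body n => br K - 1)

theorem br_sub_one_mem (K : Body n) : br K - 1 ∈ augI n := Ideal.subset_span ⟨K, rfl⟩

theorem br_sub_br_mem (K L : Body n) : br K - br L ∈ augI n := by
  have := (augI n).sub_mem (br_sub_one_mem K) (br_sub_one_mem L)
  rwa [sub_sub_sub_cancel_right] at this

theorem ev_one_of_mem {a : BodyAlg n} (ha : a ∈ augI n) : ev (fun _ => 1) a = 0 := by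
  refine Submodule.span_induction ?_ ?_ ?_ ?_ ha
  · rintro _ ⟨K, rfl⟩
    rw [map_sub, ev_br, ← br_zero, ev_br, sub_self]
  · simp
  · intro a b _ _ ha hb
    rw [map_add, ha, hb, add_zero]
  · intro b a _ ha
    rw [smul_eq_mul]
    induction b using bodyAlg_induction with
    | h0 => simp
    | hadd b c hb hc => rw [add_mul, map_add, hb, hc, add_zero]
    | hs c K => rw [smul_mul_assoc, map_smul, ev_mul_br, ha, smul_zero]

theorem ev_eq_zero_of_mem_pow (m : ℕ) : ∀ {i : ℕ} {φ : Body n → ℂ}, IsPolyHom i φ → i < m →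
    ∀ a ∈ augI n ^ m, ev φ a = 0 := by
  induction m with
  | zero => intro i φ _ h; lia
  | succ m ih =>
    intro i φ hφ hi a ha
    have e : augI n ^ (m + 1) = augI n * augI n ^ m := pow_succ' (augI n) m
    rw [e] at ha
    refine Submodule.mul_induction_on ha ?_ ?_
    · intro x hx
      refine Submodule.span_induction (p := fun x _ => ∀ b ∈ augI n ^ m, ev φ (x * b) = 0)
        ?_ ?_ ?_ ?_ hx
      · rintro _ ⟨K, rfl⟩ b hb
        obtain ⟨c, hc, hc0, hcs⟩ := exists_isPolyHom_coeff hφ K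
        have e : (fun L => φ (K + L)) = ∑ k ∈ Finset.range i, c (k + 1) + φ := by
          funext L
          have h := hcs L 1 zero_le_one
          rw [one_smul] at h
          rw [h, Finset.sum_range_succ', hc0]
          simp
        simp only [sub_mul, one_mul, map_sub]
        rw [ev_mul_br, e, map_add, LinearMap.add_apply, add_sub_cancel_right, map_sum,
          LinearMap.sum_apply]
        refine Finset.sum_eq_zero fun k hk => ?_
        have hk' := Finset.mem_range.1 hk
        exact ih (hc (k + 1) hk') (by lia) b hb
      · simp
      · intro x y _ _ hx hy b hb
        rw [add_mul, map_add, hx b hb, hy b hb, add_zero]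
      · intro z x _ hx b hb
        rw [smul_eq_mul, mul_comm z, mul_assoc]
        exact hx _ ((augI n ^ m).mul_mem_left _ hb)
    · intro x y hx hy
      rw [map_add, hx, hy, add_zero]

theorem ev_br_sub_one_pow {i : ℕ} {φ : Body n → ℂ} (hφ : IsPolyHom i φ) (K : Body n) :
    ev φ ((br K - 1) ^ i) = (i.factorial : ℂ) * φ K := by
  have h := congrFun (fwdDiff_iter_eq_factorial (R := ℂ) (n := i)) 0
  rw [fwdDiff_iter_eq_sum_shift] at h
  simp only [Pi.natCast_apply] at h
  rw [← h, sub_eq_add_neg, add_pow, map_sum, Finset.sum_mul]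
  refine Finset.sum_congr rfl fun k _ => ?_
  rw [← br_nsmul, mul_assoc, mul_comm]
  have e : ((-1 : BodyAlg n) ^ (i - k) * (i.choose k : BodyAlg n)) =
      (((-1) ^ (i - k) * (i.choose k : ℂ)) • (1 : BodyAlg n)) := by
    rw [Algebra.smul_def, mul_one, map_mul, map_pow, map_neg, map_one, map_natCast]
  rw [e, smul_mul_assoc, one_mul, map_smul, ev_br, ← natCast_smul_body, hφ.natCast_smul]
  simp [mul_assoc]

end BodyAlgebra

section AugmentationPowers

open scoped Polynomial

variable {n : ℕ}

theorem suppF_sum_nnreal_smul (s : Finset (Body n)) (d : Body n → ℝ≥0) (u : En n) :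
    suppF (∑ K ∈ s, d K • K) u = ∑ K ∈ s, (d K : ℝ) * suppF K u := by
  induction s using Finset.cons_induction with
  | empty => simp
  | cons K s hK ih =>
    rw [Finset.sum_cons, Finset.sum_cons, suppF_add, ih, NNReal.smul_def,
      suppF_smul_of_nonneg (d K).coe_nonneg]

theorem sum_smul_apply_eq_zero (ψ : Body n →ₗ[ℝ≥0] ℂ) {s : Finset (Body n)} {c : Body n → ℝ}
    (h : ∀ u : En n, ‖u‖ = 1 → ∑ K ∈ s, c K * suppF K u = 0) : ∑ K ∈ s, (c K : ℂ) * ψ K = 0 := by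
  have e : ∑ K ∈ s, (c K).toNNReal • K = ∑ K ∈ s, (-c K).toNNReal • K := by
    apply body_ext
    intro u hu
    rw [suppF_sum_nnreal_smul, suppF_sum_nnreal_smul, ← sub_eq_zero, ← Finset.sum_sub_distrib,
      ← h u hu]
    refine Finset.sum_congr rfl fun K _ => ?_
    rw [← sub_mul, Real.coe_toNNReal', Real.coe_toNNReal', max_zero_sub_max_neg_zero_eq_self]
  have e' := congrArg ψ e
  rw [map_sum, map_sum, ← sub_eq_zero, ← Finset.sum_sub_distrib] at e'
  rw [← e']
  refine Finset.sum_congr rfl fun K _ => ?_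
  rw [map_smul, map_smul, NNReal.smul_def, NNReal.smul_def, Complex.real_smul, Complex.real_smul,
    ← sub_mul, Real.coe_toNNReal', Real.coe_toNNReal', ← Complex.ofReal_sub,
    max_zero_sub_max_neg_zero_eq_self]

/-- The support function of an element of the body algebra. -/
def suppA (a : BodyAlg n) (u : En n) : ℂ := ev (fun K => (suppF K u : ℂ)) a

theorem suppA_add (a b : BodyAlg n) (u : En n) : suppA (a + b) u = suppA a u + suppA b u :=
  map_add _ _ _

theorem suppA_sub (a b : BodyAlg n) (u : En n) : suppA (a - b) u = suppA a u - suppA b u :=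
  map_sub _ _ _

theorem suppA_smul (c : ℂ) (a : BodyAlg n) (u : En n) : suppA (c • a) u = c * suppA a u :=
  map_smul _ _ _

@[simp] theorem suppA_br (K : Body n) (u : En n) : suppA (br K) u = suppF K u := ev_br _ _

theorem ev_eq_zero_of_suppA (ψ : Body n →ₗ[ℝ≥0] ℂ) {a : BodyAlg n}
    (h : ∀ u : En n, ‖u‖ = 1 → suppA a u = 0) : ev ψ a = 0 := by
  have h1 := sum_smul_apply_eq_zero ψ (s := a.coeff.support) (c := fun K => (a.coeff K).re)
    (fun u hu => by
      have := congrArg Complex.re (h u hu)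
      rw [suppA, ev_apply] at this
      simpa using this)
  have h2 := sum_smul_apply_eq_zero ψ (s := a.coeff.support) (c := fun K => (a.coeff K).im)
    (fun u hu => by
      have := congrArg Complex.im (h u hu)
      rw [suppA, ev_apply] at this
      simpa using this)
  rw [ev_apply]
  calc ∑ K ∈ a.coeff.support, a.coeff K * ψ K
      = ∑ K ∈ a.coeff.support, ((a.coeff K).re : ℂ) * ψ K +
        Complex.I * ∑ K ∈ a.coeff.support, ((a.coeff K).im : ℂ) * ψ K := by
        rw [Finset.mul_sum, ← Finset.sum_add_distrib]
        refine Finset.sum_congr rfl fun K _ => ?_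
        conv_lhs => rw [← Complex.re_add_im (a.coeff K)]
        ring
    _ = 0 := by rw [h1, h2, mul_zero, add_zero]

theorem exists_polynomial_ev {i : ℕ} {φ : Body n → ℂ} (hφ : IsPolyHom i φ) (K : Body n)
    (b : BodyAlg n) : ∃ p : ℂ[X], ∀ t : ℝ, 0 ≤ t → ev φ (br (t • K) * b) = p.eval (t : ℂ) := by
  induction b using bodyAlg_induction with
  | h0 => exact ⟨0, by simp⟩
  | hadd a b ha hb =>
    obtain ⟨p, hp⟩ := ha
    obtain ⟨q, hq⟩ := hb
    exact ⟨p + q, fun t ht => by rw [mul_add, map_add, hp t ht, hq t ht, Polynomial.eval_add]⟩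
  | hs c L =>
    obtain ⟨p, _, hp⟩ := hφ.2 K L
    exact ⟨c • p, fun t ht => by
      rw [mul_smul_comm, map_smul, ← br_add, ev_br, hp t ht, Polynomial.eval_smul]⟩

/-- For `b` in the `r`-th power of the augmentation ideal and `φ` of degree `r + 1`, the map
`K ↦ φ(([K] - 1) b)` is linear. -/
def evLin {r : ℕ} {φ : Body n → ℂ} (hφ : IsPolyHom (r + 1) φ) {b : BodyAlg n}
    (hb : b ∈ augI n ^ r) : Body n →ₗ[ℝ≥0] ℂ :=
  have hadd : ∀ K L, ev φ ((br (K + L) - 1) * b) = ev φ ((br K - 1) * b) + ev φ ((br L - 1) * b) := by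
    intro K L
    have e : (br (K + L) - 1) * b =
        (br K - 1) * b + (br L - 1) * b + (br K - 1) * ((br L - 1) * b) := by
      rw [br_add]; ring
    have h0 : ev φ ((br K - 1) * ((br L - 1) * b)) = 0 := by
      apply ev_eq_zero_of_mem_pow (r + 2) hφ (by lia)
      have e2 : augI n ^ (r + 2) = augI n * (augI n * augI n ^ r) :=
        (pow_succ' (augI n) (r + 1)).trans (congrArg (augI n * ·) (pow_succ' (augI n) r))
      rw [e2]
      exact Ideal.mul_mem_mul (br_sub_one_mem K) (Ideal.mul_mem_mul (br_sub_one_mem L) hb)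
    rw [e, map_add, map_add, h0, add_zero]
  { toFun := fun K => ev φ ((br K - 1) * b)
    map_add' := hadd
    map_smul' := by
      intro t K
      obtain ⟨p, hp⟩ := exists_polynomial_ev hφ K b
      have hN : ∀ N : ℕ, ev φ ((br ((N : ℝ) • K) - 1) * b) = N * ev φ ((br K - 1) * b) := by
        intro N
        induction N with
        | zero => rw [Nat.cast_zero, zero_smul_body, br_zero]; simp
        | succ N ih =>
          rw [natCast_smul_body] at ih ⊢
          rw [succ_nsmul, hadd, ih]
          push_cast
          ring
      have e : p - Polynomial.C (ev φ b) = Polynomial.C (ev φ ((br K - 1) * b)) * Polynomial.X := by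
        refine Polynomial.eq_of_infinite_eval_eq _ _ ((Set.infinite_range_of_injective
          (f := fun N : ℕ => (N : ℂ)) Nat.cast_injective).mono ?_)
        rintro _ ⟨N, rfl⟩
        have h1 := hN N
        have h2 := hp N N.cast_nonneg
        rw [sub_mul, map_sub, h2] at h1
        simp only [Complex.ofReal_natCast, one_mul] at h1
        simp only [Set.mem_ofPred_eq, Polynomial.eval_sub, Polynomial.eval_C, Polynomial.eval_mul,
          Polynomial.eval_X]
        rw [h1, mul_comm]
      have h3 := congrArg (Polynomial.eval ((t : ℝ) : ℂ)) e
      simp only [Polynomial.eval_sub, Polynomial.eval_C, Polynomial.eval_mul,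
          Polynomial.eval_X] at h3
      rw [← hp t t.coe_nonneg] at h3
      rw [NNReal.smul_def, NNReal.smul_def, RingHom.id_apply, Complex.real_smul, sub_mul, map_sub,
        one_mul, h3, mul_comm] }

theorem ev_mul_eq_zero_of_suppA {r : ℕ} {φ : Body n → ℂ} (hφ : IsPolyHom (r + 1) φ)
    {a b : BodyAlg n} (ha : a ∈ augI n) (hb : b ∈ augI n ^ r)
    (h : ∀ u : En n, ‖u‖ = 1 → suppA a u = 0) : ev φ (a * b) = 0 := by
  have h1 := ev_eq_zero_of_suppA (evLin hφ hb) h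
  have e : ∀ a : BodyAlg n, ev φ (a * b) = ev (evLin hφ hb) a + ev φ b * ev (fun _ => 1) a := by
    intro a
    induction a using bodyAlg_induction with
    | h0 => simp
    | hadd a c ha hc =>
      rw [add_mul, map_add, ha, hc, map_add, map_add]
      ring
    | hs c K =>
      rw [smul_mul_assoc, map_smul, map_smul, map_smul, ev_br, ev_br]
      change _ = c • ev φ ((br K - 1) * b) + _
      rw [sub_mul, map_sub, one_mul]
      simp only [smul_eq_mul]
      ring
  rw [e, h1, ev_one_of_mem ha, mul_zero, add_zero]

end AugmentationPowers

section Locality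

open scoped Polynomial

variable {n : ℕ}

theorem suppF_add_le (K : Body n) (u v : En n) : suppF K (u + v) ≤ suppF K u + suppF K v :=
  suppF_le fun x hx => by
    rw [inner_add_right]
    exact add_le_add (inner_le_suppF hx u) (inner_le_suppF hx v)

theorem continuous_suppF (K : Body n) : Continuous (suppF K) := by
  obtain ⟨R, hR, h⟩ := exists_norm_le K
  have h1 : ∀ u v, suppF K u ≤ suppF K v + R * dist u v := by
    intro u v
    refine suppF_le fun x hx => ?_
    have e : ⟪x, u⟫ = ⟪x, v⟫ + ⟪x, u - v⟫ := by rw [inner_sub_right]; ring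
    rw [e, dist_eq_norm]
    refine add_le_add (inner_le_suppF hx v) ((real_inner_le_norm _ _).trans ?_)
    gcongr
    exact h x hx
  exact (LipschitzWith.of_le_add_mul R.toNNReal fun u v => by
    rw [Real.coe_toNNReal _ hR.le]; exact h1 u v).continuous

theorem exists_unit_smul (u : En n) (hu : u ≠ 0) : ∃ v : En n, ‖v‖ = 1 ∧ u = ‖u‖ • v := by
  have h : ‖u‖ ≠ 0 := norm_ne_zero_iff.2 hu
  exact ⟨‖u‖⁻¹ • u, by rw [norm_smul, norm_inv, norm_norm, inv_mul_cancel₀ h],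
    by rw [smul_smul, mul_inv_cancel₀ h, one_smul]⟩

theorem suppF_zero_right (K : Body n) : suppF K 0 = 0 := by
  have := suppF_smul_right le_rfl K 0
  simpa using this

theorem valuation_local {φ : Body n → ℂ} (hφ : IsValuation φ) {U V U' V' : Body n}
    (hV : ∀ u : En n, ‖u‖ = 1 → suppF V u ≤ suppF U u)
    (hV' : ∀ u : En n, ‖u‖ = 1 → suppF V' u ≤ suppF U' u)
    (h : ∀ u : En n, ‖u‖ = 1 → suppF U u = suppF V u ∨ suppF U' u = suppF V' u) (L : Body n) :
    φ (U + V' + L) + φ (V + U' + L) = φ (U + U' + L) + φ (V + V' + L) := by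
  have ext : ∀ {K M : Body n} {v : En n} (r : ℝ), 0 ≤ r → suppF K v ≤ suppF M v →
      suppF K (r • v) ≤ suppF M (r • v) := by
    intro K M v r hr h
    rw [suppF_smul_right hr, suppF_smul_right hr]
    gcongr
  have hV : ∀ u : En n, suppF V u ≤ suppF U u := by
    intro u
    rcases eq_or_ne u 0 with rfl | hu
    · rw [suppF_zero_right, suppF_zero_right]
    · obtain ⟨v, hv, e⟩ := exists_unit_smul u hu
      rw [e]
      exact ext _ (norm_nonneg _) (hV v hv)
  have hV' : ∀ u : En n, suppF V' u ≤ suppF U' u := by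
    intro u
    rcases eq_or_ne u 0 with rfl | hu
    · rw [suppF_zero_right, suppF_zero_right]
    · obtain ⟨v, hv, e⟩ := exists_unit_smul u hu
      rw [e]
      exact ext _ (norm_nonneg _) (hV' v hv)
  have h : ∀ u : En n, suppF U u = suppF V u ∨ suppF U' u = suppF V' u := by
    intro u
    rcases eq_or_ne u 0 with rfl | hu
    · left
      rw [suppF_zero_right, suppF_zero_right]
    · obtain ⟨v, hv, e⟩ := exists_unit_smul u hu
      rw [e]
      refine (h v hv).imp (fun h' => ?_) fun h' => ?_ <;>
      rw [suppF_smul_right (norm_nonneg _), suppF_smul_right (norm_nonneg _), h']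
  refine hφ _ _ _ _ ?_ ?_
  · apply Set.Subset.antisymm
    · intro x hx
      by_contra hx'
      rw [Set.mem_union, not_or] at hx'
      obtain ⟨h1, h2⟩ := hx'
      have hex : ∀ {K : Body n}, x ∉ (K : Set (En n)) → ∃ u, suppF K u < ⟪x, u⟫ := by
        intro K hK
        by_contra! hc
        exact hK (mem_of_inner_le_suppF fun u _ => hc u)
      obtain ⟨u, hu⟩ := hex h1
      obtain ⟨v, hv⟩ := hex h2
      have hxu := inner_le_suppF (K := U + U' + L) hx
      have hbu : suppF U u = suppF V u := by
        refine (h u).resolve_right fun h' => ?_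
        have := hxu u
        simp only [suppF_add] at this hu
        linarith
      have hav : suppF U' v = suppF V' v := by
        refine (h v).resolve_left fun h' => ?_
        have := hxu v
        simp only [suppF_add] at this hv
        linarith
      have hc : ∀ K : Body n, Continuous fun t : ℝ => suppF K ((1 - t) • u + t • v) := fun K =>
        (continuous_suppF K).comp (by fun_prop)
      obtain ⟨t, ht, ht1, ht2⟩ := isPreconnected_closed_iff.1 (isPreconnected_Icc (a := (0 : ℝ))
        (b := 1)) {t | suppF U ((1 - t) • u + t • v) = suppF V ((1 - t) • u + t • v)}
        {t | suppF U' ((1 - t) • u + t • v) = suppF V' ((1 - t) • u + t • v)}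
        (isClosed_eq (hc _) (hc _)) (isClosed_eq (hc _) (hc _)) (fun t _ => h _)
        ⟨0, by simp, by simpa using hbu⟩ ⟨1, by simp, by simpa using hav⟩
      rw [Set.mem_ofPred_eq] at ht1 ht2
      set w := (1 - t) • u + t • v with hw
      have hN : suppF (V + V' + L) w < ⟪x, w⟫ := by
        have hu' : suppF (V + V' + L) u < ⟪x, u⟫ := by
          simp only [suppF_add] at hu ⊢
          linarith [hV u]
        have hv' : suppF (V + V' + L) v < ⟪x, v⟫ := by
          simp only [suppF_add] at hv ⊢
          linarith [hV' v]
        have h1t : 0 ≤ 1 - t := sub_nonneg.2 ht.2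
        have := suppF_add_le (V + V' + L) ((1 - t) • u) (t • v)
        rw [suppF_smul_right h1t, suppF_smul_right ht.1] at this
        rw [hw, inner_add_right, inner_smul_right, inner_smul_right]
        refine this.trans_lt ?_
        rcases h1t.eq_or_lt with h0 | h0
        · have : t = 1 := by linarith
          subst this
          simpa using hv'
        · exact add_lt_add_of_lt_of_le (mul_lt_mul_of_pos_left hu' h0)
            (mul_le_mul_of_nonneg_left hv'.le ht.1)
      have hD := hxu w
      simp only [suppF_add] at hN hD
      linarith
    · rintro x (hx | hx)
      · refine subset_of_suppF_le (fun u _ => ?_) hx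
        simp only [suppF_add]
        linarith [hV' u]
      · refine subset_of_suppF_le (fun u _ => ?_) hx
        simp only [suppF_add]
        linarith [hV u]
  · apply Set.Subset.antisymm
    · intro x hx
      refine ⟨subset_of_suppF_le (fun u _ => ?_) hx, subset_of_suppF_le (fun u _ => ?_) hx⟩
      · simp only [suppF_add]
        linarith [hV u]
      · simp only [suppF_add]
        linarith [hV' u]
    · rintro x ⟨h1, h2⟩
      refine mem_of_inner_le_suppF fun u _ => ?_
      have h1' := inner_le_suppF (K := U + V' + L) h1 u
      have h2' := inner_le_suppF (K := V + U' + L) h2 u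
      simp only [suppF_add] at h1' h2' ⊢
      rcases h u with h' | h' <;> linarith

theorem ev_local {φ : Body n → ℂ} (hφ : IsValuation φ) {U V U' V' : Body n}
    (hV : ∀ u : En n, ‖u‖ = 1 → suppF V u ≤ suppF U u)
    (hV' : ∀ u : En n, ‖u‖ = 1 → suppF V' u ≤ suppF U' u)
    (h : ∀ u : En n, ‖u‖ = 1 → suppF U u = suppF V u ∨ suppF U' u = suppF V' u)
    (b : BodyAlg n) : ev φ ((br U - br V) * ((br U' - br V') * b)) = 0 := by
  induction b using bodyAlg_induction with
  | h0 => simp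
  | hadd a b ha hb => rw [mul_add, mul_add, map_add, ha, hb, add_zero]
  | hs c L =>
    rw [mul_smul_comm, mul_smul_comm, map_smul]
    have e : (br U - br V) * ((br U' - br V') * br L) =
        br (U + U' + L) + br (V + V' + L) - (br (U + V' + L) + br (V + U' + L)) := by
      simp only [br_add]; ring
    rw [e, map_sub, map_add, map_add, ev_br, ev_br, ev_br, ev_br,
      valuation_local hφ hV hV' h L, sub_self, smul_zero]

theorem continuous_ev_br {φ : Body n → ℂ} (hφ : Continuous φ) (b : BodyAlg n) :
    Continuous fun K : Body n => ev φ (br K * b) := by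
  induction b using bodyAlg_induction with
  | h0 => simpa using continuous_const
  | hadd a b ha hb =>
    simp only [mul_add, map_add]
    exact ha.add hb
  | hs c L =>
    simp only [mul_smul_comm, map_smul, ← br_add, ev_br]
    exact (hφ.comp (continuous_id.add continuous_const)).const_smul c

theorem exists_norm_ev_le {q : ℕ} {φ : Body n → ℂ} (hφ : φ ∈ ValI n (q + 2)) {b : BodyAlg n}
    (hb : b ∈ augI n ^ q) : ∃ κ : ℝ, 0 < κ ∧ ∀ (r r' : ℝ) (K K' : Body n), 0 < r → 0 < r' →
      (∀ x ∈ K, ‖x‖ ≤ r) → (∀ x ∈ K', ‖x‖ ≤ r') →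
      ‖ev φ ((br K - 1) * ((br K' - 1) * b))‖ ≤ κ * (r * r') := by
  have hp := isPolyHom_of_mem hφ
  have hmem : ∀ K, (br K - 1) * b ∈ augI n ^ (q + 1) := fun K => by
    have e : augI n ^ (q + 1) = augI n * augI n ^ q := pow_succ' (augI n) q
    rw [e]
    exact Ideal.mul_mem_mul (br_sub_one_mem K) hb
  set β : Body n → Body n → ℂ := fun K K' => ev φ ((br K - 1) * ((br K' - 1) * b)) with hβ
  have hs1 : ∀ (t : ℝ), 0 ≤ t → ∀ K K', β (t • K) K' = t * β K K' := by
    intro t ht K K'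
    have := (evLin hp (hmem K')).map_smul t.toNNReal K
    rw [NNReal.smul_def, NNReal.smul_def, Real.coe_toNNReal _ ht, Complex.real_smul] at this
    exact this
  have hsymm : ∀ K K', β K K' = β K' K := by
    intro K K'
    simp only [hβ]
    rw [mul_left_comm]
  have hcont : Continuous fun p : Body n × Body n => β p.1 p.2 := by
    have e : (fun p : Body n × Body n => β p.1 p.2) = fun p => ev φ (br (p.1 + p.2) * b) -
        ev φ (br p.1 * b) - ev φ (br p.2 * b) + ev φ b := by
      funext p
      simp only [hβ]
      rw [← map_sub, ← map_sub, ← map_add, br_add]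
      congr 1
      ring
    rw [e]
    have hc := continuous_ev_br hφ.1.1 b
    exact (((hc.comp (continuous_fst.add continuous_snd)).sub (hc.comp continuous_fst)).sub
      (hc.comp continuous_snd)).add continuous_const
  have h00 : β 0 0 = 0 := by simp [hβ, br_zero]
  obtain ⟨δ, hδ, hd⟩ := Metric.continuousAt_iff.1 (hcont.continuousAt (x := (0, 0))) 1 one_pos
  rw [h00] at hd
  refine ⟨(δ / 2)⁻¹ ^ 2, by positivity, fun r r' K K' hr hr' hK hK' => ?_⟩
  have hsmall : ∀ (r : ℝ) (K : Body n), 0 < r → (∀ x ∈ K, ‖x‖ ≤ r) →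
      dist ((δ / 2 / r) • K) 0 ≤ δ / 2 := by
    intro r K hr hK
    refine dist_le_of_suppF (by positivity) fun u hu => ?_
    rw [suppF_zero, sub_zero, suppF_smul_of_nonneg (by positivity), abs_mul,
      abs_of_nonneg (by positivity : 0 ≤ δ / 2 / r)]
    calc δ / 2 / r * |suppF K u| ≤ δ / 2 / r * r := by
          gcongr
          exact abs_suppF_le hK hu
      _ = δ / 2 := by field_simp
  have hlt : ‖β ((δ / 2 / r) • K) ((δ / 2 / r') • K')‖ < 1 := by
    have := hd (x := ((δ / 2 / r) • K, (δ / 2 / r') • K')) (by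
      rw [Prod.dist_eq]
      exact (max_le (hsmall r K hr hK) (hsmall r' K' hr' hK')).trans_lt (by linarith))
    simpa using this
  rw [hs1 _ (by positivity), hsymm, hs1 _ (by positivity), hsymm, norm_mul, norm_mul,
    Complex.norm_real, Complex.norm_real, Real.norm_of_nonneg (by positivity),
    Real.norm_of_nonneg (by positivity)] at hlt
  change ‖β K K'‖ ≤ _
  have e : ‖β K K'‖ = (δ / 2)⁻¹ ^ 2 * (r * r') * (δ / 2 / r * (δ / 2 / r' * ‖β K K'‖)) := by
    field_simp
  rw [e]
  exact mul_le_of_le_one_right (by positivity) hlt.le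

end Locality

section Rep

open scoped Polynomial

variable {n : ℕ}

/-- The unit sphere. -/
abbrev Sph (n : ℕ) : Type := {u : En n // ‖u‖ = 1}

/-- Support functions on the sphere of the elements of the augmentation ideal. -/
def suppS (n : ℕ) : (augI n).restrictScalars ℂ →ₗ[ℂ] (Sph n → ℂ) where
  toFun a u := suppA (a : BodyAlg n) u
  map_add' a b := by ext u; exact suppA_add _ _ _
  map_smul' c a := by ext u; exact suppA_smul _ _ _

theorem exists_rep (n : ℕ) : ∃ ρ : (Sph n → ℂ) →ₗ[ℂ] (augI n).restrictScalars ℂ,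
    ∀ a, suppS n (ρ (suppS n a)) = suppS n a := by
  obtain ⟨g, hg⟩ := (suppS n).rangeRestrict.exists_rightInverse_of_surjective
    (LinearMap.range_rangeRestrict _)
  obtain ⟨ρ, hρ⟩ := g.exists_extend
  refine ⟨ρ, fun a => ?_⟩
  have h1 : ρ (suppS n a) = g ((suppS n).rangeRestrict a) := by
    rw [← hρ]; rfl
  have h2 := LinearMap.congr_fun hg ((suppS n).rangeRestrict a)
  rw [h1]
  exact congrArg Subtype.val h2

/-- A linear choice of representatives in the augmentation ideal of functions on the sphere. -/
def rep (n : ℕ) : (Sph n → ℂ) →ₗ[ℂ] BodyAlg n :=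
  ((augI n).restrictScalars ℂ).subtype ∘ₗ (exists_rep n).choose

theorem rep_mem (f : Sph n → ℂ) : rep n f ∈ augI n := ((exists_rep n).choose f).2

/-- A function on the sphere is representable if it is the support function of an element
of the augmentation ideal. -/
def IsRep (f : Sph n → ℂ) : Prop := ∃ a ∈ augI n, ∀ u : Sph n, suppA a u = f u

theorem IsRep.suppA_rep {f : Sph n → ℂ} (hf : IsRep f) (u : Sph n) : suppA (rep n f) u = f u := by
  obtain ⟨a, ha, h⟩ := hf
  have e : suppS n ⟨a, ha⟩ = f := funext h
  rw [← e]
  exact congrFun ((exists_rep n).choose_spec ⟨a, ha⟩) u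

theorem IsRep.add {f g : Sph n → ℂ} (hf : IsRep f) (hg : IsRep g) : IsRep (f + g) := by
  obtain ⟨a, ha, h⟩ := hf
  obtain ⟨b, hb, h'⟩ := hg
  exact ⟨a + b, (augI n).add_mem ha hb, fun u => by rw [suppA_add, h, h']; rfl⟩

theorem IsRep.smul {f : Sph n → ℂ} (c : ℂ) (hf : IsRep f) : IsRep (c • f) := by
  obtain ⟨a, ha, h⟩ := hf
  exact ⟨c • a, ((augI n).restrictScalars ℂ).smul_mem c ha, fun u => by rw [suppA_smul, h]; rfl⟩

theorem ev_congr_of_suppA {r : ℕ} {φ : Body n → ℂ} (hφ : IsPolyHom (r + 1) φ)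
    {a a' b : BodyAlg n} (ha : a ∈ augI n) (ha' : a' ∈ augI n) (hb : b ∈ augI n ^ r)
    (h : ∀ u : En n, ‖u‖ = 1 → suppA a u = suppA a' u) : ev φ (a * b) = ev φ (a' * b) := by
  have := ev_mul_eq_zero_of_suppA hφ ((augI n).sub_mem ha ha') hb
    (fun u hu => by rw [suppA_sub, h u hu, sub_self])
  rwa [sub_mul, map_sub, sub_eq_zero] at this

theorem mul_mem_pow_succ {a b : BodyAlg n} {r : ℕ} (ha : a ∈ augI n) (hb : b ∈ augI n ^ r) :
    a * b ∈ augI n ^ (r + 1) := by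
  have e : augI n ^ (r + 1) = augI n * augI n ^ r := pow_succ' (augI n) r
  rw [e]
  exact Ideal.mul_mem_mul ha hb

end Rep

section Good

open scoped Polynomial

variable {n : ℕ}

/-- Functions on the sphere with two-sided quadratic first order Taylor estimates. -/
def Good (f : En n → ℝ) (A : ℝ) : Prop :=
  ∀ q : En n, ‖q‖ = 1 → |f q| ≤ A ∧ ∃ v : En n, ‖v‖ ≤ A ∧
    ∀ θ : En n, ‖θ‖ = 1 → |f θ - f q - ⟪v, θ - q⟫| ≤ A * ‖θ - q‖ ^ 2

theorem norm_sub_le_two {q θ : En n} (hq : ‖q‖ = 1) (hθ : ‖θ‖ = 1) : ‖θ - q‖ ≤ 2 := by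
  have := norm_sub_le θ q
  rw [hq, hθ] at this
  linarith

theorem Good.mul {f g : En n → ℝ} {A B : ℝ} (hA : 0 ≤ A) (hB : 0 ≤ B) (hf : Good f A)
    (hg : Good g B) : Good (fun u => f u * g u) (11 * A * B) := by
  intro q hq
  obtain ⟨h1, v, hv, h2⟩ := hf q hq
  obtain ⟨k1, w, hw, k2⟩ := hg q hq
  have hAB := mul_nonneg hA hB
  refine ⟨?_, g q • v + f q • w, ?_, fun θ hθ => ?_⟩
  · rw [abs_mul]
    exact (mul_le_mul h1 k1 (abs_nonneg _) hA).trans (by linarith)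
  · refine (norm_add_le _ _).trans ?_
    rw [norm_smul, norm_smul, Real.norm_eq_abs, Real.norm_eq_abs]
    have e1 := mul_le_mul k1 hv (norm_nonneg _) hB
    have e2 := mul_le_mul h1 hw (norm_nonneg _) hA
    linarith
  · have hd := norm_sub_le_two hq hθ
    set d := ‖θ - q‖ with hd'
    have hd0 : 0 ≤ d := norm_nonneg _
    have lip : ∀ {f : En n → ℝ} {v : En n} {A : ℝ}, ‖v‖ ≤ A →
        |f θ - f q - ⟪v, θ - q⟫| ≤ A * d ^ 2 → |f θ - f q| ≤ 3 * A * d := by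
      intro f v A hv h
      have hA : 0 ≤ A := (norm_nonneg _).trans hv
      have h3 : |⟪v, θ - q⟫| ≤ A * d := (abs_real_inner_le_norm _ _).trans (by gcongr)
      have h4 : A * d ^ 2 ≤ 2 * A * d := by nlinarith [mul_nonneg hA hd0]
      have := abs_add_le (f θ - f q - ⟪v, θ - q⟫) ⟪v, θ - q⟫
      rw [sub_add_cancel] at this
      linarith
    have l1 := lip hv (h2 θ hθ)
    have l2 := lip hw (k2 θ hθ)
    have e : f θ * g θ - f q * g q - ⟪g q • v + f q • w, θ - q⟫ =
        g q * (f θ - f q - ⟪v, θ - q⟫) + f q * (g θ - g q - ⟪w, θ - q⟫) +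
        (f θ - f q) * (g θ - g q) := by
      rw [inner_add_left, real_inner_smul_left, real_inner_smul_left]
      ring
    rw [e]
    refine (abs_add_three _ _ _).trans ?_
    rw [abs_mul, abs_mul, abs_mul]
    have m1 := mul_le_mul k1 (h2 θ hθ) (abs_nonneg _) hB
    have m2 := mul_le_mul h1 (k2 θ hθ) (abs_nonneg _) hA
    have m3 := mul_le_mul l1 l2 (abs_nonneg _) (by positivity)
    nlinarith

theorem good_const (c : ℝ) : Good (fun _ : En n => c) |c| := fun q _ =>
  ⟨le_rfl, 0, by simp, fun θ _ => by simp; positivity⟩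

theorem good_coord (a : Fin n) : Good (fun u : En n => u a) 1 := by
  intro q hq
  refine ⟨?_, EuclideanSpace.single a 1, by simp, fun θ _ => ?_⟩
  · have := PiLp.norm_apply_le q a
    rwa [hq] at this
  · rw [EuclideanSpace.inner_single_left]
    simp

theorem Good.exists_body {f : En n → ℝ} {A : ℝ} (hf : Good f A) :
    ∃ K : Body n, ∀ u : En n, ‖u‖ = 1 → suppF K u = f u + 4 * A := by
  apply exists_body_suppF (C := 5 * A)
  · intro u hu
    linarith [le_abs_self (f u), (hf u hu).1]
  · intro q hq
    obtain ⟨h1, v, hv, h2⟩ := hf q hq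
    have hqq : ⟪q, q⟫ = 1 := by rw [real_inner_self_eq_norm_sq, hq, one_pow]
    refine ⟨v + (f q + 4 * A - ⟪v, q⟫) • q, fun θ hθ => ?_, ?_⟩
    · have hd : ⟪q, θ⟫ = 1 - ‖θ - q‖ ^ 2 / 2 := by
        rw [norm_sub_sq_real, hq, hθ, real_inner_comm]
        ring
      rw [inner_add_left, real_inner_smul_left, hd]
      have h3 := (abs_le.1 (h2 θ hθ)).1
      rw [inner_sub_right] at h3
      have h4 := (abs_le.1 h1).1
      have h5 : ⟪v, q⟫ ≤ A := (real_inner_le_norm _ _).trans (by rw [hq, mul_one]; exact hv)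
      nlinarith [sq_nonneg ‖θ - q‖]
    · rw [inner_add_left, real_inner_smul_left, hqq]
      ring

theorem norm_le_of_suppF_le {K : Body n} {R : ℝ} (hR : 0 ≤ R)
    (h : ∀ u : En n, ‖u‖ = 1 → suppF K u ≤ R) : ∀ x ∈ K, ‖x‖ ≤ R := by
  intro x hx
  rcases eq_or_ne x 0 with rfl | hx0
  · simpa using hR
  · obtain ⟨v, hv, e⟩ := exists_unit_smul x hx0
    have := (inner_le_suppF hx v).trans (h v hv)
    have h2 : ⟪x, v⟫ = ‖x‖ := by
      conv_lhs => rw [e]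
      rw [real_inner_smul_left, real_inner_self_eq_norm_sq, hv, one_pow, mul_one]
    rwa [h2] at this

/-- Restriction of a real function to the sphere. -/
def res : (En n → ℝ) →ₗ[ℝ] (Sph n → ℂ) where
  toFun f u := (f u : ℂ)
  map_add' f g := by ext u; simp
  map_smul' c f := by ext u; simp

theorem Good.exists_rep {f : En n → ℝ} {A : ℝ} (hA : 0 ≤ A) (hf : Good f A) :
    ∃ K L : Body n, (∀ u : En n, ‖u‖ = 1 → suppF K u - suppF L u = f u) ∧
      (∀ x ∈ K, ‖x‖ ≤ 5 * A) ∧ ∀ x ∈ L, ‖x‖ ≤ 5 * A := by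
  obtain ⟨K, hK⟩ := hf.exists_body
  have hL : ∀ u : En n, ‖u‖ = 1 → suppF ((4 * A) • unitB n) u = 4 * A := fun u hu => by
    rw [suppF_smul_of_nonneg (by positivity), suppF_unitB hu, mul_one]
  refine ⟨K, (4 * A) • unitB n, fun u hu => ?_, norm_le_of_suppF_le (by positivity) fun u hu => ?_,
    norm_le_of_suppF_le (by positivity) fun u hu => ?_⟩
  · rw [hK u hu, hL u hu, add_sub_cancel_right]
  · rw [hK u hu]
    linarith [le_abs_self (f u), (hf u hu).1]
  · rw [hL u hu]
    linarith

theorem suppA_br_sub_br {K L : Body n} {f : En n → ℝ}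
    (h : ∀ u : En n, ‖u‖ = 1 → suppF K u - suppF L u = f u) (u : Sph n) :
    suppA (br K - br L) u = res f u := by
  rw [suppA_sub, suppA_br, suppA_br, ← Complex.ofReal_sub, h u u.2]
  rfl

theorem Good.isRep {f : En n → ℝ} {A : ℝ} (hA : 0 ≤ A) (hf : Good f A) : IsRep (res f) := by
  obtain ⟨K, L, h, -, -⟩ := hf.exists_rep hA
  exact ⟨br K - br L, br_sub_br_mem K L, suppA_br_sub_br h⟩

end Good

section Bilinear

open scoped Polynomial

variable {n q : ℕ}

/-- The bilinear form on functions on the sphere given by two slots of a valuation. -/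
def bet (φ : Body n → ℂ) (b : BodyAlg n) (f g : En n → ℝ) : ℂ :=
  ev φ (rep n (res f) * (rep n (res g) * b))

theorem bet_eq {φ : Body n → ℂ} (hφ : IsPolyHom (q + 2) φ) {b : BodyAlg n} (hb : b ∈ augI n ^ q)
    {f g : En n → ℝ} {K L K' L' : Body n}
    (h : ∀ u : En n, ‖u‖ = 1 → suppF K u - suppF L u = f u)
    (h' : ∀ u : En n, ‖u‖ = 1 → suppF K' u - suppF L' u = g u) :
    bet φ b f g = ev φ ((br K - br L) * ((br K' - br L') * b)) := by
  have hf : IsRep (res f) := ⟨br K - br L, br_sub_br_mem K L, suppA_br_sub_br h⟩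
  have hg : IsRep (res g) := ⟨br K' - br L', br_sub_br_mem K' L', suppA_br_sub_br h'⟩
  rw [bet, ev_congr_of_suppA (r := q + 1) hφ (rep_mem _) (br_sub_br_mem K L)
    (mul_mem_pow_succ (rep_mem _) hb) (fun u hu => by
      rw [hf.suppA_rep ⟨u, hu⟩, ← suppA_br_sub_br h ⟨u, hu⟩]), mul_left_comm,
    ev_congr_of_suppA (r := q + 1) hφ (rep_mem _) (br_sub_br_mem K' L')
    (mul_mem_pow_succ (br_sub_br_mem K L) hb) (fun u hu => by
      rw [hg.suppA_rep ⟨u, hu⟩, ← suppA_br_sub_br h' ⟨u, hu⟩]), mul_left_comm]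

theorem exists_norm_bet_le {φ : Body n → ℂ} (hφ : φ ∈ ValI n (q + 2)) {b : BodyAlg n}
    (hb : b ∈ augI n ^ q) : ∃ κ : ℝ, 0 < κ ∧ ∀ (f g : En n → ℝ) (A B : ℝ), 0 < A → 0 < B →
      Good f A → Good g B → ‖bet φ b f g‖ ≤ κ * (A * B) := by
  obtain ⟨κ, hκ, h⟩ := exists_norm_ev_le hφ hb
  refine ⟨100 * κ, by positivity, fun f g A B hA hB hf hg => ?_⟩
  obtain ⟨K, L, h1, hK, hL⟩ := hf.exists_rep hA.le
  obtain ⟨K', L', h2, hK', hL'⟩ := hg.exists_rep hB.le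
  have hA5 : 0 < 5 * A := by positivity
  have hB5 : 0 < 5 * B := by positivity
  rw [bet_eq (isPolyHom_of_mem hφ) hb h1 h2]
  have e : (br K - br L) * ((br K' - br L') * b) =
      (br K - 1) * ((br K' - 1) * b) - (br K - 1) * ((br L' - 1) * b) -
      ((br L - 1) * ((br K' - 1) * b) - (br L - 1) * ((br L' - 1) * b)) := by ring
  rw [e, map_sub, map_sub, map_sub]
  have k1 := h _ _ K K' hA5 hB5 hK hK'
  have k2 := h _ _ K L' hA5 hB5 hK hL'
  have k3 := h _ _ L K' hA5 hB5 hL hK'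
  have k4 := h _ _ L L' hA5 hB5 hL hL'
  refine (norm_sub_le_of_le (norm_sub_le_of_le k1 k2) (norm_sub_le_of_le k3 k4)).trans ?_
  linarith

theorem bet_eq_zero_of_mul_eq_zero {φ : Body n → ℂ} (hφ : φ ∈ ValI n (q + 2)) {b : BodyAlg n}
    (hb : b ∈ augI n ^ q) {f g : En n → ℝ} {A B : ℝ} (hA : 0 ≤ A) (hB : 0 ≤ B)
    (hf : Good f A) (hg : Good g B) (hfg : ∀ u : En n, ‖u‖ = 1 → f u = 0 ∨ g u = 0) :
    bet φ b f g = 0 := by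
  obtain ⟨K, L, h1, -, -⟩ := hf.exists_rep hA
  obtain ⟨K', L', h2, -, -⟩ := hg.exists_rep hB
  obtain ⟨M, hM⟩ := exists_body_max K L
  obtain ⟨M', hM'⟩ := exists_body_max K' L'
  rw [bet_eq (isPolyHom_of_mem hφ) hb h1 h2]
  have e : (br K - br L) * ((br K' - br L') * b) =
      (br M - br L) * ((br M' - br L') * b) - (br M - br L) * ((br M' - br K') * b) -
      ((br M - br K) * ((br M' - br L') * b) - (br M - br K) * ((br M' - br K') * b)) := by ring
  have hK : ∀ u : En n, ‖u‖ = 1 → suppF K u ≤ suppF M u := fun u hu =>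
    (le_max_left _ _).trans (hM u hu).ge
  have hL : ∀ u : En n, ‖u‖ = 1 → suppF L u ≤ suppF M u := fun u hu =>
    (le_max_right _ _).trans (hM u hu).ge
  have hK' : ∀ u : En n, ‖u‖ = 1 → suppF K' u ≤ suppF M' u := fun u hu =>
    (le_max_left _ _).trans (hM' u hu).ge
  have hL' : ∀ u : En n, ‖u‖ = 1 → suppF L' u ≤ suppF M' u := fun u hu =>
    (le_max_right _ _).trans (hM' u hu).ge
  have hz : ∀ u : En n, ‖u‖ = 1 → (suppF M u = suppF K u ∧ suppF M u = suppF L u) ∨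
      (suppF M' u = suppF K' u ∧ suppF M' u = suppF L' u) := by
    intro u hu
    refine (hfg u hu).imp (fun h => ?_) fun h => ?_
    · have h' := h1 u hu
      rw [h, sub_eq_zero] at h'
      rw [hM u hu, h', max_self]
      exact ⟨rfl, rfl⟩
    · have h' := h2 u hu
      rw [h, sub_eq_zero] at h'
      rw [hM' u hu, h', max_self]
      exact ⟨rfl, rfl⟩
  have hv := hφ.1.2.1
  rw [e, map_sub, map_sub, map_sub,
    ev_local hv hL hL' (fun u hu => (hz u hu).imp (·.2) (·.2)),
    ev_local hv hL hK' (fun u hu => (hz u hu).imp (·.2) (·.1)),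
    ev_local hv hK hL' (fun u hu => (hz u hu).imp (·.1) (·.2)),
    ev_local hv hK hK' (fun u hu => (hz u hu).imp (·.1) (·.1))]
  simp

end Bilinear

section Cutoff

open scoped Polynomial

/-- One-variable functions with bounded values and quadratic first order Taylor estimates. -/
def GoodReal (w : ℝ → ℝ) (W : ℝ) : Prop :=
  ∀ s, |w s| ≤ W ∧ ∃ d, |d| ≤ W ∧ ∀ t, |w t - w s - d * (t - s)| ≤ W * (t - s) ^ 2

theorem exists_goodReal {w : ℝ → ℝ} (hw : ContDiff ℝ 2 w) (hc : HasCompactSupport w) :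
    ∃ W, GoodReal w W := by
  have hd : Differentiable ℝ w := hw.differentiable (by norm_num)
  have hw1 : ContDiff ℝ 1 (deriv w) := hw.deriv' (n := 1)
  have hd1 : Differentiable ℝ (deriv w) := hw1.differentiable (by norm_num)
  obtain ⟨W0, h0⟩ := hc.exists_bound_of_continuous hw.continuous
  obtain ⟨W1, h1⟩ := hc.deriv.exists_bound_of_continuous hw1.continuous
  obtain ⟨W2, h2⟩ := hc.deriv.deriv.exists_bound_of_continuous (hw1.continuous_deriv le_rfl)
  have hlip : ∀ s t, |deriv w t - deriv w s| ≤ W2 * |t - s| := fun s t =>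
    convex_univ.norm_image_sub_le_of_norm_deriv_le (fun x _ => hd1 x) (fun x _ => h2 x)
      (Set.mem_univ s) (Set.mem_univ t)
  have hW2 : 0 ≤ W2 := (norm_nonneg _).trans (h2 0)
  refine ⟨max W0 (max W1 W2), fun s => ⟨(h0 s).trans (le_max_left _ _), deriv w s,
    (h1 s).trans ((le_max_left _ _).trans (le_max_right _ _)), fun t => ?_⟩⟩
  have hder : ∀ x, HasDerivAt (fun x => w x - deriv w s * x) (deriv w x - deriv w s) x := fun x => by
    have h := ((hasDerivAt_id x).const_mul (deriv w s))
    rw [mul_one] at h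
    exact (hd x).hasDerivAt.sub h
  have key := (convex_uIcc s t).norm_image_sub_le_of_norm_hasDerivWithin_le
    (f := fun x => w x - deriv w s * x) (C := W2 * |t - s|)
    (fun x _ => (hder x).hasDerivWithinAt) (fun x hx => (hlip s x).trans
      (mul_le_mul_of_nonneg_left (Set.abs_sub_left_of_mem_uIcc hx) hW2)) Set.left_mem_uIcc Set.right_mem_uIcc
  rw [Real.norm_eq_abs, Real.norm_eq_abs, mul_assoc, ← sq, sq_abs] at key
  have e : w t - w s - deriv w s * (t - s) = w t - deriv w s * t - (w s - deriv w s * s) := by ring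
  rw [e]
  refine key.trans ?_
  gcongr
  exact (le_max_right _ _).trans (le_max_right _ _)

theorem GoodReal.mono {w : ℝ → ℝ} {W W' : ℝ} (h : GoodReal w W) (hW : W ≤ W') : GoodReal w W' := by
  intro s
  obtain ⟨h1, d, hd, h2⟩ := h s
  exact ⟨h1.trans hW, d, hd.trans hW, fun t => (h2 t).trans (by gcongr)⟩

theorem GoodReal.good {n : ℕ} {w : ℝ → ℝ} {W : ℝ} (hw : GoodReal w W) (a : Fin n) (c : ℝ) {m : ℝ}
    (hm : 1 ≤ m) : Good (fun u : En n => w (m * (u a - c))) (W * m ^ 2) := by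
  have hW : 0 ≤ W := (abs_nonneg _).trans (hw 0).1
  have hm2 : m ≤ m ^ 2 := by nlinarith
  intro q _
  obtain ⟨h1, d, hd, h2⟩ := hw (m * (q a - c))
  refine ⟨h1.trans (le_mul_of_one_le_right hW (by nlinarith)), (d * m) • EuclideanSpace.single a 1,
    ?_, fun θ _ => ?_⟩
  · rw [norm_smul, PiLp.norm_single, norm_one, mul_one, Real.norm_eq_abs, abs_mul,
      abs_of_nonneg (by linarith : 0 ≤ m)]
    exact mul_le_mul hd hm2 (by linarith) hW
  · rw [real_inner_smul_left, EuclideanSpace.inner_single_left]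
    have := h2 (m * (θ a - c))
    have e : m * (θ a - c) - m * (q a - c) = m * (θ a - q a) := by ring
    rw [e, ← mul_assoc, mul_pow, ← mul_assoc] at this
    simp only [map_one, one_mul, PiLp.sub_apply]
    refine this.trans ?_
    have h3 : (θ a - q a) ^ 2 ≤ ‖θ - q‖ ^ 2 := by
      rw [← sq_abs (θ a - q a)]
      gcongr
      exact PiLp.norm_apply_le (θ - q) a
    gcongr

theorem Good.const_mul {n : ℕ} {f : En n → ℝ} {A : ℝ} (hf : Good f A) (c : ℝ) :
    Good (fun u => c * f u) (|c| * A) := by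
  intro q hq
  obtain ⟨h1, v, hv, h2⟩ := hf q hq
  refine ⟨by rw [abs_mul]; gcongr, c • v, by rw [norm_smul, Real.norm_eq_abs]; gcongr,
    fun θ hθ => ?_⟩
  have e : c * f θ - c * f q - ⟪c • v, θ - q⟫ = c * (f θ - f q - ⟪v, θ - q⟫) := by
    rw [real_inner_smul_left]; ring
  rw [e, abs_mul, mul_assoc]
  gcongr
  exact h2 θ hθ

theorem Good.congr {n : ℕ} {f g : En n → ℝ} {A : ℝ} (hf : Good f A) (h : ∀ u, f u = g u) :
    Good g A := by
  rwa [← funext h]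

/-- A smooth bump function whose integer translates sum to one. -/
def bump (s : ℝ) : ℝ := Real.smoothTransition (s + 1) - Real.smoothTransition s

theorem bump_eq_zero {s : ℝ} (hs : 1 ≤ |s|) : bump s = 0 := by
  rcases le_abs'.1 hs with h | h
  · rw [bump, Real.smoothTransition.zero_of_nonpos (by linarith),
      Real.smoothTransition.zero_of_nonpos (by linarith), sub_zero]
  · rw [bump, Real.smoothTransition.one_of_one_le (by linarith),
      Real.smoothTransition.one_of_one_le (by linarith), sub_self]

theorem contDiff_bump : ContDiff ℝ 2 bump :=
  (Real.smoothTransition.contDiff.comp (contDiff_id.add contDiff_const)).sub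
    Real.smoothTransition.contDiff

theorem exists_goodReal_bump (j : ℕ) (e : ℝ) :
    ∃ W, GoodReal (fun s => s ^ j * bump (s - e)) W := by
  apply exists_goodReal
  · exact (contDiff_id.pow j).mul (contDiff_bump.comp (contDiff_id.sub contDiff_const))
  · refine HasCompactSupport.intro (isCompact_Icc (a := e - 1) (b := e + 1)) fun s hs => ?_
    have h : 1 ≤ |s - e| := by
      by_contra! hc
      rw [abs_lt] at hc
      exact hs ⟨by linarith, by linarith⟩
    simp only [bump_eq_zero h, mul_zero]

theorem sum_bump {m : ℕ} (hm : 1 ≤ m) {x : ℝ} (hx : |x| ≤ 1) :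
    ∑ l ∈ Finset.range (2 * m + 1), bump (m * (x + 1) - l) = 1 := by
  rw [abs_le] at hx
  have h := Finset.sum_range_sub' (fun l : ℕ => Real.smoothTransition (m * (x + 1) + 1 - l))
    (2 * m + 1)
  have e : ∀ l : ℕ, bump (m * (x + 1) - l) = Real.smoothTransition (m * (x + 1) + 1 - l) -
      Real.smoothTransition (m * (x + 1) + 1 - (l + 1 : ℕ)) := by
    intro l
    rw [bump]
    push_cast
    congr 2 <;> ring
  simp only [e]
  rw [h]
  have hm' : (1 : ℝ) ≤ m := by exact_mod_cast hm
  rw [Real.smoothTransition.one_of_one_le, Real.smoothTransition.zero_of_nonpos, sub_zero]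
  · push_cast
    nlinarith
  · push_cast
    nlinarith

end Cutoff

section Nilpotency

open scoped Polynomial

variable {n q : ℕ}

/-- The two-slot form as a real bilinear map. -/
def betL (φ : Body n → ℂ) (b : BodyAlg n) : (En n → ℝ) →ₗ[ℝ] (En n → ℝ) →ₗ[ℝ] ℂ :=
  LinearMap.mk₂ ℝ (bet φ b)
    (fun f g h => by simp only [bet, map_add, add_mul])
    (fun c f h => by
      simp only [bet, map_smul, LinearMap.map_smul_of_tower, smul_mul_assoc])
    (fun f g h => by simp only [bet, map_add, add_mul, mul_add])
    (fun c f h => by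
      simp only [bet, map_smul, LinearMap.map_smul_of_tower, smul_mul_assoc, mul_smul_comm])

theorem bet_congr {φ : Body n → ℂ} {b : BodyAlg n} {f f' g g' : En n → ℝ}
    (hf : ∀ u : En n, ‖u‖ = 1 → f u = f' u) (hg : ∀ u : En n, ‖u‖ = 1 → g u = g' u) :
    bet φ b f g = bet φ b f' g' := by
  have e : ∀ {f f' : En n → ℝ}, (∀ u : En n, ‖u‖ = 1 → f u = f' u) → res f = res f' := by
    intro f f' h
    ext u
    exact congrArg Complex.ofReal (h u u.2)
  rw [bet, bet, e hf, e hg]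

/-- The sixth power of the difference of the multiplications by a coordinate in the two slots. -/
def diffSix (φ : Body n → ℂ) (b : BodyAlg n) (a : Fin n) (c : ℝ) (f g : En n → ℝ) : ℂ :=
  ∑ j ∈ Finset.range 7, ((-1) ^ j * (Nat.choose 6 j) : ℝ) •
    bet φ b (fun u => (u a - c) ^ j * f u) (fun u => (u a - c) ^ (6 - j) * g u)

open TensorProduct in
theorem diffSix_shift (φ : Body n → ℂ) (b : BodyAlg n) (a : Fin n) (c : ℝ) (f g : En n → ℝ) :
    diffSix φ b a c f g = diffSix φ b a 0 f g := by
  let m : (En n → ℝ) → ℝ[X] →ₗ[ℝ] (En n → ℝ) := fun f =>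
    { toFun := fun p u => p.eval (u a) * f u
      map_add' := fun p q => by ext u; simp [add_mul]
      map_smul' := fun c p => by ext u; simp [mul_assoc] }
  let B : ℝ[X] ⊗[ℝ] ℝ[X] →ₗ[ℝ] ℂ := TensorProduct.lift ((betL φ b).compl₁₂ (m f) (m g))
  have hB : ∀ c : ℝ, diffSix φ b a c f g = B ((1 ⊗ₜ (Polynomial.X - Polynomial.C c) -
      (Polynomial.X - Polynomial.C c) ⊗ₜ 1) ^ 6) := by
    intro c
    rw [sub_eq_neg_add, add_pow, map_sum, diffSix]
    refine Finset.sum_congr rfl fun j _ => ?_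
    have e : (-((Polynomial.X - Polynomial.C c) ⊗ₜ[ℝ] (1 : ℝ[X]))) ^ j *
        ((1 : ℝ[X]) ⊗ₜ[ℝ] (Polynomial.X - Polynomial.C c)) ^ (6 - j) * ((Nat.choose 6 j : ℕ) : ℝ[X] ⊗[ℝ] ℝ[X]) =
        ((-1 : ℝ) ^ j * ((Nat.choose 6 j : ℕ) : ℝ)) • (((Polynomial.X - Polynomial.C c) ^ j) ⊗ₜ[ℝ]
          ((Polynomial.X - Polynomial.C c) ^ (6 - j))) := by
      generalize Polynomial.X - Polynomial.C c = P
      have h : (P ^ j) ⊗ₜ[ℝ] (P ^ (6 - j)) = (P ⊗ₜ[ℝ] (1 : ℝ[X])) ^ j *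
          ((1 : ℝ[X]) ⊗ₜ[ℝ] P) ^ (6 - j) := by
        rw [Algebra.TensorProduct.tmul_pow, Algebra.TensorProduct.tmul_pow,
          Algebra.TensorProduct.tmul_mul_tmul, one_pow, one_pow, one_mul, mul_one]
      have hs : ∀ (r : ℝ) (x : ℝ[X] ⊗[ℝ] ℝ[X]), r • x = algebraMap ℝ (ℝ[X] ⊗[ℝ] ℝ[X]) r * x :=
        fun r x => Algebra.smul_def r x
      rw [h, neg_pow (P ⊗ₜ[ℝ] (1 : ℝ[X])), hs, map_mul, map_pow, map_neg, map_one,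
        map_natCast]
      ring
    rw [e, map_smul]
    congr 1
    simp only [B, TensorProduct.lift.tmul, LinearMap.compl₁₂_apply]
    change _ = bet φ b _ _
    congr 1 <;> ext u <;> simp [m]
  rw [hB, hB]
  congr 2
  have e : (Polynomial.C c) ⊗ₜ[ℝ] (1 : ℝ[X]) = (1 : ℝ[X]) ⊗ₜ[ℝ] (Polynomial.C c) := by
    have h : Polynomial.C c = c • (1 : ℝ[X]) := by rw [Algebra.smul_def, mul_one]; rfl
    rw [h, TensorProduct.smul_tmul]
  rw [TensorProduct.tmul_sub, TensorProduct.sub_tmul, Polynomial.C_0, sub_zero, e]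
  abel

end Nilpotency

section Nilpotency

variable {n q : ℕ}

/-- `diffSix` as a bilinear map. -/
def diffSixL (φ : Body n → ℂ) (b : BodyAlg n) (a : Fin n) (c : ℝ) :
    (En n → ℝ) →ₗ[ℝ] (En n → ℝ) →ₗ[ℝ] ℂ :=
  ∑ j ∈ Finset.range 7, ((-1 : ℝ) ^ j * ((Nat.choose 6 j : ℕ) : ℝ)) •
    (betL φ b).compl₁₂ (LinearMap.mulLeft ℝ (fun u : En n => (u a - c) ^ j))
      (LinearMap.mulLeft ℝ (fun u : En n => (u a - c) ^ (6 - j)))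

theorem diffSixL_apply (φ : Body n → ℂ) (b : BodyAlg n) (a : Fin n) (c : ℝ) (f g : En n → ℝ) :
    diffSixL φ b a c f g = diffSix φ b a c f g := by
  simp only [diffSixL, LinearMap.sum_apply, LinearMap.smul_apply]
  rfl

theorem diffSix_congr {φ : Body n → ℂ} {b : BodyAlg n} {a : Fin n} {c : ℝ} {f f' g g' : En n → ℝ}
    (hf : ∀ u : En n, ‖u‖ = 1 → f u = f' u) (hg : ∀ u : En n, ‖u‖ = 1 → g u = g' u) :
    diffSix φ b a c f g = diffSix φ b a c f' g' := by
  refine Finset.sum_congr rfl fun j _ => ?_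
  rw [bet_congr (f' := fun u => (u a - c) ^ j * f' u) (g' := fun u => (u a - c) ^ (6 - j) * g' u)]
  · intro u hu
    simp only [hf u hu]
  · intro u hu
    simp only [hg u hu]

theorem good_cell {w e m c d A : ℝ} {j : ℕ} {f : En n → ℝ} {a : Fin n}
    (hw : GoodReal (fun s => s ^ j * bump (s - e)) w) (hw0 : 0 ≤ w) (hm : 1 ≤ m) (hA : 0 ≤ A)
    (hf : Good f A) (hc : m * (c + 1) + e = d) :
    Good (fun u => (u a - c) ^ j * (bump (m * (u a + 1) - d) * f u))
      (11 * ((m ^ j)⁻¹ * (w * m ^ 2)) * A) := by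
  have hm0 : 0 < m := by linarith
  have h := (hw.good a c hm).const_mul (m ^ j)⁻¹
  rw [abs_of_pos (by positivity)] at h
  refine (Good.mul (by positivity) hA h hf).congr fun u => ?_
  have e1 : m * (u a - c) - e = m * (u a + 1) - d := by rw [← hc]; ring
  rw [e1, mul_pow]
  field_simp

theorem exists_goodReal_bump_uniform :
    ∃ W > 0, ∀ j < 7, ∀ e : ℝ, (e = -1 ∨ e = 0 ∨ e = 1) →
      GoodReal (fun s => s ^ j * bump (s - e)) W := by
  choose W hW using exists_goodReal_bump
  refine ⟨1 + ∑ j ∈ Finset.range 7, (|W j (-1)| + |W j 0| + |W j 1|), by positivity,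
    fun j hj e he => (hW j e).mono ?_⟩
  have h := Finset.single_le_sum (f := fun j => |W j (-1)| + |W j 0| + |W j 1|)
    (fun j _ => by positivity) (Finset.mem_range.2 hj)
  have h1 := le_abs_self (W j (-1))
  have h2 := le_abs_self (W j 0)
  have h3 := le_abs_self (W j 1)
  have h4 := abs_nonneg (W j (-1))
  have h5 := abs_nonneg (W j 0)
  have h6 := abs_nonneg (W j 1)
  rcases he with rfl | rfl | rfl <;> linarith

theorem diffSix_far {φ : Body n → ℂ} {b : BodyAlg n} (hφ : φ ∈ ValI n (q + 2))
    (hb : b ∈ augI n ^ q) (a : Fin n) {f g : En n → ℝ} {A B m : ℝ} (hA : 0 < A) (hB : 0 < B)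
    (hf : Good f A) (hg : Good g B) (hm : 1 ≤ m) {l l' : ℕ} (hl : l + 1 < l' ∨ l' + 1 < l) :
    diffSix φ b a 0 (fun u => bump (m * (u a + 1) - l) * f u)
      (fun u => bump (m * (u a + 1) - l') * g u) = 0 := by
  refine Finset.sum_eq_zero fun j _ => ?_
  obtain ⟨w, hw⟩ := exists_goodReal_bump j (l - m)
  obtain ⟨w', hw'⟩ := exists_goodReal_bump (6 - j) (l' - m)
  have hm0 : 0 < m := by linarith
  rw [bet_eq_zero_of_mul_eq_zero (A := 11 * ((m ^ j)⁻¹ * (max w 1 * m ^ 2)) * A)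
    (B := 11 * ((m ^ (6 - j))⁻¹ * (max w' 1 * m ^ 2)) * B) hφ hb ?_ ?_ ?_ ?_ ?_, smul_zero]
  · have : (0 : ℝ) < max w 1 := lt_max_of_lt_right one_pos
    positivity
  · have : (0 : ℝ) < max w' 1 := lt_max_of_lt_right one_pos
    positivity
  · exact good_cell (hw.mono (le_max_left _ _)) (le_max_of_le_right zero_le_one) hm hA.le hf
      (by ring)
  · exact good_cell (hw'.mono (le_max_left _ _)) (le_max_of_le_right zero_le_one) hm hB.le hg
      (by ring)
  · intro u _
    by_cases h : 1 ≤ |m * (u a + 1) - l|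
    · left
      beta_reduce
      rw [bump_eq_zero h, zero_mul, mul_zero]
    · right
      beta_reduce
      rw [bump_eq_zero, zero_mul, mul_zero]
      push Not at h
      rw [abs_lt] at h
      rw [le_abs']
      rcases hl with hl | hl
      · have : (l : ℝ) + 1 + 1 ≤ l' := by exact_mod_cast hl
        left; linarith
      · have : (l' : ℝ) + 1 + 1 ≤ l := by exact_mod_cast hl
        right; linarith

theorem exists_norm_diffSix_near_le {φ : Body n → ℂ} {b : BodyAlg n} (hφ : φ ∈ ValI n (q + 2))
    (hb : b ∈ augI n ^ q) (a : Fin n) {f g : En n → ℝ} {A B : ℝ} (hA : 0 < A) (hB : 0 < B)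
    (hf : Good f A) (hg : Good g B) : ∃ M ≥ 0, ∀ m : ℝ, 1 ≤ m → ∀ l l' : ℕ, l ≤ l' + 1 →
      l' ≤ l + 1 → ‖diffSix φ b a 0 (fun u => bump (m * (u a + 1) - l) * f u)
      (fun u => bump (m * (u a + 1) - l') * g u)‖ ≤ M / m ^ 2 := by
  obtain ⟨W, hW0, hW⟩ := exists_goodReal_bump_uniform
  obtain ⟨κ, hκ, h⟩ := exists_norm_bet_le hφ hb
  refine ⟨∑ j ∈ Finset.range 7, ((Nat.choose 6 j : ℕ) : ℝ) * (κ * (121 * W ^ 2 * A * B)),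
    by positivity, fun m hm l l' h1 h2 => ?_⟩
  have hm0 : 0 < m := by linarith
  rw [← diffSix_shift φ b a (l / m - 1), diffSix, Finset.sum_div]
  refine norm_sum_le_of_le _ fun j hj => ?_
  have hj7 : j < 7 := Finset.mem_range.1 hj
  rw [norm_smul, norm_mul, norm_pow, norm_neg, norm_one, one_pow, one_mul, Real.norm_natCast,
    mul_div_assoc]
  gcongr
  have he : (l' : ℝ) - l = -1 ∨ (l' : ℝ) - l = 0 ∨ (l' : ℝ) - l = 1 := by
    rcases (by omega : l' + 1 = l ∨ l' = l ∨ l' = l + 1) with rfl | rfl | rfl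
    · left; push_cast; ring
    · right; left; ring
    · right; right; push_cast; ring
  refine (h _ _ _ _ ?_ ?_ (good_cell (hW j hj7 0 (by simp)) hW0.le hm hA.le hf ?_)
    (good_cell (hW (6 - j) (by omega) _ he) hW0.le hm hB.le hg ?_)).trans (le_of_eq ?_)
  · positivity
  · positivity
  · field_simp; ring
  · field_simp; ring
  · have hp : m ^ 6 = m ^ j * m ^ (6 - j) := by rw [← pow_add]; congr 1; omega
    have : (m ^ j)⁻¹ * (m ^ (6 - j))⁻¹ = (m ^ 6)⁻¹ := by rw [hp, mul_inv]
    calc κ * (11 * ((m ^ j)⁻¹ * (W * m ^ 2)) * A * (11 * ((m ^ (6 - j))⁻¹ * (W * m ^ 2)) * B))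
        = κ * (121 * W ^ 2 * A * B) * m ^ 4 * ((m ^ j)⁻¹ * (m ^ (6 - j))⁻¹) := by ring
      _ = _ := by rw [this]; field_simp

theorem sum_near_le (N l : ℕ) {M : ℝ} (hM : 0 ≤ M) :
    ∑ l' ∈ Finset.range N, (if l ≤ l' + 1 ∧ l' ≤ l + 1 then M else 0) ≤ 3 * M := by
  rw [← Finset.sum_filter, Finset.sum_const, nsmul_eq_mul]
  gcongr
  have h : {l' ∈ Finset.range N | l ≤ l' + 1 ∧ l' ≤ l + 1} ⊆ Finset.Icc (l - 1) (l + 1) := by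
    intro x hx
    rw [Finset.mem_filter] at hx
    rw [Finset.mem_Icc]
    omega
  have := Finset.card_le_card h
  rw [Nat.card_Icc] at this
  exact_mod_cast (by omega : _ ≤ 3)

theorem diffSix_eq_zero {φ : Body n → ℂ} {b : BodyAlg n} (hφ : φ ∈ ValI n (q + 2))
    (hb : b ∈ augI n ^ q) (a : Fin n) {f g : En n → ℝ} {A B : ℝ} (hA : 0 < A) (hB : 0 < B)
    (hf : Good f A) (hg : Good g B) : diffSix φ b a 0 f g = 0 := by
  obtain ⟨M, hM, h⟩ := exists_norm_diffSix_near_le hφ hb a hA hB hf hg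
  have key : ∀ m : ℕ, 1 ≤ m → ‖diffSix φ b a 0 f g‖ ≤ 9 * M / m := by
    intro m hm
    have hm1 : (1 : ℝ) ≤ m := by exact_mod_cast hm
    have hm0 : (0 : ℝ) < m := by linarith
    have hsum : ∀ (f : En n → ℝ) (u : En n), ‖u‖ = 1 → f u =
        (∑ l ∈ Finset.range (2 * m + 1), fun u : En n => bump (m * (u a + 1) - l) * f u) u := by
      intro f u hu
      rw [Finset.sum_apply, ← Finset.sum_mul, sum_bump hm, one_mul]
      exact (PiLp.norm_apply_le u a).trans_eq hu
    rw [diffSix_congr (hsum f) (hsum g), ← diffSixL_apply]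
    simp only [map_sum, LinearMap.sum_apply, diffSixL_apply]
    rw [Finset.sum_comm]
    have hpair : ∀ l l' : ℕ, ‖diffSix φ b a 0 (fun u => bump (m * (u a + 1) - l) * f u)
        (fun u => bump (m * (u a + 1) - l') * g u)‖ ≤
        if l ≤ l' + 1 ∧ l' ≤ l + 1 then M / m ^ 2 else 0 := by
      intro l l'
      split_ifs with hl
      · exact h m hm1 l l' hl.1 hl.2
      · rw [diffSix_far hφ hb a hA hB hf hg hm1 (by omega), norm_zero]
    refine (norm_sum_le_of_le _ fun l _ => (norm_sum_le_of_le _ fun l' _ => hpair l l').trans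
      (sum_near_le _ l (by positivity))).trans ?_
    rw [Finset.sum_const, Finset.card_range, nsmul_eq_mul]
    push_cast
    rw [mul_div_assoc', mul_div_assoc', div_le_div_iff₀ (by positivity) hm0]
    nlinarith [mul_nonneg hM hm0.le]
  have ht : Tendsto (fun m : ℕ => 9 * M / (m : ℝ)) atTop (𝓝 0) :=
    tendsto_const_div_atTop_nhds_zero_nat _
  have := ge_of_tendsto ht (Filter.eventually_atTop.2 ⟨1, key⟩)
  exact norm_le_zero_iff.1 this

end Nilpotency

section AbsApprox

open scoped Polynomial

/-- Monotone polynomials converging to the sign function on `[-1, 1]`. -/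
def signPoly : ℕ → ℝ[X]
  | 0 => Polynomial.X
  | k + 1 => Polynomial.C (1 / 2) * (3 * signPoly k - signPoly k ^ 3)

theorem eval_signPoly_succ (k : ℕ) (s : ℝ) : (signPoly (k + 1)).eval s =
    (3 * (signPoly k).eval s - (signPoly k).eval s ^ 3) / 2 := by
  simp only [signPoly, Polynomial.eval_mul, Polynomial.eval_C, Polynomial.eval_sub,
    Polynomial.eval_pow, Polynomial.eval_ofNat]
  ring

theorem signPoly_neg (k : ℕ) (s : ℝ) : (signPoly k).eval (-s) = -(signPoly k).eval s := by
  induction k with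
  | zero => simp [signPoly]
  | succ k ih => rw [eval_signPoly_succ, eval_signPoly_succ, ih]; ring

theorem abs_signPoly_le (k : ℕ) {s : ℝ} (hs : |s| ≤ 1) : |(signPoly k).eval s| ≤ 1 := by
  induction k with
  | zero => simpa [signPoly] using hs
  | succ k ih =>
    rw [eval_signPoly_succ]
    rw [abs_le] at ih ⊢
    generalize (signPoly k).eval s = x at ih
    constructor
    · nlinarith [mul_nonneg (sq_nonneg (x + 1)) (by linarith [ih.2] : 0 ≤ 2 - x)]
    · nlinarith [mul_nonneg (sq_nonneg (x - 1)) (by linarith [ih.1] : 0 ≤ 2 + x)]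

theorem signPoly_mono (k : ℕ) {s t : ℝ} (hs : |s| ≤ 1) (ht : |t| ≤ 1) (hst : s ≤ t) :
    (signPoly k).eval s ≤ (signPoly k).eval t := by
  induction k with
  | zero => simpa [signPoly] using hst
  | succ k ih =>
    rw [eval_signPoly_succ, eval_signPoly_succ]
    have h1 := abs_le.1 (abs_signPoly_le k hs)
    have h2 := abs_le.1 (abs_signPoly_le k ht)
    generalize (signPoly k).eval s = x at *
    generalize (signPoly k).eval t = y at *
    have h3 : 0 ≤ 3 - (x ^ 2 + x * y + y ^ 2) := by
      nlinarith [mul_nonneg (by linarith : 0 ≤ 1 - x) (by linarith : 0 ≤ 1 + x),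
        mul_nonneg (by linarith : 0 ≤ 1 - y) (by linarith : 0 ≤ 1 + y), sq_nonneg (x - y)]
    nlinarith [mul_nonneg (sub_nonneg.2 ih) h3]

theorem one_sub_signPoly_le (k : ℕ) {s : ℝ} (h0 : 0 ≤ s) (h1 : s ≤ 1) :
    s ≤ (signPoly k).eval s ∧ 1 - (signPoly k).eval s ≤ (1 - s / 2) ^ k := by
  induction k with
  | zero => simp [signPoly]; linarith
  | succ k ih =>
    rw [eval_signPoly_succ]
    have h := (abs_le.1 (abs_signPoly_le k (abs_le.2 ⟨by linarith, h1⟩))).2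
    generalize (signPoly k).eval s = x at *
    obtain ⟨ih1, ih2⟩ := ih
    have hx0 : 0 ≤ x := h0.trans ih1
    refine ⟨?_, ?_⟩
    · nlinarith [mul_nonneg hx0 (mul_nonneg (by linarith : 0 ≤ 1 - x) (by linarith : 0 ≤ 1 + x))]
    · rw [pow_succ]
      calc 1 - (3 * x - x ^ 3) / 2 ≤ (1 - x) * (1 - s / 2) := by
            nlinarith [mul_nonneg (by linarith : 0 ≤ 1 - x) (by nlinarith : 0 ≤ x + x ^ 2 - s)]
        _ ≤ _ := mul_le_mul_of_nonneg_right ih2 (by linarith)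

theorem exists_antiderivative (p : ℝ[X]) : ∃ w : ℝ[X], Polynomial.derivative w = p ∧ w.eval 0 = 0 := by
  induction p using Polynomial.induction_on' with
  | add p q hp hq =>
    obtain ⟨v, rfl, h⟩ := hp
    obtain ⟨w, rfl, h'⟩ := hq
    exact ⟨v + w, by simp, by simp [h, h']⟩
  | monomial k a =>
    refine ⟨Polynomial.monomial (k + 1) (a / (k + 1)), ?_, by simp [Polynomial.eval_monomial]⟩
    rw [Polynomial.derivative_monomial]
    congr 1
    push_cast
    have : (k : ℝ) + 1 ≠ 0 := by positivity
    field_simp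

theorem abs_sub_self_le_of_deriv {v : ℝ → ℝ} {k : ℕ} (h0 : v 0 = 0)
    (hv : ∀ s, HasDerivAt v ((signPoly k).eval s) s) {s : ℝ} (hs : 0 ≤ s) (hs1 : s ≤ 1) :
    |v s - s| ≤ 2 / (k + 1) := by
  have hk : (k : ℝ) + 1 ≠ 0 := by positivity
  have hG : ∀ s : ℝ, HasDerivAt (fun s => -(2 / ((k : ℝ) + 1)) * (1 - s / 2) ^ (k + 1))
      ((1 - s / 2) ^ k) s := by
    intro s
    have h := ((((hasDerivAt_id s).div_const 2).const_sub 1).pow (k + 1)).const_mul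
      (-(2 / ((k : ℝ) + 1)))
    refine h.congr_deriv ?_
    simp only [id]
    push_cast
    field_simp
  have m1 : MonotoneOn (fun s => s - v s) (Set.Icc 0 1) := by
    refine monotoneOn_of_hasDerivWithinAt_nonneg (convex_Icc 0 1)
      (f' := fun s => 1 - (signPoly k).eval s)
      (fun x _ => ((hasDerivAt_id x).sub (hv x)).continuousAt.continuousWithinAt)
      (fun x _ => ((hasDerivAt_id x).sub (hv x)).hasDerivWithinAt) fun x hx => ?_
    rw [interior_Icc] at hx
    have := (abs_le.1 (abs_signPoly_le k (abs_le.2 ⟨by linarith [hx.1], hx.2.le⟩))).2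
    linarith
  have m2 : MonotoneOn (fun s => -(2 / ((k : ℝ) + 1)) * (1 - s / 2) ^ (k + 1) - (s - v s))
      (Set.Icc 0 1) := by
    refine monotoneOn_of_hasDerivWithinAt_nonneg (convex_Icc 0 1)
      (f' := fun s => (1 - s / 2) ^ k - (1 - (signPoly k).eval s))
      (fun x _ => ((hG x).sub ((hasDerivAt_id x).sub (hv x))).continuousAt.continuousWithinAt)
      (fun x _ => ((hG x).sub ((hasDerivAt_id x).sub (hv x))).hasDerivWithinAt) fun x hx => ?_
    rw [interior_Icc] at hx
    have := (one_sub_signPoly_le k hx.1.le hx.2.le).2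
    linarith
  have a1 := m1 (Set.left_mem_Icc.2 zero_le_one) ⟨hs, hs1⟩ hs
  have a2 := m2 (Set.left_mem_Icc.2 zero_le_one) ⟨hs, hs1⟩ hs
  simp only [h0] at a1 a2
  have h3 : (0 : ℝ) ≤ 2 / (k + 1) * (1 - s / 2) ^ (k + 1) :=
    mul_nonneg (by positivity) (pow_nonneg (by linarith) _)
  norm_num at a1 a2
  rw [abs_le]
  constructor <;> linarith

theorem exists_abs_approx_unit {η : ℝ} (hη : 0 < η) : ∃ w : ℝ[X],
    (∀ s, |s| ≤ 1 → ∃ d, |d| ≤ 1 ∧ ∀ t, |t| ≤ 1 → w.eval s + d * (t - s) ≤ w.eval t) ∧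
    ∀ s, |s| ≤ 1 → |w.eval s - (|s|)| ≤ η := by
  obtain ⟨k, hk⟩ := exists_nat_gt (2 / η)
  have hk' : 2 / ((k : ℝ) + 1) ≤ η := by
    rw [div_le_iff₀ (by positivity)]
    rw [div_lt_iff₀ hη] at hk
    linarith
  obtain ⟨w, hw, hw0⟩ := exists_antiderivative (signPoly k)
  have hd : ∀ s, HasDerivAt (fun s => w.eval s) ((signPoly k).eval s) s := fun s =>
    hw ▸ w.hasDerivAt s
  refine ⟨w, fun s hs => ⟨(signPoly k).eval s, abs_signPoly_le k hs, fun t ht => ?_⟩,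
    fun s hs => ?_⟩
  · rw [abs_le] at hs ht
    rcases lt_trichotomy s t with h | rfl | h
    · obtain ⟨c, hc, e⟩ := exists_hasDerivAt_eq_slope (fun s => w.eval s) _ h
        w.continuous.continuousOn (fun x _ => hd x)
      have := signPoly_mono k (abs_le.2 hs) (abs_le.2 ⟨by linarith [hc.1], by linarith [hc.2]⟩)
        hc.1.le
      rw [e, le_div_iff₀ (by linarith)] at this
      linarith
    · simp
    · obtain ⟨c, hc, e⟩ := exists_hasDerivAt_eq_slope (fun s => w.eval s) _ h
        w.continuous.continuousOn (fun x _ => hd x)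
      have := signPoly_mono k (abs_le.2 ⟨by linarith [hc.1], by linarith [hc.2]⟩) (abs_le.2 hs)
        hc.2.le
      rw [e, div_le_iff₀ (by linarith)] at this
      linarith
  · rcases le_total 0 s with h | h
    · rw [abs_of_nonneg h] at hs ⊢
      exact (abs_sub_self_le_of_deriv hw0 hd h hs).trans hk'
    · rw [abs_of_nonpos h] at hs ⊢
      have hd' : ∀ s, HasDerivAt (fun s => w.eval (-s)) ((signPoly k).eval s) s := by
        intro s
        have := (hd (-s)).scomp s (hasDerivAt_neg s)
        rw [signPoly_neg, neg_smul, one_smul, neg_neg] at this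
        exact this
      have := abs_sub_self_le_of_deriv (by simpa using hw0) hd' (neg_nonneg.2 h) hs
      rw [neg_neg] at this
      exact this.trans hk'

theorem exists_abs_approx {R η : ℝ} (hR : 0 < R) (hη : 0 < η) : ∃ w : ℝ[X],
    (∀ s, |s| ≤ R → ∃ d, |d| ≤ 1 ∧ ∀ t, |t| ≤ R → w.eval s + d * (t - s) ≤ w.eval t) ∧
    ∀ s, |s| ≤ R → |w.eval s - (|s|)| ≤ η := by
  obtain ⟨w, h1, h2⟩ := exists_abs_approx_unit (div_pos hη hR)
  have hs : ∀ s : ℝ, |s| ≤ R → |R⁻¹ * s| ≤ 1 := fun s hs => by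
    rw [abs_mul, abs_of_pos (inv_pos.2 hR), inv_mul_le_iff₀ hR, mul_one]
    exact hs
  have e : ∀ s, (Polynomial.C R * w.comp (Polynomial.C R⁻¹ * Polynomial.X)).eval s =
      R * w.eval (R⁻¹ * s) := fun s => by simp
  refine ⟨Polynomial.C R * w.comp (Polynomial.C R⁻¹ * Polynomial.X), fun s h => ?_, fun s h => ?_⟩
  · obtain ⟨d, hd, h3⟩ := h1 _ (hs s h)
    refine ⟨d, hd, fun t ht => ?_⟩
    rw [e, e]
    have := mul_le_mul_of_nonneg_left (h3 _ (hs t ht)) hR.le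
    refine le_trans (le_of_eq ?_) this
    field_simp
  · rw [e]
    have := mul_le_mul_of_nonneg_left (h2 _ (hs s h)) hR.le
    rw [mul_div_cancel₀ _ hR.ne'] at this
    refine le_trans (le_of_eq ?_) this
    rw [abs_mul, abs_of_pos (inv_pos.2 hR), ← abs_of_pos hR, ← abs_mul, abs_of_pos hR]
    congr 1
    field_simp

end AbsApprox

section Density

open scoped Polynomial

variable {n : ℕ}

/-- Evaluation of a real polynomial at a point of Euclidean space. -/
def pev (x : En n) : MvPolynomial (Fin n) ℝ →ₐ[ℝ] ℝ := MvPolynomial.aeval fun a => x a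

theorem continuous_pev (p : MvPolynomial (Fin n) ℝ) : Continuous fun x : En n => pev x p := by
  simp only [pev, MvPolynomial.aeval_eq_eval]
  exact (MvPolynomial.continuous_eval p).comp (PiLp.continuous_ofLp 2 _)

/-- The polynomial has a subgradient at each point of the ball of radius two. -/
def HasSubgrads (p : MvPolynomial (Fin n) ℝ) : Prop :=
  ∀ q : En n, ‖q‖ ≤ 2 → ∃ v : En n, ∀ y : En n, ‖y‖ ≤ 2 → pev q p + ⟪v, y - q⟫ ≤ pev y p

/-- The function is a uniform limit of convex polynomials on the ball of radius two. -/
def PolyApprox (h : En n → ℝ) : Prop :=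
  ∀ η > 0, ∃ p : MvPolynomial (Fin n) ℝ, HasSubgrads p ∧ ∀ x : En n, ‖x‖ ≤ 2 → |pev x p - h x| ≤ η

theorem polyApprox_inner (v : En n) : PolyApprox fun x => ⟪v, x⟫ := by
  intro η hη
  have e : ∀ x : En n, pev x (∑ a, MvPolynomial.C (v a) * MvPolynomial.X a) = ⟪v, x⟫ := by
    intro x
    simp only [pev, map_sum, map_mul, MvPolynomial.aeval_C, MvPolynomial.aeval_X, PiLp.inner_apply,
      RCLike.inner_apply, Algebra.algebraMap_self, RingHom.id_apply, conj_trivial]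
    exact Finset.sum_congr rfl fun a _ => mul_comm _ _
  refine ⟨∑ a, MvPolynomial.C (v a) * MvPolynomial.X a, fun q _ => ⟨v, fun y _ => ?_⟩,
    fun x _ => ?_⟩
  · rw [e, e, ← inner_add_right, add_sub_cancel]
  · rw [e, sub_self, abs_zero]
    exact hη.le

theorem max_eq_add_abs (a b : ℝ) : max a b = (a + b + |a - b|) / 2 := by
  rcases le_total a b with h | h
  · rw [max_eq_right h, abs_of_nonpos (by linarith)]; ring
  · rw [max_eq_left h, abs_of_nonneg (by linarith)]; ring

theorem PolyApprox.sup {f g : En n → ℝ} (hf : PolyApprox f) (hg : PolyApprox g) :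
    PolyApprox fun x => max (f x) (g x) := by
  intro η hη
  obtain ⟨p, hp, hpf⟩ := hf (η / 2) (by positivity)
  obtain ⟨q, hq, hqg⟩ := hg (η / 2) (by positivity)
  obtain ⟨R0, hR0⟩ := (isCompact_closedBall (0 : En n) 2).exists_bound_of_continuousOn
    (continuous_pev (p - q)).continuousOn
  set R := max R0 1 with hRd
  have hR : 0 < R := lt_max_of_lt_right one_pos
  have hpq : ∀ x : En n, ‖x‖ ≤ 2 → |pev x p - pev x q| ≤ R := fun x hx => by
    rw [← map_sub]
    exact (hR0 x (mem_closedBall_zero_iff.2 hx)).trans (le_max_left _ _)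
  obtain ⟨w, hw, hws⟩ := exists_abs_approx hR hη
  have e : ∀ x : En n, pev x (MvPolynomial.C (1 / 2) * (p + q + Polynomial.aeval (p - q) w)) =
      (pev x p + pev x q + w.eval (pev x p - pev x q)) / 2 := by
    intro x
    rw [map_mul, map_add, map_add, ← Polynomial.aeval_algHom_apply, map_sub,
      Polynomial.coe_aeval_eq_eval]
    simp only [pev, MvPolynomial.aeval_C, Algebra.algebraMap_self, RingHom.id_apply]
    ring
  refine ⟨MvPolynomial.C (1 / 2) * (p + q + Polynomial.aeval (p - q) w), fun x hx => ?_,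
    fun x hx => ?_⟩
  · obtain ⟨v, hv⟩ := hp x hx
    obtain ⟨v', hv'⟩ := hq x hx
    obtain ⟨d, hd, h⟩ := hw _ (hpq x hx)
    rw [abs_le] at hd
    refine ⟨((1 + d) / 2) • v + ((1 - d) / 2) • v', fun y hy => ?_⟩
    rw [e, e, inner_add_left, real_inner_smul_left, real_inner_smul_left]
    have h1 := h _ (hpq y hy)
    have h2 := mul_le_mul_of_nonneg_left (hv y hy) (by linarith [hd.1] : 0 ≤ (1 + d) / 2)
    have h3 := mul_le_mul_of_nonneg_left (hv' y hy) (by linarith [hd.2] : 0 ≤ (1 - d) / 2)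
    linarith
  · rw [e]
    have h1 := hws _ (hpq x hx)
    have h2 := abs_max_sub_max_le_max (pev x p) (pev x q) (f x) (g x)
    have h3 := h2.trans (max_le (hpf x hx) (hqg x hx))
    rw [max_eq_add_abs (pev x p)] at h3
    rw [abs_le] at *
    constructor <;> linarith

theorem PolyApprox.exists_body {P : Body n} (h : PolyApprox (suppF P)) {ε : ℝ} (hε : 0 < ε) :
    ∃ K : Body n, dist K P ≤ ε ∧ ∃ p : MvPolynomial (Fin n) ℝ, ∀ u : En n, ‖u‖ = 1 →
      suppF K u = pev u p := by
  set η := ε / 4 with hη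
  have hη0 : 0 < η := by positivity
  obtain ⟨p, hp, hph⟩ := h η hη0
  have e : ∀ x : En n, pev x (p + MvPolynomial.C (3 * η)) = pev x p + 3 * η := fun x => by
    rw [map_add]
    simp [pev]
  obtain ⟨R0, hR0⟩ := (isCompact_closedBall (0 : En n) 2).exists_bound_of_continuousOn
    (continuous_pev (p + MvPolynomial.C (3 * η))).continuousOn
  obtain ⟨K, hK⟩ := exists_body_suppF (f := fun x => pev x (p + MvPolynomial.C (3 * η))) (C := R0)
    (fun u hu => (le_abs_self _).trans (hR0 u (mem_closedBall_zero_iff.2 (by linarith))))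
    (fun q hq => by
      obtain ⟨v, hv⟩ := hp q (by linarith)
      have hqq : ⟪q, q⟫ = (1 : ℝ) := by rw [real_inner_self_eq_norm_sq, hq, one_pow]
      have hc : 0 ≤ pev q p + 3 * η - ⟪v, q⟫ := by
        have hq2 : ‖(2 : ℝ) • q‖ ≤ 2 := by rw [norm_smul, hq]; norm_num
        have h1 := hv ((2 : ℝ) • q) hq2
        have h2 := (abs_le.1 (hph _ hq2)).2
        have h3 := (abs_le.1 (hph q (by linarith))).1
        rw [suppF_smul_right zero_le_two] at h2
        have e2 : (2 : ℝ) • q - q = q := by rw [two_smul, add_sub_cancel_right]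
        rw [e2] at h1
        linarith
      refine ⟨v + (pev q p + 3 * η - ⟪v, q⟫) • q, fun u hu => ?_, ?_⟩
      · rw [e, inner_add_left, real_inner_smul_left]
        have h1 := hv u (by linarith)
        have h2 : ⟪q, u⟫ ≤ (1 : ℝ) := by
          have := real_inner_le_norm q u
          rwa [hq, hu, one_mul] at this
        have h3 := mul_le_mul_of_nonneg_left h2 hc
        rw [inner_sub_right] at h1
        linarith
      · rw [e, inner_add_left, real_inner_smul_left, hqq]
        ring)
  refine ⟨K, dist_le_of_suppF hε.le fun u hu => ?_, _, hK⟩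
  rw [hK u hu, e]
  have := abs_le.1 (hph u (by linarith))
  rw [abs_le]
  constructor <;> linarith

theorem polyApprox_sup' {ι : Type*} (s : Finset ι) (hs : s.Nonempty) (v : ι → En n) :
    PolyApprox fun x => s.sup' hs fun k => ⟪v k, x⟫ := by
  induction hs using Finset.Nonempty.cons_induction with
  | singleton a => simpa using polyApprox_inner (v a)
  | cons a s ha hs ih =>
    simp only [Finset.sup'_cons hs]
    exact (polyApprox_inner (v a)).sup ih

theorem suppF_polyt {ι : Type*} [Fintype ι] [Nonempty ι] (v : ι → En n) (x : En n) :
    suppF (polyt v) x = Finset.univ.sup' Finset.univ_nonempty fun k => ⟪v k, x⟫ := by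
  classical
  apply suppF_eq
  · rintro _ ⟨c, ⟨hc0, hc1⟩, rfl⟩
    rw [Fintype.linearCombination_apply, sum_inner]
    calc ∑ k, ⟪c k • v k, x⟫ ≤ ∑ k, c k * Finset.univ.sup' Finset.univ_nonempty fun k => ⟪v k, x⟫ := by
          refine Finset.sum_le_sum fun k _ => ?_
          rw [real_inner_smul_left]
          exact mul_le_mul_of_nonneg_left
            (Finset.le_sup' (fun k => ⟪v k, x⟫) (Finset.mem_univ k)) (hc0 k)
      _ = _ := by rw [← Finset.sum_mul, hc1, one_mul]
  · obtain ⟨k, -, hk⟩ := Finset.exists_mem_eq_sup' Finset.univ_nonempty fun k => ⟪v k, x⟫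
    refine ⟨v k, ⟨Pi.single k 1, ⟨fun j => ?_, by simp⟩, by
      simp [Fintype.linearCombination_apply, Pi.single_apply]⟩, hk.symm⟩
    by_cases h : j = k
    · subst h; simp
    · simp [h]

/-- Bodies whose support function is polynomial on the sphere are dense. -/
theorem exists_poly_body (K : Body n) {ε : ℝ} (hε : 0 < ε) : ∃ K' : Body n, dist K' K ≤ ε ∧
    ∃ p : MvPolynomial (Fin n) ℝ, ∀ u : En n, ‖u‖ = 1 → suppF K' u = pev u p := by
  obtain ⟨ι, _, _, v, hv⟩ := exists_polyt_dist_le K (half_pos hε)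
  have h : PolyApprox (suppF (polyt v)) := by
    rw [funext (suppF_polyt v)]
    exact polyApprox_sup' _ _ v
  obtain ⟨K', h1, hp⟩ := h.exists_body (half_pos hε)
  refine ⟨K', (dist_triangle _ (polyt v) _).trans ?_, hp⟩
  linarith

end Density

section Symbol

variable {n r : ℕ}

/-- Restriction of complex polynomials to the sphere. -/
def sp (n : ℕ) : MvPolynomial (Fin n) ℂ →ₐ[ℂ] (Sph n → ℂ) :=
  MvPolynomial.aeval fun a u => ((u.1 a : ℝ) : ℂ)

/-- Real monomial functions. -/
def mon (m : Fin n →₀ ℕ) : En n → ℝ := fun u => ∏ a, u a ^ m a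

theorem exists_good_mon (m : Fin n →₀ ℕ) : ∃ A > 0, Good (mon m) A := by
  have hmul : ∀ f g : En n → ℝ, (∃ A > 0, Good f A) → (∃ A > 0, Good g A) →
      ∃ A > 0, Good (f * g) A := by
    rintro f g ⟨A, hA, hf⟩ ⟨B, hB, hg⟩
    exact ⟨11 * A * B, by positivity, Good.mul hA.le hB.le hf hg⟩
  have hone : ∃ A > 0, Good (1 : En n → ℝ) A := ⟨|1|, by simp, good_const 1⟩
  have hpow : ∀ (f : En n → ℝ) (k : ℕ), (∃ A > 0, Good f A) → ∃ A > 0, Good (f ^ k) A := by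
    intro f k hf
    induction k with
    | zero => simpa using hone
    | succ k ih => rw [pow_succ]; exact hmul _ _ ih hf
  have e : mon m = ∏ a, (fun u : En n => u a) ^ m a := by
    ext u
    simp [mon]
  rw [e]
  exact Finset.prod_induction _ (fun f : En n → ℝ => ∃ A > 0, Good f A) hmul hone
    fun a _ => hpow _ _ ⟨1, one_pos, good_coord a⟩

theorem sp_monomial (m : Fin n →₀ ℕ) : sp n (MvPolynomial.monomial m 1) = res (mon m) := by
  ext u
  rw [sp, MvPolynomial.aeval_monomial, map_one, one_mul, Finsupp.prod_fintype _ _ (by simp)]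
  simp [res, mon]

theorem isRep_sp (p : MvPolynomial (Fin n) ℂ) : IsRep (sp n p) := by
  induction p using MvPolynomial.induction_on' with
  | monomial m b =>
    obtain ⟨A, hA, h'⟩ := exists_good_mon m
    have h : sp n (MvPolynomial.monomial m b) = b • res (mon m) := by
      rw [← sp_monomial, ← map_smul, MvPolynomial.smul_monomial, smul_eq_mul, mul_one]
    rw [h]
    exact (h'.isRep hA.le).smul b
  | add p q hp hq =>
    rw [map_add]
    exact hp.add hq

/-- The inclusion of the polynomials in the `k`-th block of variables. -/
def blk {ι : Type*} (k : ι) : MvPolynomial (Fin n) ℂ →ₐ[ℂ] MvPolynomial (ι × Fin n) ℂ :=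
  MvPolynomial.rename fun a => (k, a)

/-- The exponents in the `k`-th block. -/
def slice {ι : Type*} (k : ι) (μ : ι × Fin n →₀ ℕ) : Fin n →₀ ℕ :=
  Finsupp.equivFunOnFinite.symm fun a => μ (k, a)

theorem slice_equivFunOnFinite_symm {ι : Type*} [Finite ι] (k : ι) (m : ι → Fin n →₀ ℕ) :
    slice k (Finsupp.equivFunOnFinite.symm fun ka : ι × Fin n => m ka.1 ka.2) = m k := by
  ext a
  simp [slice]

theorem blk_monomial {ι : Type*} (k : ι) (m : Fin n →₀ ℕ) :
    blk k (MvPolynomial.monomial m 1) = ∏ a, (MvPolynomial.X (k, a)) ^ m a := by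
  rw [MvPolynomial.monomial_eq, Finsupp.prod_fintype _ _ (by simp)]
  simp [blk]

theorem monomial_eq_prod_blk {ι : Type*} [Fintype ι] (μ : ι × Fin n →₀ ℕ) :
    (MvPolynomial.monomial μ 1 : MvPolynomial (ι × Fin n) ℂ) =
      ∏ k, blk k (MvPolynomial.monomial (slice k μ) 1) := by
  rw [MvPolynomial.monomial_eq, Finsupp.prod_fintype _ _ (by simp), Fintype.prod_prod_type]
  simp [blk_monomial, slice]

theorem linearMap_ext_blk {ι M : Type*} [Fintype ι] [AddCommMonoid M] [Module ℂ M]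
    {S T : MvPolynomial (ι × Fin n) ℂ →ₗ[ℂ] M}
    (h : ∀ m : ι → Fin n →₀ ℕ, S (∏ k, blk k (MvPolynomial.monomial (m k) 1)) =
      T (∏ k, blk k (MvPolynomial.monomial (m k) 1))) : S = T := by
  refine (MvPolynomial.basisMonomials _ ℂ).ext fun μ => ?_
  rw [MvPolynomial.coe_basisMonomials]
  beta_reduce
  rw [monomial_eq_prod_blk]
  exact h _

/-- The linear map sending a product of polynomials in separate blocks of variables to the product
of their representatives in the algebra of bodies. -/
def prodRep (n r : ℕ) : MvPolynomial (Fin r × Fin n) ℂ →ₗ[ℂ] BodyAlg n :=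
  (MvPolynomial.basisMonomials _ ℂ).constr ℂ fun μ =>
    ∏ k, rep n (sp n (MvPolynomial.monomial (slice k μ) 1))

theorem prodRep_prod_blk (f : Fin r → MvPolynomial (Fin n) ℂ) :
    prodRep n r (∏ k, blk k (f k)) = ∏ k, rep n (sp n (f k)) := by
  let S : MultilinearMap ℂ (fun _ : Fin r => MvPolynomial (Fin n) ℂ) (BodyAlg n) :=
    (prodRep n r).compMultilinearMap ((MultilinearMap.mkPiAlgebra ℂ (Fin r)
      (MvPolynomial (Fin r × Fin n) ℂ)).compLinearMap fun k => (blk k).toLinearMap)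
  let T : MultilinearMap ℂ (fun _ : Fin r => MvPolynomial (Fin n) ℂ) (BodyAlg n) :=
    (MultilinearMap.mkPiAlgebra ℂ (Fin r) (BodyAlg n)).compLinearMap
      fun _ => rep n ∘ₗ (sp n).toLinearMap
  have h : S = T := by
    refine Module.Basis.ext_multilinear (fun _ => MvPolynomial.basisMonomials (Fin n) ℂ)
      fun m => ?_
    simp only [S, T, MvPolynomial.coe_basisMonomials, LinearMap.compMultilinearMap_apply,
      MultilinearMap.compLinearMap_apply, MultilinearMap.mkPiAlgebra_apply, AlgHom.toLinearMap_apply,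
      LinearMap.comp_apply]
    have e : ∏ k, blk k (MvPolynomial.monomial (m k) 1) =
        (MvPolynomial.monomial (Finsupp.equivFunOnFinite.symm fun ka : Fin r × Fin n => m ka.1 ka.2) 1 :
          MvPolynomial (Fin r × Fin n) ℂ) := by
      rw [monomial_eq_prod_blk]
      simp only [slice_equivFunOnFinite_symm]
    rw [e, ← congrFun (MvPolynomial.coe_basisMonomials (Fin r × Fin n) ℂ) _, prodRep,
      Module.Basis.constr_basis]
    simp only [slice_equivFunOnFinite_symm]
  exact congrArg (fun S => S f) h

theorem prod_mem_augI_pow {ι : Type*} (s : Finset ι) {a : ι → BodyAlg n}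
    (ha : ∀ k, a k ∈ augI n) : ∏ k ∈ s, a k ∈ augI n ^ s.card := by
  classical
  induction s using Finset.induction_on with
  | empty => simp
  | insert k s hk ih =>
    rw [Finset.prod_insert hk, Finset.card_insert_of_notMem hk]
    exact mul_mem_pow_succ (ha k) ih

theorem ev_prod_congr {φ : Body n → ℂ} (hφ : IsPolyHom (r + 1) φ)
    {a a' : Fin (r + 1) → BodyAlg n} (ha : ∀ k, a k ∈ augI n) (ha' : ∀ k, a' k ∈ augI n)
    (h : ∀ k, ∀ u : En n, ‖u‖ = 1 → suppA (a k) u = suppA (a' k) u) :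
    ev φ (∏ k, a k) = ev φ (∏ k, a' k) := by
  classical
  have key : ∀ s : Finset (Fin (r + 1)), ev φ (∏ k, s.piecewise a' a k) = ev φ (∏ k, a k) := by
    intro s
    induction s using Finset.induction_on with
    | empty => simp
    | insert j s hj ih =>
      rw [← ih]
      have hmem : ∀ (t : Finset (Fin (r + 1))) k, t.piecewise a' a k ∈ augI n := fun t k => by
        by_cases hk : k ∈ t <;> simp [hk, ha, ha']
      rw [← Finset.mul_prod_erase _ _ (Finset.mem_univ j),
        ← Finset.mul_prod_erase _ (s.piecewise a' a) (Finset.mem_univ j)]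
      have e : ∏ k ∈ Finset.univ.erase j, (insert j s).piecewise a' a k =
          ∏ k ∈ Finset.univ.erase j, s.piecewise a' a k := by
        refine Finset.prod_congr rfl fun k hk => ?_
        rw [Finset.piecewise_insert_of_ne _ _ _ (Finset.ne_of_mem_erase hk)]
      rw [e]
      have hp := prod_mem_augI_pow (Finset.univ.erase j) (hmem s)
      rw [Finset.card_erase_of_mem (Finset.mem_univ j), Finset.card_univ, Fintype.card_fin,
        Nat.add_sub_cancel] at hp
      refine ev_congr_of_suppA hφ (hmem _ _) (hmem _ _) hp fun u hu => ?_
      simp [hj, h j u hu]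
  simpa using (key Finset.univ).symm

/-- The symbol of a valuation, as a functional on polynomials. -/
def symb (n r : ℕ) : (Body n → ℂ) →ₗ[ℂ] MvPolynomial (Fin r × Fin n) ℂ →ₗ[ℂ] ℂ :=
  (LinearMap.lcomp ℂ ℂ (prodRep n r)) ∘ₗ ev

theorem symb_prod_blk (φ : Body n → ℂ) (f : Fin r → MvPolynomial (Fin n) ℂ) :
    symb n r φ (∏ k, blk k (f k)) = ev φ (∏ k, rep n (sp n (f k))) := by
  rw [← prodRep_prod_blk]
  rfl

theorem suppA_rep_sp (f : MvPolynomial (Fin n) ℂ) (u : Sph n) :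
    suppA (rep n (sp n f)) u = sp n f u := (isRep_sp f).suppA_rep u

theorem sp_map_ofReal (p : MvPolynomial (Fin n) ℝ) (u : Sph n) :
    sp n (MvPolynomial.map Complex.ofRealHom p) u = ((pev u.1 p : ℝ) : ℂ) := by
  induction p using MvPolynomial.induction_on with
  | C a => simp [sp, pev]
  | add p q hp hq => simp [hp, hq]
  | mul_X p a hp =>
    have h : sp n (MvPolynomial.X a) u = ((u.1 a : ℝ) : ℂ) := by simp [sp]
    simp [hp, h, pev]

/-- A valuation with vanishing symbol vanishes. -/
theorem eq_zero_of_symb_eq_zero {φ : Body n → ℂ} (hφ : φ ∈ ValI n (r + 1))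
    (h : symb n (r + 1) φ = 0) : φ = 0 := by
  have hP := isPolyHom_of_mem hφ
  have key : ∀ K : Body n, (∃ p : MvPolynomial (Fin n) ℝ, ∀ u : En n, ‖u‖ = 1 →
      suppF K u = pev u p) → φ K = 0 := by
    rintro K ⟨p, hp⟩
    have h1 := symb_prod_blk (r := r + 1) φ fun _ => MvPolynomial.map Complex.ofRealHom p
    rw [h, LinearMap.zero_apply, ev_prod_congr (a' := fun _ => br K - 1) hP
      (fun _ => rep_mem _) (fun _ => br_sub_one_mem K), Finset.prod_const, Finset.card_univ,
      Fintype.card_fin, ev_br_sub_one_pow hP] at h1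
    · exact (mul_eq_zero.1 h1.symm).resolve_left (Nat.cast_ne_zero.2 (Nat.factorial_ne_zero _))
    · intro _ u hu
      rw [suppA_rep_sp _ ⟨u, hu⟩, suppA_sub, suppA_br, ← br_zero, suppA_br, suppF_zero, hp u hu, Complex.ofReal_zero,
        sub_zero, sp_map_ofReal]
  ext K
  refine eq_of_forall_dist_le fun ε hε => ?_
  obtain ⟨δ, hδ, hc⟩ := Metric.continuous_iff.1 hφ.1.1 K ε hε
  obtain ⟨K', h1, h2⟩ := exists_poly_body K (half_pos hδ)
  have h3 := hc K' (by linarith)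
  rw [key K' h2, dist_comm] at h3
  exact h3.le

end Symbol

section SymbolRelations

variable {n r : ℕ}

open MvPolynomial (X C)

theorem sp_X (a : Fin n) : sp n (X a) = fun u => ((u.1 a : ℝ) : ℂ) := by
  rw [sp, MvPolynomial.aeval_X]

theorem blk_mul_prod_blk {ι : Type*} [Fintype ι] [DecidableEq ι] (k : ι)
    (h : MvPolynomial (Fin n) ℂ) (f : ι → MvPolynomial (Fin n) ℂ) :
    blk k h * ∏ l, blk l (f l) = ∏ l, blk l (Function.update f k (h * f k) l) := by
  rw [← Finset.mul_prod_erase _ _ (Finset.mem_univ k), ← mul_assoc, ← map_mul,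
    ← Finset.mul_prod_erase _ (fun l => blk l (Function.update f k (h * f k) l))
      (Finset.mem_univ k), Function.update_self]
  congr 1
  refine Finset.prod_congr rfl fun l hl => ?_
  rw [Function.update_of_ne (Finset.ne_of_mem_erase hl)]

/-- The symbol only depends on the restrictions of polynomials to spheres. -/
theorem symb_blk_mul_congr (φ : Body n → ℂ) (k : Fin r) {h h' : MvPolynomial (Fin n) ℂ}
    (e : sp n h = sp n h') (G : MvPolynomial (Fin r × Fin n) ℂ) :
    symb n r φ (blk k h * G) = symb n r φ (blk k h' * G) := by
  suffices H : symb n r φ ∘ₗ LinearMap.mulLeft ℂ (blk k h) =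
      symb n r φ ∘ₗ LinearMap.mulLeft ℂ (blk k h') from LinearMap.congr_fun H G
  refine linearMap_ext_blk fun m => ?_
  simp only [LinearMap.comp_apply, LinearMap.mulLeft_apply]
  rw [blk_mul_prod_blk, blk_mul_prod_blk, symb_prod_blk, symb_prod_blk]
  congr 2
  ext1 l
  rcases eq_or_ne l k with rfl | hl
  · rw [Function.update_self, Function.update_self, map_mul (sp n), map_mul (sp n), e]
  · rw [Function.update_of_ne hl, Function.update_of_ne hl]

theorem sp_X_pow_mul_monomial (a : Fin n) (j : ℕ) (m : Fin n →₀ ℕ) :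
    sp n (X a ^ j * MvPolynomial.monomial m 1) = res fun u => (u a - 0) ^ j * mon m u := by
  rw [map_mul, map_pow, sp_monomial, sp_X]
  ext u
  simp [res]

/-- The symbol of a valuation is supported on a finite order neighbourhood of the diagonal. -/
theorem symb_sub_pow_six_mul {q : ℕ} {φ : Body n → ℂ} (hφ : φ ∈ ValI n (q + 2)) (p : Fin (q + 1))
    (a : Fin n) (F : MvPolynomial (Fin (q + 2) × Fin n) ℂ) :
    symb n (q + 2) φ ((X (p.succ, a) - X (0, a)) ^ 6 * F) = 0 := by
  suffices H : symb n (q + 2) φ ∘ₗ LinearMap.mulLeft ℂ ((X (p.succ, a) - X (0, a)) ^ 6) = 0 from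
    LinearMap.congr_fun H F
  refine linearMap_ext_blk fun m => ?_
  obtain ⟨A, hA, hf⟩ := exists_good_mon (m 0)
  obtain ⟨B, hB, hg⟩ := exists_good_mon (m p.succ)
  have hb : ∏ l ∈ Finset.univ.erase p, rep n (sp n (MvPolynomial.monomial (m l.succ) 1)) ∈
      augI n ^ q := by
    have := prod_mem_augI_pow (Finset.univ.erase p)
      (a := fun l : Fin (q + 1) => rep n (sp n (MvPolynomial.monomial (m l.succ) 1)))
      fun l => rep_mem _
    rwa [Finset.card_erase_of_mem (Finset.mem_univ p), Finset.card_univ, Fintype.card_fin,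
      Nat.add_sub_cancel] at this
  rw [LinearMap.zero_apply, ← diffSix_eq_zero hφ hb a hA hB hf hg]
  have hX : ∀ (k : Fin (q + 2)) (j : ℕ),
      (X (k, a) ^ j : MvPolynomial (Fin (q + 2) × Fin n) ℂ) = blk k (X a ^ j) := fun k j => by
    rw [map_pow, blk, MvPolynomial.rename_X]
  have e : (X (p.succ, a) - X (0, a) : MvPolynomial (Fin (q + 2) × Fin n) ℂ) ^ 6 =
      ∑ j ∈ Finset.range 7, ((-1) ^ j * (Nat.choose 6 j : ℕ) : ℝ) •
        (blk 0 (X a ^ j) * blk p.succ (X a ^ (6 - j))) := by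
    rw [sub_eq_neg_add, add_pow]
    refine Finset.sum_congr rfl fun j _ => ?_
    rw [neg_pow, hX, hX, Algebra.smul_def]
    simp only [map_mul, map_pow, map_neg, map_one, map_natCast]
    ring
  rw [LinearMap.comp_apply, LinearMap.mulLeft_apply, e, Finset.sum_mul, map_sum, diffSix]
  refine Finset.sum_congr rfl fun j _ => ?_
  rw [smul_mul_assoc, LinearMap.map_smul_of_tower, mul_assoc, blk_mul_prod_blk, blk_mul_prod_blk,
    symb_prod_blk, bet]
  congr 2
  rw [Fin.prod_univ_succ, ← Finset.mul_prod_erase _ _ (Finset.mem_univ p)]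
  have h0 : p.succ ≠ 0 := Fin.succ_ne_zero p
  rw [Function.update_self, Function.update_of_ne h0.symm, Function.update_of_ne h0,
    Function.update_self, sp_X_pow_mul_monomial, sp_X_pow_mul_monomial]
  congr 2
  refine Finset.prod_congr rfl fun l hl => ?_
  have hl' : l.succ ≠ p.succ := fun h => Finset.ne_of_mem_erase hl (Fin.succ_injective _ h)
  rw [Function.update_of_ne (Fin.succ_ne_zero l), Function.update_of_ne hl']

/-- The linear change of variables attached to an orthogonal matrix. -/
def rotP (g : Matrix.orthogonalGroup (Fin n) ℝ) :
    MvPolynomial (Fin n) ℂ →ₐ[ℂ] MvPolynomial (Fin n) ℂ :=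
  MvPolynomial.aeval fun a => ∑ b, C ((OMat g a b : ℝ) : ℂ) * X b

/-- The simultaneous linear change of variables attached to an orthogonal matrix. -/
def rotQ (ι : Type*) (g : Matrix.orthogonalGroup (Fin n) ℝ) :
    MvPolynomial (ι × Fin n) ℂ →ₐ[ℂ] MvPolynomial (ι × Fin n) ℂ :=
  MvPolynomial.aeval fun ka => ∑ b, C ((OMat g ka.2 b : ℝ) : ℂ) * X (ka.1, b)

theorem rotQ_blk {ι : Type*} (g : Matrix.orthogonalGroup (Fin n) ℝ) (k : ι)
    (f : MvPolynomial (Fin n) ℂ) : rotQ ι g (blk k f) = blk k (rotP g f) := by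
  suffices h : (rotQ ι g).comp (blk k) = (blk k).comp (rotP g) from AlgHom.congr_fun h f
  refine MvPolynomial.algHom_ext fun a => ?_
  simp [rotQ, rotP, blk, MvPolynomial.algebraMap_eq]

/-- The orthogonal action on the sphere. -/
def rotS (g : Matrix.orthogonalGroup (Fin n) ℝ) (u : En n) : En n := Matrix.toEuclideanLin (OMat g) u

theorem rotS_apply (g : Matrix.orthogonalGroup (Fin n) ℝ) (u : En n) (a : Fin n) :
    rotS g u a = ∑ b, OMat g a b * u b := by
  simp [rotS, Matrix.toEuclideanLin, Matrix.mulVec, dotProduct]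

theorem norm_rotS (g : Matrix.orthogonalGroup (Fin n) ℝ) (u : En n) : ‖rotS g u‖ = ‖u‖ := by
  have h : (OMat g).transpose * OMat g = 1 := (Matrix.mem_orthogonalGroup_iff' (Fin n) ℝ).1 g.2
  have hd : ∀ v : En n, ‖v‖ ^ 2 = v.ofLp ⬝ᵥ v.ofLp := fun v => by
    rw [EuclideanSpace.real_norm_sq_eq, dotProduct]
    exact Finset.sum_congr rfl fun a _ => sq _
  have h2 : ‖rotS g u‖ ^ 2 = ‖u‖ ^ 2 := by
    have e : (rotS g u).ofLp = (OMat g).mulVec u.ofLp := rfl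
    rw [hd, hd, e, Matrix.dotProduct_mulVec, Matrix.vecMul_mulVec, h, Matrix.vecMul_one]
  exact (pow_left_inj₀ (norm_nonneg _) (norm_nonneg _) two_ne_zero).1 h2

theorem sp_rotP (g : Matrix.orthogonalGroup (Fin n) ℝ) (f : MvPolynomial (Fin n) ℂ) (u : Sph n) :
    sp n (rotP g f) u = sp n f ⟨rotS g u.1, (norm_rotS g u.1).trans u.2⟩ := by
  induction f using MvPolynomial.induction_on with
  | C a => simp [sp, rotP]
  | add p q hp hq => simp only [map_add, Pi.add_apply, hp, hq]
  | mul_X p a hp =>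
    simp only [map_mul, Pi.mul_apply, hp]
    congr 1
    rw [sp_X, rotP, MvPolynomial.aeval_X]
    simp [rotS_apply, sp]

theorem mapBody_add (A : Matrix (Fin n) (Fin n) ℝ) (K L : Body n) :
    mapBody A (K + L) = mapBody A K + mapBody A L :=
  body_ext fun u _ => by simp only [suppF_mapBody, suppF_add]

theorem mapBody_zero (A : Matrix (Fin n) (Fin n) ℝ) : mapBody A (0 : Body n) = 0 :=
  body_ext fun u _ => by simp only [suppF_mapBody, suppF_zero]

/-- The action of matrices on the body algebra. -/
def mapA (A : Matrix (Fin n) (Fin n) ℝ) : BodyAlg n →ₐ[ℂ] BodyAlg n :=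
  AddMonoidAlgebra.mapDomainAlgHom ℂ ℂ
    ({ toFun := mapBody A, map_zero' := mapBody_zero A, map_add' := mapBody_add A } :
      Body n →+ Body n)

theorem mapA_br (A : Matrix (Fin n) (Fin n) ℝ) (K : Body n) : mapA A (br K) = br (mapBody A K) := by
  simp [mapA, br]

theorem ev_mapA (A : Matrix (Fin n) (Fin n) ℝ) (φ : Body n → ℂ) (a : BodyAlg n) :
    ev φ (mapA A a) = ev (fun K => φ (mapBody A K)) a := by
  induction a using bodyAlg_induction with
  | h0 => simp
  | hadd a b ha hb => rw [map_add, map_add, ha, hb, map_add]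
  | hs c L => rw [map_smul, map_smul, map_smul, mapA_br, ev_br, ev_br]

theorem mapA_mem (A : Matrix (Fin n) (Fin n) ℝ) {a : BodyAlg n} (ha : a ∈ augI n) :
    mapA A a ∈ augI n := by
  have h : augI n ≤ (augI n).comap (mapA A) := by
    refine Ideal.span_le.2 ?_
    rintro _ ⟨K, rfl⟩
    rw [SetLike.mem_coe, Ideal.mem_comap, map_sub, map_one, mapA_br]
    exact br_sub_one_mem _
  exact h ha

theorem suppA_mapA (A : Matrix (Fin n) (Fin n) ℝ) (a : BodyAlg n) (u : En n) :
    suppA (mapA A a) u = suppA a (Matrix.toEuclideanLin A.transpose u) := by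
  rw [suppA, ev_mapA]
  simp only [suppF_mapBody]
  rfl

theorem OMat_inv (g : Matrix.orthogonalGroup (Fin n) ℝ) : (OMat g⁻¹).transpose = OMat g := by
  have : OMat g⁻¹ = (OMat g).transpose := rfl
  rw [this, Matrix.transpose_transpose]

/-- The symbol is equivariant. -/
theorem symb_actValO {φ : Body n → ℂ} (hφ : φ ∈ ValI n (r + 1))
    (g : Matrix.orthogonalGroup (Fin n) ℝ) (F : MvPolynomial (Fin (r + 1) × Fin n) ℂ) :
    symb n (r + 1) (actValO g φ) F = symb n (r + 1) φ (rotQ _ g F) := by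
  suffices H : symb n (r + 1) (actValO g φ) =
      symb n (r + 1) φ ∘ₗ (rotQ (Fin (r + 1)) g).toLinearMap from LinearMap.congr_fun H F
  refine linearMap_ext_blk fun m => ?_
  rw [LinearMap.comp_apply, AlgHom.toLinearMap_apply, map_prod (rotQ _ g)]
  simp only [rotQ_blk]
  rw [symb_prod_blk, symb_prod_blk]
  have e : actValO g φ = fun K => φ (mapBody (OMat g⁻¹) K) := rfl
  rw [e, ← ev_mapA, map_prod (mapA _)]
  refine ev_prod_congr (isPolyHom_of_mem hφ) (fun k => mapA_mem _ (rep_mem _))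
    (fun k => rep_mem _) fun k u hu => ?_
  rw [suppA_mapA, OMat_inv, suppA_rep_sp _ ⟨u, hu⟩, sp_rotP]
  exact suppA_rep_sp _ ⟨rotS g u, (norm_rotS g u).trans hu⟩

end SymbolRelations

section FiniteDimensionality

variable {n r : ℕ}

open MvPolynomial (X C)

/-- A subspace on which the joint kernels of decreasing families of boundedly many functionals
become trivial is finite dimensional. -/
theorem finiteDimensional_of_bounded_functionals {V J : Type*} [AddCommGroup V] [Module ℂ V]
    [Fintype J] (H : Submodule ℂ V) (K : ℕ → Submodule ℂ V) (hK : Antitone K)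
    (h0 : ∀ x ∈ H, (∀ N, x ∈ K N) → x = 0) (E : ℕ → V →ₗ[ℂ] J → ℂ)
    (hE : ∀ N, ∀ x ∈ H, E N x = 0 → x ∈ K N) : FiniteDimensional ℂ H := by
  have key : Module.rank ℂ H ≤ (Fintype.card J : ℕ) := by
    refine rank_le fun s hs => ?_
    let S : Submodule ℂ H := Submodule.span ℂ (s : Set H)
    have : FiniteDimensional ℂ S := FiniteDimensional.span_finset ℂ s
    let L : ℕ → Submodule ℂ S := fun N => (K N).comap (H.subtype ∘ₗ S.subtype)
    have hL : Antitone L := fun a b h => Submodule.comap_mono (hK h)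
    obtain ⟨N, hN⟩ := IsArtinian.monotone_stabilizes
      (⟨fun N => OrderDual.toDual (L N), fun a b h => hL h⟩ : ℕ →o (Submodule ℂ S)ᵒᵈ)
    have hbot : ∀ x ∈ L N, x = 0 := fun x hx => by
      have : ((x : H) : V) = 0 := h0 _ (x : H).2 fun M => by
        rcases le_total N M with h | h
        · have e : L N = L M := hN M h
          rw [e] at hx
          exact hx
        · exact hL h hx
      exact Subtype.ext (Subtype.ext this)
    have hinj : Function.Injective (E N ∘ₗ H.subtype ∘ₗ S.subtype) := by
      rw [← LinearMap.ker_eq_bot, LinearMap.ker_eq_bot']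
      exact fun x hx => hbot x (hE N _ (x : H).2 hx)
    have h1 := LinearMap.finrank_le_finrank_of_injective hinj
    rwa [finrank_span_finset_eq_card hs, Module.finrank_fintype_fun_eq_card] at h1
  exact Module.rank_lt_aleph0_iff.1 (key.trans_lt (Cardinal.natCast_lt_aleph0))

/-- Powers of real linear forms span the homogeneous polynomials. -/
theorem eq_zero_of_linear_pow (S : MvPolynomial (Fin n) ℂ →ₗ[ℂ] ℂ) (N : ℕ)
    (h : ∀ v : Fin n → ℝ, S ((∑ b, C ((v b : ℝ) : ℂ) * X b) ^ N) = 0)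
    {f : MvPolynomial (Fin n) ℂ} (hf : f.IsHomogeneous N) : S f = 0 := by
  classical
  let c : (Fin n → ℕ) → ℂ := fun k => (Nat.multinomial Finset.univ k : ℂ) *
    S (MvPolynomial.monomial (Finsupp.equivFunOnFinite.symm k) 1)
  let Q : MvPolynomial (Fin n) ℂ := ∑ k ∈ Finset.univ.piAntidiag N,
    MvPolynomial.monomial (Finsupp.equivFunOnFinite.symm k) (c k)
  have hQ : Q = 0 := by
    refine MvPolynomial.funext_set (fun _ => Set.range ((↑) : ℝ → ℂ))
      (fun _ => Set.infinite_range_of_injective Complex.ofReal_injective) fun x hx => ?_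
    choose v hv using fun b => hx b (Set.mem_univ b)
    rw [map_zero, ← h v, Finset.sum_pow_eq_sum_piAntidiag, map_sum, map_sum]
    refine Finset.sum_congr rfl fun k _ => ?_
    rw [MvPolynomial.eval_monomial, Finsupp.prod_fintype _ _ (by simp)]
    have e : (Nat.multinomial Finset.univ k : MvPolynomial (Fin n) ℂ) *
        ∏ i, (C ((v i : ℝ) : ℂ) * X i) ^ k i =
        ((Nat.multinomial Finset.univ k : ℂ) * ∏ i, ((v i : ℝ) : ℂ) ^ k i) •
          MvPolynomial.monomial (Finsupp.equivFunOnFinite.symm k) 1 := by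
      rw [MvPolynomial.monomial_eq, Finsupp.prod_fintype _ _ (by simp), MvPolynomial.smul_eq_C_mul]
      simp only [mul_pow, Finset.prod_mul_distrib, map_mul, map_prod, map_pow, map_one, one_mul,
        map_natCast, Finsupp.coe_equivFunOnFinite_symm]
      ring
    rw [e, map_smul, smul_eq_mul]
    simp only [c, hv, Finsupp.coe_equivFunOnFinite_symm]
    ring
  have hmon : ∀ m : Fin n →₀ ℕ, ∑ i, m i = N → S (MvPolynomial.monomial m 1) = 0 := by
    intro m hm
    have hc : MvPolynomial.coeff m Q = c m := by
      rw [MvPolynomial.coeff_sum, Finset.sum_eq_single (m : Fin n → ℕ)]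
      · rw [MvPolynomial.coeff_monomial, if_pos (Finsupp.equivFunOnFinite_symm_coe m)]
      · intro k _ hk
        rw [MvPolynomial.coeff_monomial, if_neg]
        rintro rfl
        exact hk rfl
      · intro h'
        exact absurd (Finset.mem_piAntidiag.2 ⟨hm, fun i _ => Finset.mem_univ i⟩) h'
    rw [hQ, MvPolynomial.coeff_zero] at hc
    have h' := (mul_eq_zero.1 hc.symm).resolve_left
      (Nat.cast_ne_zero.2 (Nat.multinomial_pos Finset.univ m).ne')
    rwa [Finsupp.equivFunOnFinite_symm_coe] at h'
  rw [← MvPolynomial.support_sum_monomial_coeff f, map_sum]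
  refine Finset.sum_eq_zero fun m hm => ?_
  have hd : ∑ i, m i = N := by
    have := hf (MvPolynomial.mem_support_iff.1 hm)
    rwa [← Finsupp.degree_eq_sum, Finsupp.degree_eq_weight_one]
  have e : MvPolynomial.monomial m (MvPolynomial.coeff m f) =
      MvPolynomial.coeff m f • MvPolynomial.monomial m (1 : ℂ) := by
    rw [MvPolynomial.smul_monomial, smul_eq_mul, mul_one]
  rw [e, map_smul, hmon m hd, smul_zero]

theorem exists_orthogonal_row (a : Fin n) {v : En n} (hv : ‖v‖ = 1) :
    ∃ g : Matrix.orthogonalGroup (Fin n) ℝ, ∀ b, OMat g a b = v b := by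
  obtain ⟨B, hB⟩ := Orthonormal.exists_orthonormalBasis_extension_of_card_eq (𝕜 := ℝ)
    (E := En n) (ι := Fin n) (by simp) (v := fun _ => v) (s := {a}) (by
      rw [orthonormal_iff_ite]
      rintro ⟨i, hi⟩ ⟨j, hj⟩
      obtain rfl : i = a := hi
      obtain rfl : j = i := hj
      simp [Set.domRestrict, hv])
  refine ⟨⟨Matrix.of fun i b => B i b, ?_⟩, fun b => ?_⟩
  · rw [Matrix.mem_orthogonalGroup_iff]
    ext i j
    have := orthonormal_iff_ite.1 B.orthonormal i j
    simp only [PiLp.inner_apply, RCLike.inner_apply, conj_trivial] at this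
    simp only [Matrix.mul_apply, Matrix.of_apply, Matrix.one_apply]
    rw [← this]
    exact Finset.sum_congr rfl fun b _ => mul_comm _ _
  · change B a b = v b
    rw [hB a rfl]

/-- The polynomials in the differences of the blocks of variables. -/
def dif (n r : ℕ) :
    MvPolynomial (Fin r × Fin n) ℂ →ₐ[ℂ] MvPolynomial (Fin (r + 1) × Fin n) ℂ :=
  MvPolynomial.aeval fun pa => X (pa.1.succ, pa.2) - X (0, pa.2)

theorem eq_zero_of_blk_mul_dif (S : MvPolynomial (Fin (r + 1) × Fin n) ℂ →ₗ[ℂ] ℂ)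
    (h : ∀ f e, S (blk 0 f * dif n r e) = 0) : S = 0 := by
  have key : ∀ F f e, S (blk 0 f * dif n r e * F) = 0 := by
    intro F
    induction F using MvPolynomial.induction_on with
    | C c =>
      intro f e
      rw [mul_comm, ← MvPolynomial.smul_eq_C_mul, map_smul, h, smul_zero]
    | add F G hF hG =>
      intro f e
      rw [mul_add, map_add, hF, hG, add_zero]
    | mul_X F ka hF =>
      intro f e
      obtain ⟨k, a⟩ := ka
      have h0 : (X (0, a) : MvPolynomial (Fin (r + 1) × Fin n) ℂ) = blk 0 (X a) := by
        rw [blk, MvPolynomial.rename_X]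
      refine Fin.cases ?_ (fun p => ?_) k
      · have e1 : blk 0 f * dif n r e * (F * X (0, a)) = blk 0 (f * X a) * dif n r e * F := by
          rw [map_mul, h0]
          ring
        rw [e1, hF]
      · have hp : (X (p.succ, a) : MvPolynomial (Fin (r + 1) × Fin n) ℂ) =
            dif n r (X (p, a)) + blk 0 (X a) := by
          rw [← h0, dif, MvPolynomial.aeval_X, sub_add_cancel]
        have e1 : blk 0 f * dif n r e * (F * X (p.succ, a)) =
            blk 0 f * dif n r (e * X (p, a)) * F + blk 0 (f * X a) * dif n r e * F := by
          rw [map_mul, map_mul, hp]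
          ring
        rw [e1, map_add, hF, hF, add_zero]
  refine LinearMap.ext fun F => ?_
  simpa using key F 1 1

theorem symb_mul_dif_monomial {φ : Body n → ℂ} (hφ : φ ∈ ValI n (r + 1))
    {m : Fin r × Fin n →₀ ℕ} {pa : Fin r × Fin n} (hm : 6 ≤ m pa)
    (F : MvPolynomial (Fin (r + 1) × Fin n) ℂ) :
    symb n (r + 1) φ (F * dif n r (MvPolynomial.monomial m 1)) = 0 := by
  cases r with
  | zero => exact pa.1.elim0
  | succ q =>
    have e : (MvPolynomial.monomial m 1 : MvPolynomial (Fin (q + 1) × Fin n) ℂ) =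
        X pa ^ 6 * MvPolynomial.monomial (m - Finsupp.single pa 6) 1 := by
      rw [MvPolynomial.X_pow_eq_monomial, MvPolynomial.monomial_mul, one_mul,
        add_tsub_cancel_of_le (Finsupp.single_le_iff.2 hm)]
    rw [e, map_mul (dif n _), map_pow, mul_left_comm, dif, MvPolynomial.aeval_X]
    exact symb_sub_pow_six_mul hφ pa.1 pa.2 _

theorem rotQ_dif (g : Matrix.orthogonalGroup (Fin n) ℝ) (e : MvPolynomial (Fin r × Fin n) ℂ) :
    rotQ _ g (dif n r e) = dif n r (rotQ _ g e) := by
  suffices h : (rotQ _ g).comp (dif n r) = (dif n r).comp (rotQ _ g) from AlgHom.congr_fun h e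
  refine MvPolynomial.algHom_ext fun pa => ?_
  simp [rotQ, dif, MvPolynomial.algebraMap_eq, mul_sub]

theorem rotQ_rotQ_inv {ι : Type*} (g : Matrix.orthogonalGroup (Fin n) ℝ)
    (e : MvPolynomial (ι × Fin n) ℂ) : rotQ ι g (rotQ ι g⁻¹ e) = e := by
  suffices h : (rotQ ι g).comp (rotQ ι g⁻¹) = AlgHom.id ℂ _ from AlgHom.congr_fun h e
  refine MvPolynomial.algHom_ext fun ka => ?_
  have hg : ∀ c, ∑ b, OMat g⁻¹ ka.2 b * OMat g b c = if ka.2 = c then 1 else 0 := fun c => by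
    have h1 : OMat g⁻¹ * OMat g = 1 := congrArg OMat (inv_mul_cancel g)
    have := congrFun (congrFun h1 ka.2) c
    rwa [Matrix.mul_apply, Matrix.one_apply] at this
  rw [AlgHom.comp_apply, rotQ, rotQ, MvPolynomial.aeval_X, map_sum, AlgHom.id_apply]
  simp only [map_mul, MvPolynomial.algHom_C, MvPolynomial.algebraMap_eq, MvPolynomial.aeval_X,
    Finset.mul_sum]
  rw [Finset.sum_comm]
  simp only [← mul_assoc, ← Finset.sum_mul, ← map_mul, ← map_sum, ← Complex.ofReal_mul,
    ← Complex.ofReal_sum, hg]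
  rw [Finset.sum_eq_single ka.2]
  · rw [if_pos rfl, Complex.ofReal_one, map_one, one_mul]
  · intro c _ hc
    rw [if_neg hc.symm, Complex.ofReal_zero, map_zero, zero_mul]
  · exact fun h => absurd (Finset.mem_univ _) h

/-- The equivariant linear maps from a linear action to valuations of degree `i`. -/
def eqv {W : Type*} [AddCommGroup W] [Module ℂ W] (n i : ℕ)
    (ρ : Matrix.orthogonalGroup (Fin n) ℝ → W → W) :
    Submodule ℂ (W →ₗ[ℂ] (Body n → ℂ)) where
  carrier := {Θ | (∀ w, Θ w ∈ ValI n i) ∧ ∀ g w, Θ (ρ g w) = actValO g (Θ w)}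
  zero_mem' := ⟨fun _ => (ValI n i).zero_mem, fun _ _ => rfl⟩
  add_mem' := by
    rintro Θ Θ' ⟨h1, h2⟩ ⟨h1', h2'⟩
    refine ⟨fun w => (ValI n i).add_mem (h1 w) (h1' w), fun g w => ?_⟩
    rw [LinearMap.add_apply, h2, h2']
    rfl
  smul_mem' := by
    rintro c Θ ⟨h1, h2⟩
    refine ⟨fun w => (ValI n i).smul_mem c (h1 w), fun g w => ?_⟩
    rw [LinearMap.smul_apply, h2]
    rfl

section Equivariant

variable {W : Type*} [AddCommGroup W] [Module ℂ W]
  {ρ : Matrix.orthogonalGroup (Fin n) ℝ → W → W}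

/-- The functionals on equivariant maps attached to polynomials. -/
def fnl (n r : ℕ) (f : MvPolynomial (Fin n) ℂ) (e : MvPolynomial (Fin r × Fin n) ℂ) (w : W) :
    (W →ₗ[ℂ] (Body n → ℂ)) →ₗ[ℂ] ℂ :=
  (symb n (r + 1)).flip (blk 0 f * dif n r e) ∘ₗ LinearMap.applyₗ w

theorem fnl_apply (f : MvPolynomial (Fin n) ℂ) (e : MvPolynomial (Fin r × Fin n) ℂ) (w : W)
    (Θ : W →ₗ[ℂ] (Body n → ℂ)) :
    fnl n r f e w Θ = symb n (r + 1) (Θ w) (blk 0 f * dif n r e) := rfl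

theorem fnl_rotP {Θ : W →ₗ[ℂ] (Body n → ℂ)} (hΘ : Θ ∈ eqv n (r + 1) ρ)
    {f : MvPolynomial (Fin n) ℂ} (h : ∀ e w, fnl n r f e w Θ = 0)
    (g : Matrix.orthogonalGroup (Fin n) ℝ) (e : MvPolynomial (Fin r × Fin n) ℂ) (w : W) :
    fnl n r (rotP g f) e w Θ = 0 := by
  have h1 := h (rotQ _ g⁻¹ e) (ρ g w)
  rwa [fnl_apply, hΘ.2, symb_actValO (hΘ.1 w), map_mul, rotQ_blk, rotQ_dif, rotQ_rotQ_inv] at h1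

theorem fnl_eq_zero_of_small {κ : Type*} (B : Module.Basis κ ℂ W) {Θ : W →ₗ[ℂ] (Body n → ℂ)}
    (hΘ : Θ ∈ eqv n (r + 1) ρ) {f : MvPolynomial (Fin n) ℂ}
    (h : ∀ (m : Fin r × Fin n → Fin 6) (k : κ), fnl n r f (MvPolynomial.monomial
      (Finsupp.equivFunOnFinite.symm fun pa => (m pa : ℕ)) 1) (B k) Θ = 0)
    (e : MvPolynomial (Fin r × Fin n) ℂ) (w : W) : fnl n r f e w Θ = 0 := by
  have h1 : ∀ e k, fnl n r f e (B k) Θ = 0 := by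
    intro e k
    suffices H : symb n (r + 1) (Θ (B k)) ∘ₗ LinearMap.mulLeft ℂ (blk 0 f) ∘ₗ
        (dif n r).toLinearMap = 0 from LinearMap.congr_fun H e
    refine (MvPolynomial.basisMonomials _ ℂ).ext fun m => ?_
    rw [MvPolynomial.coe_basisMonomials]
    simp only [LinearMap.comp_apply, LinearMap.mulLeft_apply, AlgHom.toLinearMap_apply,
      LinearMap.zero_apply]
    by_cases hm : ∃ pa, 6 ≤ m pa
    · obtain ⟨pa, hm⟩ := hm
      exact symb_mul_dif_monomial (hΘ.1 _) hm _
    · push Not at hm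
      have := h (fun pa => ⟨m pa, hm pa⟩) k
      rwa [fnl_apply, show (Finsupp.equivFunOnFinite.symm fun pa => m pa) = m from
        Finsupp.equivFunOnFinite_symm_coe m] at this
  suffices H : (symb n (r + 1)).flip (blk 0 f * dif n r e) ∘ₗ Θ = 0 from LinearMap.congr_fun H w
  exact B.ext fun k => h1 e k

theorem fnl_homogeneous {Θ : W →ₗ[ℂ] (Body n → ℂ)} (hΘ : Θ ∈ eqv n (r + 1) ρ) (a : Fin n) {N : ℕ}
    (h : ∀ e w, fnl n r (X a ^ N) e w Θ = 0) {f : MvPolynomial (Fin n) ℂ} (hf : f.IsHomogeneous N)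
    (e : MvPolynomial (Fin r × Fin n) ℂ) (w : W) : fnl n r f e w Θ = 0 := by
  have key := eq_zero_of_linear_pow (symb n (r + 1) (Θ w) ∘ₗ
    LinearMap.mulRight ℂ (dif n r e) ∘ₗ (blk 0).toLinearMap) N ?_ hf
  · simpa only [fnl_apply, LinearMap.comp_apply, LinearMap.mulRight_apply,
      AlgHom.toLinearMap_apply] using key
  intro v
  obtain ⟨u, hu, hv⟩ : ∃ u : En n, ‖u‖ = 1 ∧ (WithLp.toLp 2 v : En n) =
      ‖(WithLp.toLp 2 v : En n)‖ • u := by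
    rcases eq_or_ne (WithLp.toLp 2 v : En n) 0 with h0 | h0
    · exact ⟨EuclideanSpace.single a 1, by simp, by simp [h0]⟩
    · exact exists_unit_smul _ h0
  obtain ⟨g, hg⟩ := exists_orthogonal_row a hu
  have e1 : (∑ b, C ((v b : ℝ) : ℂ) * X b : MvPolynomial (Fin n) ℂ) ^ N =
      (((‖(WithLp.toLp 2 v : En n)‖ : ℝ) : ℂ) ^ N) • rotP g (X a ^ N) := by
    rw [map_pow, ← smul_pow, rotP, MvPolynomial.aeval_X, Finset.smul_sum]
    congr 1
    refine Finset.sum_congr rfl fun b _ => ?_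
    have hb : v b = ‖(WithLp.toLp 2 v : En n)‖ * u b := congrArg (fun x : En n => x b) hv
    rw [hg, MvPolynomial.smul_eq_C_mul, ← mul_assoc, ← map_mul, ← Complex.ofReal_mul, ← hb]
  rw [e1, map_smul]
  have := fnl_rotP hΘ h g e w
  rw [fnl_apply] at this
  simp only [LinearMap.comp_apply, LinearMap.mulRight_apply, AlgHom.toLinearMap_apply]
  rw [this, smul_zero]

theorem fnl_homogeneous_le {Θ : W →ₗ[ℂ] (Body n → ℂ)} {N d k : ℕ}
    (h : ∀ f : MvPolynomial (Fin n) ℂ, f.IsHomogeneous N → ∀ e w, fnl n r f e w Θ = 0)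
    (hd : d + 2 * k = N) {f : MvPolynomial (Fin n) ℂ} (hf : f.IsHomogeneous d)
    (e : MvPolynomial (Fin r × Fin n) ℂ) (w : W) : fnl n r f e w Θ = 0 := by
  let Q : MvPolynomial (Fin n) ℂ := ∑ a, X a ^ 2
  have hQ : Q.IsHomogeneous 2 :=
    MvPolynomial.IsHomogeneous.sum _ _ _ fun a _ => MvPolynomial.isHomogeneous_X_pow a 2
  have hQ1 : sp n Q = 1 := by
    ext u
    have h1 := u.2
    have h2 : ∑ a, u.1 a ^ 2 = 1 := by
      rw [← EuclideanSpace.real_norm_sq_eq, h1, one_pow]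
    simp only [Q, map_sum, map_pow, sp_X, Finset.sum_apply, Pi.pow_apply, Pi.one_apply]
    exact_mod_cast h2
  have e1 : sp n f = sp n (f * Q ^ k) := by rw [map_mul, map_pow, hQ1, one_pow, mul_one]
  rw [fnl_apply, symb_blk_mul_congr _ _ e1, ← fnl_apply]
  exact h _ (hd ▸ hf.mul (hQ.pow k)) e w

/-- The space of equivariant linear maps from a finite dimensional space to valuations of
positive degree is finite dimensional. -/
theorem finiteDimensional_eqv_succ [FiniteDimensional ℂ W] (hn : 0 < n) :
    FiniteDimensional ℂ (eqv n (r + 1) ρ) := by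
  let B := Module.finBasis ℂ W
  let a : Fin n := ⟨0, hn⟩
  let K : ℕ → Submodule ℂ (W →ₗ[ℂ] (Body n → ℂ)) := fun N =>
    ⨅ d ∈ Set.Iic N, ⨅ (f : MvPolynomial (Fin n) ℂ) (_ : f.IsHomogeneous d), ⨅ e, ⨅ w,
      LinearMap.ker (fnl n r f e w)
  have hK : ∀ N Θ, Θ ∈ K N ↔ ∀ d ≤ N, ∀ f : MvPolynomial (Fin n) ℂ, f.IsHomogeneous d →
      ∀ e w, fnl n r f e w Θ = 0 := fun N Θ => by
    simp only [K, Submodule.mem_iInf, LinearMap.mem_ker, Set.mem_Iic]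
  refine finiteDimensional_of_bounded_functionals
    (J := Fin 2 × (Fin r × Fin n → Fin 6) × Fin (Module.finrank ℂ W)) _ K ?_ ?_
    (fun N => LinearMap.pi fun j => fnl n r (X a ^ (N + j.1.val)) (MvPolynomial.monomial
      (Finsupp.equivFunOnFinite.symm fun pa => (j.2.1 pa : ℕ)) 1) (B j.2.2)) ?_
  · intro M N hMN Θ hΘ
    rw [hK] at hΘ ⊢
    exact fun d hd => hΘ d (hd.trans hMN)
  · intro Θ hΘ h
    have hw : ∀ w, Θ w = 0 := fun w => by
      refine eq_zero_of_symb_eq_zero (hΘ.1 w) (eq_zero_of_blk_mul_dif _ fun f e => ?_)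
      rw [← MvPolynomial.sum_homogeneousComponent f, map_sum, Finset.sum_mul, map_sum]
      exact Finset.sum_eq_zero fun d _ => (hK d Θ).1 (h d) d le_rfl _
        (MvPolynomial.homogeneousComponent_isHomogeneous d f) e w
    exact LinearMap.ext hw
  · intro N Θ hΘ h
    have h2 : ∀ j : Fin 2, ∀ f : MvPolynomial (Fin n) ℂ, f.IsHomogeneous (N + j.val) →
        ∀ e w, fnl n r f e w Θ = 0 := fun j f hf e w =>
      by
      refine fnl_homogeneous hΘ a (fnl_eq_zero_of_small B hΘ fun m k => ?_) hf e w
      have := congrFun h (j, m, k)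
      rwa [LinearMap.pi_apply] at this
    rw [hK]
    intro d hd f hf e w
    rcases Nat.even_or_odd' (N - d) with ⟨k, hk | hk⟩
    · exact fnl_homogeneous_le (k := k) (h2 0) (by simp; omega) hf e w
    · exact fnl_homogeneous_le (k := k + 1) (h2 1) (by simp; omega) hf e w

theorem apply_eq_of_mem_valI_zero {φ : Body n → ℂ} (hφ : φ ∈ ValI n 0) (K : Body n) : φ K = φ 0 := by
  have h1 : Tendsto (fun t : ℝ => φ (t • K)) (𝓝[>] 0) (𝓝 (φ 0)) := by
    have := (hφ.1.1.comp (continuous_smul_body K)).tendsto 0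
    rw [Function.comp_apply, zero_smul_body] at this
    exact this.mono_left nhdsWithin_le_nhds
  have h2 : (fun t : ℝ => φ (t • K)) =ᶠ[𝓝[>] 0] fun _ => φ K := by
    filter_upwards [self_mem_nhdsWithin] with t ht
    have := hφ.2 t ht K
    rwa [pow_zero, one_smul, scaleBody_eq] at this
  exact tendsto_nhds_unique (tendsto_const_nhds.congr' h2.symm) h1

theorem finiteDimensional_eqv [FiniteDimensional ℂ W] (hn : 0 < n) (i : ℕ) :
    FiniteDimensional ℂ (eqv n i ρ) := by
  cases i with
  | succ r => exact finiteDimensional_eqv_succ hn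
  | zero =>
    let T : eqv n 0 ρ →ₗ[ℂ] (W →ₗ[ℂ] ℂ) :=
      (LinearMap.llcomp ℂ W (Body n → ℂ) ℂ (LinearMap.proj 0)) ∘ₗ (eqv n 0 ρ).subtype
    refine FiniteDimensional.of_injective T fun Θ Θ' h => ?_
    ext w K
    rw [apply_eq_of_mem_valI_zero (Θ.2.1 w) K, apply_eq_of_mem_valI_zero (Θ'.2.1 w) K]
    exact LinearMap.congr_fun h w

end Equivariant

end FiniteDimensionality

section TensorProducts

variable {n i j : ℕ}

open TensorProduct

theorem lift_biProd_tmul (φ : ValIf n i) (ψ : ValIf n j) :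
    TensorProduct.lift (biProd n i j) (φ ⊗ₜ[ℂ] ψ) =
      fun K L => (φ : Body n → ℂ) K * (ψ : Body n → ℂ) L := rfl

theorem injective_lift_biProd : Function.Injective (TensorProduct.lift (biProd n i j)) := by
  suffices H : ∀ x, TensorProduct.lift (biProd n i j) x = 0 → x = 0 by
    intro x y h
    refine sub_eq_zero.1 (H _ ?_)
    have h1 := map_add (TensorProduct.lift (biProd n i j)) (x - y) y
    rwa [sub_add_cancel, h, right_eq_add] at h1
  intro x hx
  let B := Module.Basis.ofVectorSpace ℂ (ValIf n i)
  obtain ⟨b, rfl⟩ := TensorProduct.eq_repr_basis_left B x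
  have hb : b = 0 := by
    ext k L
    have hL : Finsupp.linearCombination ℂ B (b.mapRange (fun ψ : ValIf n j => (ψ : Body n → ℂ) L) rfl) = 0 := by
      ext K
      have := congrFun (congrFun hx K) L
      rw [Finsupp.sum, map_sum] at this
      rw [Finsupp.linearCombination_apply, Finsupp.sum_mapRange_index (by simp), Finsupp.sum]
      simpa [biProd, Finset.sum_apply, mul_comm] using this
    have := DFunLike.congr_fun (linearIndependent_iff.1 B.linearIndependent _ hL) k
    simpa using this
  rw [hb, Finsupp.sum_zero_index]

theorem mul_mem_bValIJf {φ ψ : Body n → ℂ} (hφ : φ ∈ ValIf n i) (hψ : ψ ∈ ValIf n j) :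
    (fun K L => φ K * ψ L) ∈ BValIJf n i j := by
  obtain ⟨⟨⟨hc, hv, ht⟩, hh⟩, hf⟩ := hφ
  obtain ⟨⟨⟨hc', hv', ht'⟩, hh'⟩, hf'⟩ := hψ
  refine ⟨⟨(hc.comp continuous_fst).mul (hc'.comp continuous_snd),
    ⟨fun L K K' U I hU hI => ?_, fun K L L' U I hU hI => ?_⟩, fun x y K L => ?_⟩,
    fun t s h1 h2 K L => ?_, ?_⟩
  · have := hv K K' U I hU hI
    linear_combination ψ L * this
  · have := hv' L L' U I hU hI
    linear_combination φ K * this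
  · beta_reduce
    rw [ht, ht']
  · beta_reduce
    rw [hh t h1, hh' s h2, smul_mul_smul_comm]
  · let M : (Body n → ℂ) →ₗ[ℂ] (Body n → ℂ) →ₗ[ℂ] (Body n → Body n → ℂ) :=
      LinearMap.mk₂ ℂ (fun φ ψ K L => φ K * ψ L)
        (fun _ _ _ => by ext; simp [add_mul]) (fun _ _ _ => by ext; simp [mul_assoc])
        (fun _ _ _ => by ext; simp [mul_add]) (fun _ _ _ => by ext; simp [mul_left_comm])
    have := Module.Finite.iff_fg.2
      (Submodule.FG.map₂ M (Module.Finite.iff_fg.1 hf) (Module.Finite.iff_fg.1 hf'))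
    refine Submodule.finiteDimensional_of_le (S₂ := Submodule.map₂ M
      (Submodule.span ℂ (Set.range fun g => actValO g φ))
      (Submodule.span ℂ (Set.range fun g => actValO g ψ))) (Submodule.span_le.2 ?_)
    rintro _ ⟨⟨g, h⟩, rfl⟩
    exact Submodule.apply_mem_map₂ M (Submodule.subset_span ⟨g, rfl⟩)
      (Submodule.subset_span ⟨h, rfl⟩)

theorem range_lift_biProd_le :
    LinearMap.range (TensorProduct.lift (biProd n i j)) ≤ BValIJf n i j := by
  rintro _ ⟨x, rfl⟩
  induction x using TensorProduct.induction_on with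
  | zero => rw [map_zero]; exact zero_mem _
  | tmul φ ψ => exact mul_mem_bValIJf φ.2 ψ.2
  | add x y hx hy => rw [map_add]; exact add_mem hx hy

/-- A function of two variables whose sections lie in a finite dimensional space is a finite sum
of products. -/
theorem exists_sum_mul {Y Z : Type*} (f : Y → Z → ℂ) (V : Submodule ℂ (Y → ℂ))
    [FiniteDimensional ℂ V] (B : Submodule ℂ (Z → ℂ)) (hV : ∀ z, (fun y => f y z) ∈ V)
    (hB : ∀ y, f y ∈ B) :
    ∃ (m : ℕ) (e : Fin m → V) (ψ : Fin m → B),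
      f = ∑ k, fun y z => (e k : Y → ℂ) y * (ψ k : Z → ℂ) z := by
  let b := Module.finBasis ℂ V
  let s : Z → V := fun z => ⟨fun y => f y z, hV z⟩
  let δ : Y → V →ₗ[ℂ] ℂ := fun y => LinearMap.proj y ∘ₗ V.subtype
  have key : ∀ l : V →ₗ[ℂ] ℂ, (fun z => l (s z)) ∈ B := by
    intro l
    have hl : l ∈ Submodule.span ℂ (Set.range δ) := by
      refine FiniteDimensional.mem_span_of_iInf_ker_le_ker fun v hv => ?_
      have h0 : v = 0 := by
        ext y
        exact (Submodule.mem_iInf _).1 hv y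
      rw [h0]
      exact zero_mem _
    refine Submodule.span_induction ?_ ?_ ?_ ?_ hl
    · rintro _ ⟨y, rfl⟩
      exact hB y
    · exact zero_mem B
    · exact fun l l' _ _ h h' => add_mem h h'
    · exact fun c l _ h => B.smul_mem c h
  refine ⟨_, b, fun k => ⟨fun z => b.coord k (s z), key _⟩, ?_⟩
  ext y z
  have h1 := congrArg (fun v : V => (v : Y → ℂ) y) (b.sum_repr (s z))
  simp only [Submodule.coe_sum, Submodule.coe_smul, Finset.sum_apply, Pi.smul_apply,
    smul_eq_mul] at h1
  rw [Finset.sum_apply, Finset.sum_apply]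
  simp only [Module.Basis.coord_apply]
  rw [show f y z = (s z : Y → ℂ) y from rfl, ← h1]
  exact Finset.sum_congr rfl fun k _ => mul_comm _ _

theorem mapBody_one (K : Body n) : mapBody 1 K = K :=
  body_ext fun u _ => by rw [suppF_mapBody, Matrix.transpose_one, Matrix.toLpLin_one]; rfl

theorem mapBody_mul (A A' : Matrix (Fin n) (Fin n) ℝ) (K : Body n) :
    mapBody A (mapBody A' K) = mapBody (A * A') K :=
  body_ext fun u _ => by
    rw [suppF_mapBody, suppF_mapBody, suppF_mapBody, Matrix.transpose_mul, Matrix.toLpLin_mul]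
    rfl

theorem actBValOO_actBValOO (g g' h h' : Matrix.orthogonalGroup (Fin n) ℝ)
    (φ : Body n → Body n → ℂ) :
    actBValOO g h (actBValOO g' h' φ) = actBValOO (g * g') (h * h') φ := by
  have e : ∀ (k k' : Matrix.orthogonalGroup (Fin n) ℝ) (K : Body n),
      rotBodyO k'⁻¹ (rotBodyO k⁻¹ K) = rotBodyO (k * k')⁻¹ K := fun k k' K => by
    rw [rotBodyO, rotBodyO, mapBody_mul, rotBodyO, mul_inv_rev]
    rfl
  ext K L
  simp only [actBValOO, e]

theorem rotBodyO_one_inv (K : Body n) : rotBodyO 1⁻¹ K = K := by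
  rw [inv_one]
  exact mapBody_one K

/-- The span of the orbit of a bivaluation. -/
def orb (φ : Body n → Body n → ℂ) : Submodule ℂ (Body n → Body n → ℂ) :=
  Submodule.span ℂ (Set.range fun p :
    Matrix.orthogonalGroup (Fin n) ℝ × Matrix.orthogonalGroup (Fin n) ℝ => actBValOO p.1 p.2 φ)

theorem mem_orb (φ : Body n → Body n → ℂ) (g h : Matrix.orthogonalGroup (Fin n) ℝ) :
    actBValOO g h φ ∈ orb φ := Submodule.subset_span ⟨(g, h), rfl⟩

theorem self_mem_orb (φ : Body n → Body n → ℂ) : φ ∈ orb φ := by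
  have := mem_orb φ 1 1
  rwa [show actBValOO 1 1 φ = φ from by ext K L; simp only [actBValOO, rotBodyO_one_inv]] at this

theorem actBValOO_mem_orb {φ w : Body n → Body n → ℂ} (hw : w ∈ orb φ)
    (g h : Matrix.orthogonalGroup (Fin n) ℝ) : actBValOO g h w ∈ orb φ := by
  refine Submodule.span_induction ?_ ?_ ?_ ?_ hw
  · rintro _ ⟨p, rfl⟩
    beta_reduce
    rw [actBValOO_actBValOO]
    exact mem_orb _ _ _
  · exact zero_mem _
  · exact fun x y _ _ hx hy => add_mem hx hy
  · exact fun c x _ hx => Submodule.smul_mem _ c hx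

theorem scaleBody_one (K : Body n) : scaleBody 1 K = K := by
  rw [scaleBody_eq]
  exact ConvexBody.ext (one_smul ℝ (K : Set (En n)))

theorem transBody_zero (K : Body n) : transBody 0 K = K :=
  ConvexBody.ext (by simp [transBody])

theorem section_left_mem {φ : Body n → Body n → ℂ} (hφ : φ ∈ BValSub n) (hh : IsBihomog i j φ)
    (L : Body n) : (fun K => φ K L) ∈ ValI n i := by
  obtain ⟨hc, hv, ht⟩ := hφ
  refine ⟨⟨hc.comp (Continuous.prodMk continuous_id continuous_const), hv.1 L, fun x K => ?_⟩,
    fun t ht0 K => ?_⟩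
  · have := ht x 0 K L
    rwa [transBody_zero] at this
  · have := hh t 1 ht0 one_pos K L
    rwa [scaleBody_one, one_pow, mul_one] at this

theorem section_right_mem {φ : Body n → Body n → ℂ} (hφ : φ ∈ BValSub n) (hh : IsBihomog i j φ)
    (K : Body n) : φ K ∈ ValI n j := by
  obtain ⟨hc, hv, ht⟩ := hφ
  refine ⟨⟨hc.comp (Continuous.prodMk continuous_const continuous_id), hv.2 K, fun x L => ?_⟩,
    fun t ht0 L => ?_⟩
  · have := ht 0 x K L
    rwa [transBody_zero] at this
  · have := hh 1 t one_pos ht0 K L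
    rwa [scaleBody_one, one_pow, one_mul] at this

theorem toEuclideanLin_OMat_injective (g : Matrix.orthogonalGroup (Fin n) ℝ) :
    Function.Injective (Matrix.toEuclideanLin (OMat g)) :=
  (injective_iff_map_eq_zero (Matrix.toEuclideanLin (OMat g))).2 fun u hu => by
    rw [← norm_eq_zero, ← norm_rotS g u, rotS, hu, norm_zero]

theorem continuous_rotBodyO_inv (g : Matrix.orthogonalGroup (Fin n) ℝ) :
    Continuous (rotBodyO g⁻¹ : Body n → Body n) :=
  (LipschitzWith.of_dist_le_mul (K := 1) fun K L => dist_le_of_suppF (by positivity) fun u hu => by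
    rw [rotBodyO, rotBodyO, suppF_mapBody, suppF_mapBody, OMat_inv]
    refine (suppF_sub_le_dist K L _).trans ?_
    rw [show ‖Matrix.toEuclideanLin (OMat g) u‖ = 1 from (norm_rotS g u).trans hu]
    simp).continuous

theorem actValO_mem_valI {φ : Body n → ℂ} (hφ : φ ∈ ValI n i)
    (g : Matrix.orthogonalGroup (Fin n) ℝ) : actValO g φ ∈ ValI n i := by
  obtain ⟨⟨hc, hv, ht⟩, hh⟩ := hφ
  refine ⟨⟨hc.comp (continuous_rotBodyO_inv g), fun K L U I hU hI => hv _ _ _ _ ?_ ?_,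
    fun x K => ?_⟩, fun t ht0 K => ?_⟩
  · exact (congrArg _ hU).trans (Set.image_union _ _ _)
  · exact (congrArg _ hI).trans (Set.image_inter (toEuclideanLin_OMat_injective g⁻¹))
  · have e : rotBodyO g⁻¹ (transBody x K) =
        transBody (Matrix.toEuclideanLin (OMat g⁻¹) x) (rotBodyO g⁻¹ K) := by
      refine ConvexBody.ext ?_
      change _ '' (_ '' _) = _ '' (_ '' _)
      simp only [Set.image_image, map_add]
    rw [actValO, e, ht, actValO]
  · have e : rotBodyO g⁻¹ (scaleBody t K) = scaleBody t (rotBodyO g⁻¹ K) := by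
      refine ConvexBody.ext ?_
      change _ '' (_ '' _) = _ '' (_ '' _)
      simp only [Set.image_image, map_smul]
    rw [actValO, e, hh t ht0, actValO]

theorem section_left_mem_of_orb {φ w : Body n → Body n → ℂ} (hφ : φ ∈ BValSub n)
    (hh : IsBihomog i j φ) (hw : w ∈ orb φ) (L : Body n) : (fun K => w K L) ∈ ValI n i := by
  refine Submodule.span_induction ?_ ?_ ?_ ?_ hw
  · rintro _ ⟨p, rfl⟩
    exact actValO_mem_valI (section_left_mem hφ hh (rotBodyO p.2⁻¹ L)) p.1
  · exact zero_mem _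
  · exact fun x y _ _ hx hy => add_mem hx hy
  · exact fun c x _ hx => Submodule.smul_mem _ c hx

theorem le_range_lift_biProd (hn : 0 < n) :
    BValIJf n i j ≤ LinearMap.range (TensorProduct.lift (biProd n i j)) := by
  rintro φ ⟨hφ, hh, hfin⟩
  have hW : FiniteDimensional ℂ (orb φ) := hfin
  let ρ : Matrix.orthogonalGroup (Fin n) ℝ → orb φ → orb φ := fun g w =>
    ⟨actBValOO g 1 w, actBValOO_mem_orb w.2 g 1⟩
  have hE : FiniteDimensional ℂ (eqv n i ρ) := finiteDimensional_eqv hn i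
  let V := (eqv n i ρ).map (LinearMap.applyₗ (⟨φ, self_mem_orb φ⟩ : orb φ))
  have hV : V ≤ ValIf n i := by
    rintro _ ⟨Θ, hΘ, rfl⟩
    refine ⟨hΘ.1 _, ?_⟩
    refine Submodule.finiteDimensional_of_le (S₂ := LinearMap.range Θ) (Submodule.span_le.2 ?_)
    rintro _ ⟨g, rfl⟩
    exact ⟨_, hΘ.2 g _⟩
  have hR : ∀ K, φ K ∈ ValIf n j := by
    intro K
    refine ⟨section_right_mem hφ hh K, ?_⟩
    refine Submodule.finiteDimensional_of_le (S₂ := (orb φ).map (LinearMap.proj K))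
      (Submodule.span_le.2 ?_)
    rintro _ ⟨g, rfl⟩
    refine ⟨_, mem_orb φ 1 g, ?_⟩
    ext L
    simp only [LinearMap.proj_apply, actBValOO, actValO, rotBodyO_one_inv]
  let ev : Body n → orb φ →ₗ[ℂ] (Body n → ℂ) := fun L =>
    { toFun := fun w K => (w : Body n → Body n → ℂ) K L
      map_add' := fun _ _ => rfl
      map_smul' := fun _ _ => rfl }
  have hL : ∀ L, (fun K => φ K L) ∈ V := fun L =>
    ⟨ev L, ⟨fun w => section_left_mem_of_orb hφ hh w.2 L, fun g w => by
      ext K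
      simp only [ev, ρ, LinearMap.coe_mk, AddHom.coe_mk, actBValOO, actValO,
        rotBodyO_one_inv]⟩, rfl⟩
  obtain ⟨m, e, ψ, h⟩ := exists_sum_mul φ V (ValIf n j) hL hR
  rw [h]
  exact sum_mem fun k _ => ⟨(⟨e k, hV (e k).2⟩ : ValIf n i) ⊗ₜ[ℂ] ψ k, lift_biProd_tmul _ _⟩

end TensorProducts

end BodyVal

/-- **Proposition 6.3.** The map `ι : Val_i^f ⊗ Val_j^f → BVal_{i,j}^f` induced by
`ι(φ ⊗ ψ)(K,L) = φ(K)ψ(L)` is an isomorphism of `O(n) × O(n)` modules: it is injective,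
its range is exactly `BVal_{i,j}^f`, and it is equivariant. -/
theorem tensor_product_bivaluations (n i j : ℕ) (hn : 3 ≤ n) (hi : i ≤ n) (hj : j ≤ n) :
    Function.Injective (TensorProduct.lift (biProd n i j)) ∧
    LinearMap.range (TensorProduct.lift (biProd n i j)) = BValIJf n i j ∧
    ∀ (g h : Matrix.orthogonalGroup (Fin n) ℝ) (φ : ValIf n i) (ψ : ValIf n j)
      (hgφ : actValO g (φ : Body n → ℂ) ∈ ValIf n i)
      (hhψ : actValO h (ψ : Body n → ℂ) ∈ ValIf n j),
      TensorProduct.lift (biProd n i j)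
          ((⟨actValO g (φ : Body n → ℂ), hgφ⟩ : ValIf n i) ⊗ₜ[ℂ]
            (⟨actValO h (ψ : Body n → ℂ), hhψ⟩ : ValIf n j)) =
        actBValOO g h (TensorProduct.lift (biProd n i j) (φ ⊗ₜ[ℂ] ψ)) := by
  refine ⟨BodyVal.injective_lift_biProd, le_antisymm BodyVal.range_lift_biProd_le
    (BodyVal.le_range_lift_biProd (by omega)), fun g h φ ψ _ _ => rfl⟩
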